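/- Fix N ∈ ℕ and 0 < β_* < β^*. There exist C' > 0 and ν* > 0 such that for all β ∈ [β_*, β^*], 0 < ν ≤ ν*, and every smooth function P on (0,∞) satisfying |P(ζ)| + |ζ ∂_ζ P(ζ)| ≤ (ν²/|ln ν|) ζ²/(ν² + ζ²)² for all ζ > 0, the following holds. For each 0 ≤ n ≤ N there exist an eigenvalue λ_{n,ν} of 𝒜^ζ of the form λ_{n,ν} = 2β(1 − n + 1/(2 ln ν) + O(1/|ln ν|²)), with nonzero eigenfunction φ_{n,ν} ∈ L²((0,∞), (ω_ν/ζ) dζ), and an eigenvalue λ̄_{n,ν} of the perturbed operator 𝒜̄^ζ = 𝒜^ζ + ζ^{−1} ∂_ζ (P ·), with nonzero eigenfunction φ̄_{n,ν} ∈ L²((0,∞), (ω_ν/ζ) dζ), such that |λ̄_{n,ν} − λ_{n,ν}| ≤ C'/|ln ν|² and ‖φ̄_{n,ν} − φ_{n,ν}‖_{L²(ω_ν/ζ)} / ‖φ_{n,ν}‖_{L²(ω_ν/ζ)} ≤ C'/√|ln ν|. -/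

import Mathlib

open Real Set MeasureTheory

/-- `Q_ν(ζ) = 4ζ²/(ζ²+ν²)`. -/
noncomputable def Qnu (ν ζ : ℝ) : ℝ := 4 * ζ ^ 2 / (ζ ^ 2 + ν ^ 2)

/-- `U_ν(ζ) = 8ν²/(ν²+ζ²)²`. -/
noncomputable def Unu (ν ζ : ℝ) : ℝ := 8 * ν ^ 2 / (ν ^ 2 + ζ ^ 2) ^ 2

/-- The operator `𝒜^ζ f = f'' − f'/ζ + (Q_ν/ζ) f' + (∂_ζ Q_ν /ζ) f − β ζ f'`. -/
noncomputable def Azeta (ν β : ℝ) (f : ℝ → ℝ) (ζ : ℝ) : ℝ :=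
  deriv (deriv f) ζ - deriv f ζ / ζ + Qnu ν ζ * deriv f ζ / ζ
    + deriv (Qnu ν) ζ * f ζ / ζ - β * ζ * deriv f ζ

/-- The perturbed operator `𝒜̄^ζ f = 𝒜^ζ f + ζ⁻¹ ∂_ζ (P f)`. -/
noncomputable def AzetaBar (ν β : ℝ) (P f : ℝ → ℝ) (ζ : ℝ) : ℝ :=
  Azeta ν β f ζ + deriv (fun s => P s * f s) ζ / ζ

/-- The weight `ω_ν(ζ) = (ν²/U_ν(ζ)) e^{−βζ²/2}`. -/
noncomputable def omegaNu (ν β ζ : ℝ) : ℝ := ν ^ 2 / Unu ν ζ * Real.exp (-β * ζ ^ 2 / 2)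

/-- The norm of `L²((0,∞), (ω_ν/ζ) dζ)`. -/
noncomputable def nrm (ν β : ℝ) (f : ℝ → ℝ) : ℝ :=
  Real.sqrt (∫ ζ in Set.Ioi (0:ℝ), (f ζ) ^ 2 * (omegaNu ν β ζ / ζ))

lemma poly_antideriv (p : Polynomial ℝ) :
    ∃ q : Polynomial ℝ, Polynomial.derivative q = p ∧ q.eval 0 = 0 := by
  induction p using Polynomial.induction_on' with
  | add p q hp hq =>
    obtain ⟨a, ha, ha0⟩ := hp
    obtain ⟨b, hb, hb0⟩ := hq
    exact ⟨a + b, by simp [ha, hb], by simp [ha0, hb0]⟩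
  | monomial n c =>
    refine ⟨Polynomial.monomial (n+1) (c / (n+1)), ?_, by simp⟩
    rw [Polynomial.derivative_monomial]
    have : ((n:ℝ)+1) ≠ 0 := by positivity
    simp
    field_simp

lemma lag_exists (n : ℕ) : ∃ A M : Polynomial ℝ, A.eval 0 = 1 ∧
    Polynomial.X * Polynomial.derivative (Polynomial.derivative A)
      + (1 - Polynomial.X) * Polynomial.derivative A + Polynomial.C (n:ℝ) * A = 0 ∧
    M.eval 0 = 1 ∧ Polynomial.derivative M = M - A ^ 2 ∧ ∀ s, 0 ≤ M.eval s := by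
  induction n with
  | zero => exact ⟨1, 1, by simp, by simp, by simp, by simp, by simp⟩
  | succ n ih =>
    obtain ⟨A, M, hA0, hA, hM0, hM, hMp⟩ := ih
    obtain ⟨I, hI, hI0⟩ := poly_antideriv A
    refine ⟨A - I, M + I ^ 2, by simp [hA0, hI0], ?_, by simp [hM0, hI0], ?_, ?_⟩
    · set E := Polynomial.X * Polynomial.derivative (Polynomial.derivative (A - I))
        + (1 - Polynomial.X) * Polynomial.derivative (A - I)
        + Polynomial.C ((n+1 : ℕ):ℝ) * (A - I) with hE
      have hd : Polynomial.derivative E = 0 := by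
        have h2 := congrArg Polynomial.derivative hA
        rw [hE]
        simp [hI] at h2 hA ⊢
        linear_combination h2 - hA
      have hc := Polynomial.eq_C_of_derivative_eq_zero hd
      have h0 : E.eval 0 = 0 := by
        have h2 := congrArg (Polynomial.eval 0) hA
        rw [hE]
        simp [hI, hA0, hI0] at h2 ⊢
        linear_combination h2
      rw [hc] at h0 ⊢
      simp at h0
      simp [h0]
    · have : (Polynomial.C (2:ℝ)) = 2 := rfl
      simp [hI, hM, Polynomial.derivative_pow, this]
      ring
    · intro s
      have := hMp s
      simp
      positivity

lemma poly_exp_bound (p : Polynomial ℝ) : ∃ C : ℝ, 0 ≤ C ∧ ∀ s : ℝ, 0 ≤ s → |p.eval s| ≤ C * exp (s/8) := by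
  induction p using Polynomial.induction_on' with
  | add p q hp hq =>
    obtain ⟨a, ha, ha0⟩ := hp
    obtain ⟨b, hb, hb0⟩ := hq
    refine ⟨a + b, by positivity, fun s hs => ?_⟩
    have h1 := ha0 s hs
    have h2 := hb0 s hs
    rw [Polynomial.eval_add]
    exact (abs_add_le _ _).trans (by linarith)
  | monomial n c =>
    refine ⟨|c| * (8^n * n.factorial), by positivity, fun s hs => ?_⟩
    have := Real.pow_div_factorial_le_exp (s/8) (by positivity) n
    rw [div_le_iff₀ (by positivity), div_pow, div_le_iff₀ (by positivity)] at this
    simp [abs_mul, abs_of_nonneg hs]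
    calc |c| * s^n ≤ |c| * (exp (s/8) * n.factorial * 8^n) := by gcongr
      _ = _ := by ring

/-- Laguerre data. -/
structure LData (n : ℕ) (L L1 M : ℝ → ℝ) (C S1 : ℝ) : Prop where
  dL : ∀ s, HasDerivAt L (L1 s) s
  dL1 : ∀ s, 0 < s → HasDerivAt L1 ((-(1-s) * L1 s - n * L s)/s) s
  L0 : L 0 = 1
  C1 : 1 ≤ C
  bL : ∀ s, 0 ≤ s → |L s| ≤ C * exp (s/8)
  bL1 : ∀ s, 0 ≤ s → |L1 s| ≤ C * exp (s/8)
  bM : ∀ s, 0 ≤ s → |M s| ≤ C * exp (s/8)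
  dM : ∀ s, HasDerivAt M (M s - L s ^ 2) s
  M0 : M 0 = 1
  Mp : ∀ s, 0 ≤ M s
  S11 : 1 ≤ S1
  nz : ∀ s, S1 ≤ s → L s ≠ 0
  b8 : ∀ s, S1 ≤ s → |L1 s| ≤ |L s| / 8
  eM : exp (-S1) * M S1 ≤ 1/4
  eL : 4 * L S1 ^ 2 ≤ exp S1

lemma ldata_exists (n : ℕ) : ∃ L L1 M C S1, LData n L L1 M C S1 := by
  obtain ⟨A, M, hA0, hA, hM0, hM, hMp⟩ := lag_exists n
  obtain ⟨C1, hC1, h1⟩ := poly_exp_bound A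
  obtain ⟨C2, hC2, h2⟩ := poly_exp_bound (Polynomial.derivative A)
  obtain ⟨C3, hC3, h3⟩ := poly_exp_bound M
  set C := 1 + C1 + C2 + C3 with hC
  have hAne : A ≠ 0 := by rintro rfl; simp at hA0
  have b1 : ∀ s, 0 ≤ s → |A.eval s| ≤ C * exp (s/8) := fun s hs => (h1 s hs).trans (by gcongr; linarith)
  have b2 : ∀ s, 0 ≤ s → |(Polynomial.derivative A).eval s| ≤ C * exp (s/8) :=
    fun s hs => (h2 s hs).trans (by gcongr; linarith)
  have b3 : ∀ s, 0 ≤ s → |M.eval s| ≤ C * exp (s/8) := fun s hs => (h3 s hs).trans (by gcongr; linarith)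
  have e1 : ∀ᶠ s : ℝ in Filter.atTop, A.eval s ≠ 0 := by
    have := Polynomial.eventually_atTop_not_isRoot A hAne
    exact this.mono (fun s hs => hs)
  have e2 : Filter.Tendsto (fun s : ℝ => (Polynomial.derivative A).eval s / A.eval s) Filter.atTop (nhds 0) :=
    Polynomial.div_tendsto_atTop_zero_of_degree_lt _ _ (Polynomial.degree_derivative_lt hAne)
  have e3 : ∀ᶠ s : ℝ in Filter.atTop, |(Polynomial.derivative A).eval s / A.eval s| < 1/8 := by
    have := e2.abs
    simp only [abs_zero] at this
    exact this.eventually_lt_const (by norm_num)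
  have e4 : ∀ᶠ s : ℝ in Filter.atTop, 4 * C^2 ≤ exp (s/2) := by
    have : Filter.Tendsto (fun s : ℝ => exp (s/2)) Filter.atTop Filter.atTop :=
      Real.tendsto_exp_atTop.comp (Filter.tendsto_id.atTop_div_const (by norm_num))
    exact this.eventually_ge_atTop _
  obtain ⟨S0, hS0⟩ := Filter.eventually_atTop.1 (e1.and (e3.and e4))
  have hCC : 1 ≤ C := by linarith
  set S1 := max S0 1
  have hS1 : 1 ≤ S1 := le_max_right _ _
  have hS4 := (hS0 S1 (le_max_left _ _)).2.2
  refine ⟨fun s => A.eval s, fun s => (Polynomial.derivative A).eval s, fun s => M.eval s, C, S1,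
    fun s => A.hasDerivAt s, fun s hs => ?_, hA0, hCC, b1, b2, b3, fun s => ?_, hM0, hMp, hS1, ?_, ?_, ?_, ?_⟩
  · have := (Polynomial.derivative A).hasDerivAt s
    refine this.congr_deriv ?_
    have h := congrArg (Polynomial.eval s) hA
    simp at h
    rw [eq_div_iff hs.ne']
    linear_combination h
  · have := M.hasDerivAt s
    rw [hM] at this
    simpa using this
  · intro s hs
    exact (hS0 s ((le_max_left _ _).trans hs)).1
  · intro s hs
    have h := hS0 s ((le_max_left _ _).trans hs)
    have h' := h.2.1
    rw [abs_div, div_lt_iff₀ (abs_pos.2 h.1)] at h'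
    linarith
  · have hb := (le_abs_self _).trans (b3 S1 (by linarith))
    have : exp (-S1) * (M.eval S1) ≤ exp (-S1) * (C * exp (S1/8)) := by gcongr
    refine this.trans ?_
    have e5 : exp (-S1) = exp (-(S1/2)) * exp (-(S1/2)) := by rw [← exp_add]; ring_nf
    have e6 : exp (-(S1/2)) * exp (S1/8) ≤ 1 := by rw [← exp_add]; apply exp_le_one_iff.2; linarith
    have e7 : exp (-(S1/2)) * exp (S1/2) = 1 := by rw [← exp_add]; simp
    have e8 : exp (-(S1/2)) * (4 * C) ≤ 1 := by
      rw [← e7]; gcongr; nlinarith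
    calc exp (-S1) * (C * exp (S1/8)) = (exp (-(S1/2)) * (4 * C)) * (exp (-(S1/2)) * exp (S1/8)) / 4 := by rw [e5]; ring
      _ ≤ 1 * 1 / 4 := by gcongr
      _ = _ := by norm_num
  · have hb := b1 S1 (by linarith)
    have : (A.eval S1)^2 ≤ (C * exp (S1/8))^2 := sq_le_sq' (by linarith [neg_abs_le (A.eval S1)]) ((le_abs_self _).trans hb)
    have e5 : exp S1 = exp (S1/2) * exp (S1/2) := by rw [← exp_add]; ring_nf
    have e6 : exp (S1/8)^2 ≤ exp (S1/2) := by rw [← exp_nat_mul]; apply exp_le_exp.2; push_cast; linarith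
    calc 4 * (A.eval S1)^2 ≤ 4 * (C * exp (S1/8))^2 := by linarith
      _ = (4 * C^2) * exp (S1/8)^2 := by ring
      _ ≤ exp (S1/2) * exp (S1/2) := by gcongr
      _ = _ := e5.symm

/-- locally bounded near zero, continuous on the half line -/
def LB (F : ℝ → ℝ) : Prop :=
  ContinuousOn F (Ioi 0) ∧ ∀ s : ℝ, 0 < s → ∃ A : ℝ, ∀ t ∈ Ioc 0 s, |F t| ≤ A

lemma LB.ii {F : ℝ → ℝ} (h : LB F) (s : ℝ) (hs : 0 < s) : IntervalIntegrable F volume 0 s := by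
  rw [intervalIntegrable_iff_integrableOn_Ioc_of_le hs.le]
  obtain ⟨A, hA⟩ := h.2 s hs
  have hc : Integrable (fun _ : ℝ => A) (volume.restrict (Ioc 0 s)) := by simp
  refine hc.mono' ((h.1.mono (fun t ht => ht.1)).aestronglyMeasurable measurableSet_Ioc) ?_
  filter_upwards [ae_restrict_mem measurableSet_Ioc] with t ht using hA t ht

lemma LB.deriv {F : ℝ → ℝ} (h : LB F) (s : ℝ) (hs : 0 < s) :
    HasDerivAt (fun s => ∫ t in (0:ℝ)..s, F t) (F s) s :=
  intervalIntegral.integral_hasDerivAt_right (h.ii s hs)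
    (h.1.stronglyMeasurableAtFilter isOpen_Ioi s hs) (h.1.continuousAt (Ioi_mem_nhds hs))

lemma LB.bound {F : ℝ → ℝ} (s A : ℝ) (hs : 0 < s) (hA : ∀ t ∈ Ioc 0 s, |F t| ≤ A) :
    |∫ t in (0:ℝ)..s, F t| ≤ A * s := by
  have := intervalIntegral.norm_integral_le_of_norm_le_const (a := 0) (b := s) (f := F) (C := A)
    (fun t ht => by rw [uIoc_of_le hs.le] at ht; exact hA t ht)
  simpa [abs_of_pos hs] using this

lemma LB.lim {F : ℝ → ℝ} (h : LB F) :
    Filter.Tendsto (fun s => ∫ t in (0:ℝ)..s, F t) (nhdsWithin 0 (Ioi 0)) (nhds 0) := by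
  obtain ⟨A, hA⟩ := h.2 1 one_pos
  have h1 : Filter.Tendsto (fun s : ℝ => A * s) (nhdsWithin 0 (Ioi 0)) (nhds 0) := by
    have : Filter.Tendsto (fun s : ℝ => A * s) (nhds 0) (nhds (A * 0)) := (continuous_const.mul continuous_id).tendsto 0
    rw [mul_zero] at this
    exact this.mono_left nhdsWithin_le_nhds
  refine squeeze_zero_norm' ?_ h1
  filter_upwards [Ioo_mem_nhdsGT (one_pos (α := ℝ))] with s hs
  exact LB.bound s A hs.1 (fun t ht => hA t ⟨ht.1, ht.2.trans hs.2.le⟩)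

lemma LB.cont {F : ℝ → ℝ} (h : LB F) : ContinuousOn (fun s => ∫ t in (0:ℝ)..s, F t) (Ioi 0) :=
  fun s hs => (h.deriv s hs).continuousAt.continuousWithinAt

/-- comparison from zero -/
lemma cmp0 {a b a' b' : ℝ → ℝ} (ha : ∀ s, 0 < s → HasDerivAt a (a' s) s)
    (hb : ∀ s, 0 < s → HasDerivAt b (b' s) s)
    (la : Filter.Tendsto a (nhdsWithin 0 (Ioi 0)) (nhds 0))
    (lb : Filter.Tendsto b (nhdsWithin 0 (Ioi 0)) (nhds 0))
    (s : ℝ) (hs : 0 < s) (hab : ∀ t ∈ Ioc 0 s, a' t ≤ b' t) : a s ≤ b s := by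
  have hm : MonotoneOn (fun t => b t - a t) (Ioc 0 s) := by
    apply monotoneOn_of_deriv_nonneg (convex_Ioc 0 s)
    · exact fun t ht => ((hb t ht.1).sub (ha t ht.1)).continuousAt.continuousWithinAt
    · exact fun t ht => ((hb t (interior_subset ht).1).sub (ha t (interior_subset ht).1)).differentiableAt.differentiableWithinAt
    · intro t ht
      have ht := interior_subset ht
      have hd : HasDerivAt (fun t => b t - a t) _ t := (hb t ht.1).sub (ha t ht.1)
      rw [hd.deriv]
      linarith [hab t ht]
  have hl : Filter.Tendsto (fun t => b t - a t) (nhdsWithin 0 (Ioi 0)) (nhds (0 - 0)) := lb.sub la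
  have : (0:ℝ) - 0 ≤ b s - a s := by
    refine le_of_tendsto hl ?_
    filter_upwards [Ioo_mem_nhdsGT hs] with t ht
    exact hm ⟨ht.1, ht.2.le⟩ ⟨hs, le_rfl⟩ ht.2.le
  linarith

lemma tend0_of_bound {a : ℝ → ℝ} (A : ℝ) (h : ∀ s, 0 < s → s ≤ 1 → |a s| ≤ A * s) :
    Filter.Tendsto a (nhdsWithin 0 (Ioi 0)) (nhds 0) := by
  have h1 : Filter.Tendsto (fun s : ℝ => A * s) (nhdsWithin 0 (Ioi 0)) (nhds 0) := by
    have : Filter.Tendsto (fun s : ℝ => A * s) (nhds 0) (nhds (A * 0)) := (continuous_const.mul continuous_id).tendsto 0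
    rw [mul_zero] at this
    exact this.mono_left nhdsWithin_le_nhds
  refine squeeze_zero_norm' ?_ h1
  filter_upwards [Ioo_mem_nhdsGT (one_pos (α := ℝ))] with s hs using h s hs.1 hs.2.le

noncomputable def k0 (μ s : ℝ) : ℝ := s ^ 2 / (s + μ) ^ 2

noncomputable def lam1 (μ s : ℝ) : ℝ := log (1 + s / μ)

noncomputable def H0 (μ s : ℝ) : ℝ := log (1 + s / μ) - s / (s + μ)

structure KData (μ ℓ : ℝ) (k R : ℝ → ℝ) : Prop where
  hμ : μ = exp (-ℓ)
  hℓ : 64 ≤ ℓ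
  dk : ∀ s, 0 < s → HasDerivAt k (R s * k s / s) s
  cR : ContinuousOn R (Ioi 0)
  R1 : ∀ s, 0 < s → μ / (s + μ) ≤ R s
  R2 : ∀ s, 0 < s → R s ≤ 3 * (μ / (s + μ))
  kk : ∀ s, 0 < s → |k s - k0 μ s| ≤ 4 / ℓ * k0 μ s

noncomputable def HH (k : ℝ → ℝ) (s : ℝ) : ℝ := ∫ t in (0:ℝ)..s, k t / t

lemma k0_pos {μ s : ℝ} (hμ : 0 < μ) (hs : 0 < s) : 0 < k0 μ s := by unfold k0; positivity

lemma k0_le_one {μ s : ℝ} (hμ : 0 < μ) (hs : 0 < s) : k0 μ s ≤ 1 := by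
  unfold k0; rw [div_le_one (by positivity)]; gcongr; linarith

lemma dlam {μ : ℝ} (hμ : 0 < μ) (s : ℝ) (hs : 0 < s) : HasDerivAt (lam1 μ) (1 / (s + μ)) s := by
  have h1 : HasDerivAt (fun s : ℝ => 1 + s / μ) (1 / μ) s := ((hasDerivAt_id s).div_const μ).const_add 1
  refine (h1.log (by positivity)).congr_deriv ?_
  field_simp; ring

lemma dH0 {μ : ℝ} (hμ : 0 < μ) (s : ℝ) (hs : 0 < s) : HasDerivAt (H0 μ) (k0 μ s / s) s := by
  have h1 := dlam hμ s hs
  have h2 : HasDerivAt (fun s : ℝ => s / (s + μ)) ((1 * (s + μ) - s * 1) / (s + μ) ^ 2) s :=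
    (hasDerivAt_id s).div ((hasDerivAt_id s).add_const μ) (by simp; positivity)
  refine (h1.sub h2).congr_deriv ?_
  unfold k0
  field_simp; ring

lemma lam_nonneg {μ s : ℝ} (hμ : 0 < μ) (hs : 0 < s) : 0 ≤ lam1 μ s := by
  apply log_nonneg
  have : 0 < s / μ := by positivity
  linarith

lemma lam_le {μ s : ℝ} (hμ : 0 < μ) (hs : 0 < s) : lam1 μ s ≤ s / μ := by
  have := log_le_sub_one_of_pos (show 0 < 1 + s / μ by positivity)
  unfold lam1; linarith

namespace KData
variable {μ ℓ : ℝ} {k R : ℝ → ℝ} (h : KData μ ℓ k R)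
include h

lemma μ0 : 0 < μ := by rw [h.hμ]; positivity
lemma μ1 : μ < 1 := by rw [h.hμ]; rw [exp_lt_one_iff]; linarith [h.hℓ]
lemma ℓ0 : 0 < ℓ := by linarith [h.hℓ]

lemma klow (s : ℝ) (hs : 0 < s) : k0 μ s / 2 ≤ k s := by
  have h1 := (abs_le.1 (h.kk s hs)).1
  have h2 := k0_pos h.μ0 hs
  have h3 : 4 / ℓ ≤ 1/2 := by rw [div_le_iff₀ h.ℓ0]; linarith [h.hℓ]
  nlinarith

lemma kup (s : ℝ) (hs : 0 < s) : k s ≤ 2 * k0 μ s := by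
  have h1 := (abs_le.1 (h.kk s hs)).2
  have h2 := k0_pos h.μ0 hs
  have h3 : 4 / ℓ ≤ 1/2 := by rw [div_le_iff₀ h.ℓ0]; linarith [h.hℓ]
  nlinarith

lemma kpos (s : ℝ) (hs : 0 < s) : 0 < k s := by
  linarith [h.klow s hs, k0_pos h.μ0 hs]

lemma k2 (s : ℝ) (hs : 0 < s) : k s ≤ 2 := by
  linarith [h.kup s hs, k0_le_one h.μ0 hs]

lemma kc : ContinuousOn k (Ioi 0) := fun s hs => (h.dk s hs).continuousAt.continuousWithinAt

lemma Rpos (s : ℝ) (hs : 0 < s) : 0 ≤ R s := by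
  have := h.R1 s hs
  have h0 := h.μ0
  have : 0 < μ / (s + μ) := by positivity
  linarith

lemma kmono {t s : ℝ} (ht : 0 < t) (hts : t ≤ s) : k t ≤ k s := by
  have hm : MonotoneOn k (Ioi 0) := by
    apply monotoneOn_of_deriv_nonneg (convex_Ioi 0) h.kc
    · intro t ht
      rw [interior_Ioi] at ht
      exact (h.dk t ht).differentiableAt.differentiableWithinAt
    · intro t ht
      rw [interior_Ioi] at ht
      rw [(h.dk t ht).deriv]
      have := h.Rpos t ht
      have := h.kpos t ht
      have : 0 < t := ht
      positivity
  exact hm ht (ht.trans_le hts) hts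

lemma ksq (s : ℝ) (hs : 0 < s) : k s ≤ 2 / μ^2 * s^2 := by
  have h1 := h.kup s hs
  have h0 := h.μ0
  have : k0 μ s ≤ s^2 / μ^2 := by unfold k0; gcongr; linarith
  calc k s ≤ 2 * (s^2/μ^2) := by linarith
    _ = _ := by ring

lemma LBk : LB (fun t => k t / t) := by
  refine ⟨h.kc.div continuousOn_id (fun t ht => ne_of_gt ht), fun s hs => ⟨2/μ^2 * s, fun t ht => ?_⟩⟩
  have ht0 := ht.1
  have := h.kpos t ht.1
  rw [abs_of_pos (by positivity), div_le_iff₀ ht.1]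
  have h0 := h.μ0
  calc k t ≤ 2/μ^2 * t^2 := h.ksq t ht.1
    _ = 2/μ^2 * t * t := by ring
    _ ≤ _ := by gcongr; exact ht.2

lemma dH (s : ℝ) (hs : 0 < s) : HasDerivAt (HH k) (k s / s) s := h.LBk.deriv s hs

lemma H_lim : Filter.Tendsto (HH k) (nhdsWithin 0 (Ioi 0)) (nhds 0) := h.LBk.lim

lemma H_nonneg (s : ℝ) (hs : 0 < s) : 0 ≤ HH k s := by
  refine cmp0 (a := fun _ => 0) (a' := fun _ => 0) (fun s _ => hasDerivAt_const s 0) (fun s hs => h.dH s hs)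
    tendsto_const_nhds h.H_lim s hs (fun t ht => ?_)
  have := h.kpos t ht.1
  have := ht.1
  positivity

lemma H_le (s : ℝ) (hs : 0 < s) : HH k s ≤ k s * (1 + lam1 μ s) := by
  have h0 := h.μ0
  refine cmp0 (fun s hs => h.dH s hs) (fun s hs => (h.dk s hs).mul ((dlam h0 s hs).const_add 1))
    h.H_lim ?_ s hs (fun t ht => ?_)
  · apply tend0_of_bound (2/μ^2 * (1 + 1/μ))
    intro s hs hs1
    have a1 := h.ksq s hs
    have a2 := h.kpos s hs
    have a3 := lam_nonneg h0 hs
    have a4 := lam_le h0 hs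
    have a5 : s/μ ≤ 1/μ := by gcongr
    have : 0 < 1 + lam1 μ s := by linarith
    show |k s * (1 + lam1 μ s)| ≤ _
    rw [abs_of_pos (by positivity)]
    calc k s * (1 + lam1 μ s) ≤ (2/μ^2*s^2) * (1 + 1/μ) := by gcongr; linarith
      _ = 2/μ^2 * (1 + 1/μ) * (s * s) := by ring
      _ ≤ 2/μ^2 * (1 + 1/μ) * (1 * s) := by gcongr
      _ = _ := by ring
  · have a2 := h.kpos t ht.1
    have a3 := lam_nonneg h0 ht.1
    have a4 := h.R1 t ht.1
    have ht0 := ht.1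
    have a5 : R t * k t / t ≤ R t * k t / t * (1 + lam1 μ t) := by
      have := h.Rpos t ht.1
      have : 0 ≤ R t * k t / t := by positivity
      nlinarith
    have a6 : μ/(t+μ) * k t / t ≤ R t * k t / t := by gcongr
    have a7 : μ/(t+μ) * k t / t + k t * (1/(t+μ)) = k t / t := by field_simp; ring
    show k t / t ≤ R t * k t / t * (1 + lam1 μ t) + k t * (1/(t+μ))
    linarith

lemma H0_lim : Filter.Tendsto (H0 μ) (nhdsWithin 0 (Ioi 0)) (nhds 0) := by
  have h0 := h.μ0
  have : ContinuousAt (H0 μ) 0 := by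
    unfold H0
    apply ContinuousAt.sub
    · apply ContinuousAt.log (by fun_prop) (by simp)
    · apply ContinuousAt.div (by fun_prop) (by fun_prop) (by simp; exact h0.ne')
  have h2 := this.tendsto
  simp only [H0, zero_div, add_zero, log_one, sub_zero] at h2
  exact Filter.Tendsto.mono_left h2 nhdsWithin_le_nhds

lemma HH0 (s : ℝ) (hs : 0 < s) : |HH k s - H0 μ s| ≤ 4/ℓ * H0 μ s := by
  have h0 := h.μ0
  have hl := h.H0_lim.const_mul (4/ℓ)
  rw [mul_zero] at hl
  have key : ∀ t, 0 < t → |k t / t - k0 μ t / t| ≤ 4/ℓ * (k0 μ t / t) := by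
    intro t ht
    have := h.kk t ht
    rw [← sub_div, abs_div, abs_of_pos ht, ← mul_div_assoc]
    gcongr
  rw [abs_le]
  constructor
  · have := cmp0 (fun s hs => (dH0 h0 s hs).sub (h.dH s hs)) (fun s hs => (dH0 h0 s hs).const_mul (4/ℓ))
      (by have := h.H0_lim.sub h.H_lim; rw [sub_zero] at this; exact this) hl s hs (fun t ht => by
        linarith [(abs_le.1 (key t ht.1)).1])
    simp only [Pi.sub_apply] at this
    linarith
  · exact cmp0 (fun s hs => (h.dH s hs).sub (dH0 h0 s hs)) (fun s hs => (dH0 h0 s hs).const_mul (4/ℓ))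
      (by have := h.H_lim.sub h.H0_lim; rw [sub_zero] at this; exact this) hl s hs (fun t ht => by
        linarith [(abs_le.1 (key t ht.1)).2])

lemma H0_nonneg (s : ℝ) (hs : 0 < s) : 0 ≤ H0 μ s := by
  have h0 := h.μ0
  refine cmp0 (a := fun _ => 0) (a' := fun _ => 0) (fun s _ => hasDerivAt_const s 0) (fun s hs => dH0 h0 s hs)
    tendsto_const_nhds h.H0_lim s hs (fun t ht => ?_)
  have := k0_pos h0 ht.1
  have := ht.1
  positivity

lemma lam_eq (s : ℝ) (hs : 0 < s) : lam1 μ s = ℓ + log (s + μ) := by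
  have h0 := h.μ0
  have : 1 + s / μ = (s + μ) / μ := by field_simp; ring
  unfold lam1
  rw [this, log_div (by positivity) h0.ne', h.hμ, log_exp]
  ring

lemma lam_le2 (s : ℝ) (hs : 0 < s) : lam1 μ s ≤ ℓ + s := by
  rw [h.lam_eq s hs]
  have h0 := h.μ0
  have h1 := h.μ1
  have := log_le_sub_one_of_pos (show 0 < s + μ by positivity)
  linarith

lemma Rlam (s : ℝ) (hs : 0 < s) : R s * (1 + lam1 μ s) ≤ 3 := by
  have h0 := h.μ0
  have a1 := h.R2 s hs
  have a2 := lam_nonneg h0 hs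
  have a3 : log ((s+μ)/μ) ≤ (s+μ)/μ - 1 := log_le_sub_one_of_pos (by positivity)
  have a4 : 1 + s / μ = (s + μ) / μ := by field_simp; ring
  have a5 : 1 + lam1 μ s ≤ (s+μ)/μ := by unfold lam1; rw [a4]; linarith
  calc R s * (1 + lam1 μ s) ≤ 3 * (μ/(s+μ)) * ((s+μ)/μ) := by gcongr
    _ = 3 := by field_simp

lemma H0_le (s : ℝ) (hs : 0 < s) : H0 μ s ≤ lam1 μ s := by
  have h0 := h.μ0
  unfold H0 lam1
  have : 0 < s / (s + μ) := by positivity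
  linarith

/-- the reference profile minus its limit -/
lemma Hell (s : ℝ) (hs : 0 < s) : |H0 μ s - ℓ| ≤ 2 + s + 2 / sqrt s := by
  have h0 := h.μ0
  have h1 := h.μ1
  have e : H0 μ s = lam1 μ s - s/(s+μ) := rfl
  rw [e, h.lam_eq s hs]
  have a1 : 0 < s/(s+μ) := by positivity
  have a2 : s/(s+μ) ≤ 1 := by rw [div_le_one (by positivity)]; linarith
  have a3 := log_le_sub_one_of_pos (show 0 < s + μ by positivity)
  have hq : 0 < sqrt s := sqrt_pos.2 hs
  have a4 : - log (s+μ) ≤ 2 / sqrt s := by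
    have b1 : log s ≤ log (s+μ) := log_le_log hs (by linarith)
    have b2 : log (1/sqrt s) ≤ 1/sqrt s - 1 := log_le_sub_one_of_pos (by positivity)
    have b3 : log (1/sqrt s) = - (log s / 2) := by
      rw [one_div, log_inv, log_sqrt hs.le]
    have b4 : 2 / sqrt s = 2 * (1/sqrt s) := by ring
    rw [b4]; linarith
  have a5 : 0 < 2 / sqrt s := by positivity
  rw [abs_le]
  constructor <;> linarith

lemma HHell (s : ℝ) (hs : 0 < s) : |HH k s - ℓ| ≤ 6 + 5 * s + 2 / sqrt s := by
  have a1 := h.Hell s hs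
  have a2 := h.HH0 s hs
  have a3 : 4/ℓ * H0 μ s ≤ 4 + 4 * s := by
    have h0 := h.ℓ0
    have b1 := h.H0_le s hs
    have b2 := h.lam_le2 s hs
    have h64 := h.hℓ
    calc 4/ℓ * H0 μ s ≤ 4/ℓ * (ℓ + s) := by gcongr; linarith
      _ = 4 + 4 * s / ℓ := by field_simp
      _ ≤ 4 + 4 * s := by gcongr; apply div_le_self (by positivity); linarith
  have : HH k s - ℓ = (HH k s - H0 μ s) + (H0 μ s - ℓ) := by ring
  rw [this]
  refine (abs_add_le _ _).trans ?_
  linarith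

lemma sqrtμ : sqrt μ * ℓ^2 ≤ 16 := by
  have h0 := h.ℓ0
  rw [h.hμ, sqrt_eq_rpow, ← exp_mul]
  have a := Real.pow_div_factorial_le_exp (ℓ/2) (by positivity) 2
  have e : exp (-ℓ * (1/2)) * exp (ℓ/2) = 1 := by rw [← exp_add]; simp; ring
  have p : 0 < exp (-ℓ * (1/2)) := exp_pos _
  simp only [Nat.factorial] at a
  push_cast at a
  have : ℓ^2 ≤ 8 * exp (ℓ/2) := by nlinarith
  calc exp (-ℓ * (1/2)) * ℓ^2 ≤ exp (-ℓ * (1/2)) * (8 * exp (ℓ/2)) := by gcongr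
    _ = 8 * (exp (-ℓ * (1/2)) * exp (ℓ/2)) := by ring
    _ ≤ 16 := by rw [e]; norm_num

lemma μs (s : ℝ) (hs : 0 < s) : μ / (s + μ) ≤ sqrt μ / sqrt s := by
  have h0 := h.μ0
  have q1 : 0 < sqrt s := sqrt_pos.2 hs
  have q2 : 0 < sqrt μ := sqrt_pos.2 h0
  have e1 := sq_sqrt hs.le
  have e2 := sq_sqrt h0.le
  rw [div_le_div_iff₀ (by positivity) q1]
  set a := sqrt s
  set b := sqrt μ
  rw [← e1, ← e2]
  nlinarith [mul_pos q1 q2, sq_nonneg (a - b), mul_nonneg q2.le (sq_nonneg (a-b)), mul_pos q2 (mul_pos q1 q2)]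

end KData

abbrev EE := BoundedContinuousFunction (Ioi (0:ℝ)) ℝ

open Classical in
noncomputable def ext0 (v : EE) (s : ℝ) : ℝ := if h : 0 < s then v ⟨s, h⟩ else 0

lemma ext0_eq (v : EE) (s : ℝ) (hs : 0 < s) : ext0 v s = v ⟨s, hs⟩ := by simp [ext0, hs]

lemma ext0_cont (v : EE) : ContinuousOn (ext0 v) (Ioi 0) := by
  rw [continuousOn_iff_continuous_domRestrict]
  have : (Ioi (0:ℝ)).domRestrict (ext0 v) = v := by
    funext x
    exact ext0_eq v x.1 x.2
  rw [this]
  exact v.continuous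

lemma ext0_le (v : EE) (s : ℝ) (hs : 0 < s) : |ext0 v s| ≤ ‖v‖ := by
  rw [ext0_eq v s hs]; exact v.norm_coe_le_norm _

lemma mkE (F : ℝ → ℝ) (hF : ContinuousOn F (Ioi 0)) (C : ℝ) (hb : ∀ s, 0 < s → |F s| ≤ C) :
    ∃ v : EE, ∀ s, 0 < s → ext0 v s = F s := by
  refine ⟨BoundedContinuousFunction.ofNormedAddCommGroup (fun x : Ioi (0:ℝ) => F x)
    (continuousOn_iff_continuous_domRestrict.1 hF) C (fun x => hb x x.2), fun s hs => ?_⟩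
  rw [ext0_eq _ s hs]; rfl

lemma normE (v : EE) (C : ℝ) (hC : 0 ≤ C) (hb : ∀ s, 0 < s → |ext0 v s| ≤ C) : ‖v‖ ≤ C := by
  rw [BoundedContinuousFunction.norm_le hC]
  intro x
  have := hb x.1 x.2
  rwa [ext0_eq v x.1 x.2] at this

lemma LBmul {b : ℝ → ℝ} (hb : LB b) (v : EE) : LB (fun t => b t * ext0 v t) := by
  refine ⟨hb.1.mul (ext0_cont v), fun s hs => ?_⟩
  obtain ⟨A, hA⟩ := hb.2 s hs
  refine ⟨A * ‖v‖, fun t ht => ?_⟩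
  rw [abs_mul]
  have := hA t ht
  exact mul_le_mul this (ext0_le v t ht.1) (abs_nonneg _) ((abs_nonneg _).trans this)

lemma volt (a b : ℝ → ℝ) (ha : ContinuousOn a (Ioi 0)) (hb : LB b) (hbp : ∀ s, 0 < s → 0 ≤ b s) (c : ℝ)
    (hc : 0 ≤ c) (hab : ∀ s, 0 < s → |a s| * ∫ t in (0:ℝ)..s, b t ≤ c) :
    ∃ T : EE →L[ℝ] EE, ‖T‖ ≤ c ∧ ∀ v s, 0 < s → ext0 (T v) s = a s * ∫ t in (0:ℝ)..s, b t * ext0 v t := by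
  have bd : ∀ v : EE, ∀ s, 0 < s → |a s * ∫ t in (0:ℝ)..s, b t * ext0 v t| ≤ c * ‖v‖ := by
    intro v s hs
    have h1 : |∫ t in (0:ℝ)..s, b t * ext0 v t| ≤ (∫ t in (0:ℝ)..s, b t) * ‖v‖ := by
      rw [← intervalIntegral.integral_mul_const, ← Real.norm_eq_abs]
      refine intervalIntegral.norm_integral_le_of_norm_le hs.le ?_ ((hb.ii s hs).mul_const _)
      filter_upwards with t ht
      rw [norm_mul, Real.norm_eq_abs, Real.norm_eq_abs, abs_of_nonneg (hbp t ht.1)]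
      exact mul_le_mul_of_nonneg_left (ext0_le v t ht.1) (hbp t ht.1)
    rw [abs_mul]
    calc |a s| * |∫ t in (0:ℝ)..s, b t * ext0 v t| ≤ |a s| * ((∫ t in (0:ℝ)..s, b t) * ‖v‖) := by gcongr
      _ = (|a s| * ∫ t in (0:ℝ)..s, b t) * ‖v‖ := by ring
      _ ≤ _ := by gcongr; exact hab s hs
  have ex : ∀ v : EE, ∃ w : EE, ∀ s, 0 < s → ext0 w s = a s * ∫ t in (0:ℝ)..s, b t * ext0 v t :=
    fun v => mkE _ (ha.mul (LBmul hb v).cont) (c * ‖v‖) (bd v)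
  choose T hT using ex
  have ext_eq : ∀ v w : EE, (∀ s, 0 < s → ext0 v s = ext0 w s) → v = w := by
    intro v w h
    ext x
    have := h x.1 x.2
    rwa [ext0_eq v x.1 x.2, ext0_eq w x.1 x.2] at this
  have eadd : ∀ v w : EE, ∀ s, 0 < s → ext0 (v + w) s = ext0 v s + ext0 w s := by
    intro v w s hs; simp [ext0_eq _ s hs]
  have esmul : ∀ (r : ℝ) (w : EE), ∀ s, 0 < s → ext0 (r • w) s = r * ext0 w s := by
    intro v w s hs; simp [ext0_eq _ s hs]
  let Tl : EE →ₗ[ℝ] EE :=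
    { toFun := T
      map_add' := fun v w => by
        apply ext_eq
        intro s hs
        rw [eadd _ _ s hs, hT _ s hs, hT _ s hs, hT _ s hs, ← mul_add,
          ← intervalIntegral.integral_add ((LBmul hb v).ii s hs) ((LBmul hb w).ii s hs)]
        congr 1
        apply intervalIntegral.integral_congr_ae
        filter_upwards with t ht
        rw [uIoc_of_le hs.le] at ht
        rw [eadd _ _ t ht.1]; ring
      map_smul' := fun r v => by
        apply ext_eq
        intro s hs
        simp only [RingHom.id_apply]
        have hi : (∫ t in (0:ℝ)..s, b t * ext0 (r • v) t) = r * ∫ t in (0:ℝ)..s, b t * ext0 v t := by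
          rw [← intervalIntegral.integral_const_mul]
          apply intervalIntegral.integral_congr_ae
          filter_upwards with t ht
          rw [uIoc_of_le hs.le] at ht
          rw [esmul _ _ t ht.1]; ring
        rw [esmul _ _ s hs, hT _ s hs, hT _ s hs, hi]; ring }
  refine ⟨Tl.mkContinuous c (fun v => ?_), LinearMap.mkContinuous_norm_le _ hc _, fun v s hs => hT v s hs⟩
  apply normE _ _ (by positivity)
  intro s hs
  rw [show Tl v = T v from rfl, hT v s hs]
  exact bd v s hs

lemma fam {E : Type*} [NormedAddCommGroup E] [NormedSpace ℝ E] [CompleteSpace E] (B : E →L[ℝ] E) (n : ℕ)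
    (hB : ‖B‖ ≤ 1 / (2 * ((n:ℝ) + 1))) (s0 s1 : E) :
    ∃ U : ℝ → E, ContinuousOn U (Icc 0 1) ∧ ∀ δ ∈ Icc (0:ℝ) 1,
      U δ = s0 + δ • s1 + ((n:ℝ) + δ) • B (U δ) ∧ ‖U δ‖ ≤ 2 * ‖s0 + δ • s1‖ := by
  have hlt : ∀ δ ∈ Icc (0:ℝ) 1, ‖((n:ℝ) + δ) • B‖ ≤ 1/2 := by
    intro δ hδ
    rw [norm_smul, Real.norm_eq_abs, abs_of_nonneg (by have := hδ.1; positivity)]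
    calc ((n:ℝ) + δ) * ‖B‖ ≤ ((n:ℝ) + 1) * (1 / (2 * ((n:ℝ) + 1))) := by gcongr; exact hδ.2
      _ = 1/2 := by field_simp
  have ex : ∀ δ : ℝ, ∃ u : E, δ ∈ Icc (0:ℝ) 1 → u = s0 + δ • s1 + ((n:ℝ) + δ) • B u := by
    intro δ
    by_cases hδ : δ ∈ Icc (0:ℝ) 1
    · have hu : IsUnit (1 - ((n:ℝ) + δ) • B) := isUnit_one_sub_of_norm_lt_one (by linarith [hlt δ hδ])
      obtain ⟨W, hW⟩ := hu
      refine ⟨(↑W⁻¹ : E →L[ℝ] E) (s0 + δ • s1), fun _ => ?_⟩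
      have h1 : ((1 - ((n:ℝ) + δ) • B) * (↑W⁻¹ : E →L[ℝ] E)) (s0 + δ • s1) = s0 + δ • s1 := by
        rw [← hW, Units.mul_inv]; rfl
      set y := (↑W⁻¹ : E →L[ℝ] E) (s0 + δ • s1)
      have h2 : y - ((n:ℝ) + δ) • B y = s0 + δ • s1 := h1
      rw [← h2]; abel
    · exact ⟨0, fun h => absurd h hδ⟩
  choose U hU using ex
  have hbd : ∀ δ ∈ Icc (0:ℝ) 1, ‖U δ‖ ≤ 2 * ‖s0 + δ • s1‖ := by
    intro δ hδ
    have h1 : ‖U δ‖ ≤ ‖s0 + δ • s1‖ + ‖(((n:ℝ) + δ) • B) (U δ)‖ := by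
      conv_lhs => rw [hU δ hδ]
      exact norm_add_le _ _
    have h2 := (((n:ℝ) + δ) • B).le_opNorm (U δ)
    have h3 : ‖((n:ℝ) + δ) • B‖ * ‖U δ‖ ≤ 1/2 * ‖U δ‖ := by gcongr; exact hlt δ hδ
    linarith
  refine ⟨U, ?_, fun δ hδ => ⟨hU δ hδ, hbd δ hδ⟩⟩
  set K := 2 * (‖s1‖ + ‖B‖ * (2 * (‖s0‖ + ‖s1‖))) with hK
  have hK0 : 0 ≤ K := by positivity
  have lip : LipschitzOnWith K.toNNReal U (Icc 0 1) := by
    apply LipschitzOnWith.of_dist_le_mul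
    intro x hx y hy
    rw [dist_eq_norm, dist_eq_norm, Real.coe_toNNReal _ hK0]
    have e : U x - U y = (x - y) • s1 + (((n:ℝ) + x) • B) (U x - U y) + (x - y) • B (U y) := by
      conv_lhs => rw [hU x hx, hU y hy]
      simp only [map_sub, smul_apply]
      module
    have h1 : ‖U x - U y‖ ≤ ‖(x - y) • s1‖ + ‖(((n:ℝ) + x) • B) (U x - U y)‖ + ‖(x - y) • B (U y)‖ := by
      conv_lhs => rw [e]
      exact norm_add₃_le
    have h2 := (((n:ℝ) + x) • B).le_opNorm (U x - U y)
    have h3 : ‖((n:ℝ) + x) • B‖ * ‖U x - U y‖ ≤ 1/2 * ‖U x - U y‖ := by gcongr; exact hlt x hx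
    have h4 : ‖B (U y)‖ ≤ ‖B‖ * (2 * (‖s0‖ + ‖s1‖)) := by
      refine (B.le_opNorm _).trans ?_
      gcongr
      refine (hbd y hy).trans ?_
      gcongr
      refine (norm_add_le _ _).trans ?_
      gcongr
      rw [norm_smul, Real.norm_eq_abs, abs_of_nonneg hy.1]
      nlinarith [norm_nonneg s1, hy.2]
    rw [norm_smul, norm_smul] at h1
    have h5 : ‖x - y‖ * ‖B (U y)‖ ≤ ‖x - y‖ * (‖B‖ * (2 * (‖s0‖ + ‖s1‖))) := by gcongr
    rw [hK]
    linarith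
  exact lip.continuousOn

noncomputable def src (μ : ℝ) (k R L L1 : ℝ → ℝ) (δ s : ℝ) : ℝ :=
  HH k s / k s * (δ * L s - R s * L1 s) + 2 * L1 s - L s

lemma s_le_exp {s : ℝ} : s ≤ 8 * exp (s/8) := by
  have := add_one_le_exp (s/8)
  linarith

lemma two_ell {μ ℓ : ℝ} {k R : ℝ → ℝ} (h : KData μ ℓ k R) : 2/ℓ ≤ 1 := by
  rw [div_le_one h.ℓ0]; linarith [h.hℓ]

lemma src_bound {n : ℕ} {L L1 M : ℝ → ℝ} {C S1 : ℝ} (hL : LData n L L1 M C S1)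
    {μ ℓ : ℝ} {k R : ℝ → ℝ} (h : KData μ ℓ k R) (δ : ℝ) (hδ : δ ∈ Icc 0 (2/ℓ)) (s : ℝ) (hs : 0 < s) :
    |src μ k R L L1 δ s| ≤ 26 * C * exp (s/4) := by
  have hk := h.kpos s hs
  have hC := hL.C1
  have a1 : HH k s / k s ≤ 1 + lam1 μ s := by
    rw [div_le_iff₀ hk, mul_comm]; exact h.H_le s hs
  have a0 : 0 ≤ HH k s / k s := div_nonneg (h.H_nonneg s hs) hk.le
  have b1 := hL.bL s hs.le
  have b2 := hL.bL1 s hs.le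
  have hl := h.ℓ0
  have hl64 := h.hℓ
  have c1 : (HH k s / k s) * δ ≤ 4 + 2 * s := by
    calc (HH k s / k s) * δ ≤ (1 + (ℓ + s)) * (2/ℓ) := by
          have hδ0 := hδ.1
          have hδ1 := hδ.2
          have := h.lam_le2 s hs
          exact mul_le_mul (by linarith) hδ1 hδ0 (by linarith)
      _ = 2 + 2 * (1 + s) / ℓ := by field_simp; ring
      _ ≤ 2 + 2 * (1 + s) := by gcongr; apply div_le_self (by positivity); linarith
      _ = _ := by ring
  have hR := h.Rpos s hs
  have c2 : (HH k s / k s) * R s ≤ 3 := by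
    calc (HH k s / k s) * R s ≤ (1 + lam1 μ s) * R s := by gcongr
      _ ≤ 3 := by linarith [h.Rlam s hs]
  have c0 : 0 ≤ (HH k s / k s) * δ := mul_nonneg a0 hδ.1
  have c3 : 0 ≤ (HH k s / k s) * R s := mul_nonneg a0 hR
  have d1 : |(HH k s / k s) * δ * L s| ≤ (4 + 2 * s) * (C * exp (s/8)) := by
    rw [abs_mul, abs_of_nonneg c0]; gcongr
  have d2 : |(HH k s / k s) * R s * L1 s| ≤ 3 * (C * exp (s/8)) := by
    rw [abs_mul, abs_of_nonneg c3]; gcongr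
  have e : src μ k R L L1 δ s = (HH k s / k s) * δ * L s - (HH k s / k s) * R s * L1 s + 2 * L1 s - L s := by
    unfold src; ring
  have e8 : exp (s/4) = exp (s/8) * exp (s/8) := by rw [← exp_add]; ring_nf
  have e9 : 1 ≤ exp (s/8) := one_le_exp (by positivity)
  have e10 := @s_le_exp s
  have f1 : |src μ k R L L1 δ s| ≤ (10 + 2 * s) * (C * exp (s/8)) := by
    rw [e, abs_le]
    have := abs_le.1 d1
    have := abs_le.1 d2
    have := abs_le.1 b1
    have := abs_le.1 b2
    constructor <;> linarith
  refine f1.trans ?_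
  rw [e8]
  calc (10 + 2 * s) * (C * exp (s/8)) ≤ (26 * exp (s/8)) * (C * exp (s/8)) := by gcongr; linarith
    _ = _ := by ring

theorem volterra {n : ℕ} {L L1 M : ℝ → ℝ} {C S1 : ℝ} (hL : LData n L L1 M C S1)
    {μ ℓ : ℝ} {k R : ℝ → ℝ} (h : KData μ ℓ k R) (Λ : ℝ) (hΛ : Λ = 2 * ((n:ℝ) + 1)) :
    ∃ G D : ℝ → ℝ → ℝ,
      (∀ s, 0 < s → ContinuousOn (fun δ => G δ s) (Icc 0 (2/ℓ))) ∧
      (∀ s, 0 < s → ContinuousOn (fun δ => D δ s) (Icc 0 (2/ℓ))) ∧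
      ∀ δ ∈ Icc 0 (2/ℓ), ∀ s, 0 < s →
        HasDerivAt (G δ) (G δ s + src μ k R L L1 δ s + ((n:ℝ) + δ) * D δ s / k s) s ∧
        HasDerivAt (D δ) (- (k s * G δ s / s)) s ∧
        |G δ s| ≤ 52 * C * s * exp (Λ * s) ∧ |D δ s| ≤ 52 * C * k s * exp (Λ * s) := by
  have hΛ2 : 2 ≤ Λ := by rw [hΛ]; have : (0:ℝ) ≤ n := Nat.cast_nonneg n; linarith
  have hC := hL.C1
  have hl := h.ℓ0
  have hHc : ContinuousOn (HH k) (Ioi 0) := fun s hs => (h.dH s hs).continuousAt.continuousWithinAt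
  have hLc : ContinuousOn L (Ioi 0) := fun s hs => (hL.dL s).continuousAt.continuousWithinAt
  have hL1c : ContinuousOn L1 (Ioi 0) := fun s hs => (hL.dL1 s hs).continuousAt.continuousWithinAt
  have hkc := h.kc
  have hkne : ∀ s ∈ Ioi (0:ℝ), k s ≠ 0 := fun s hs => (h.kpos s hs).ne'
  have hRc := h.cR
  -- sources
  have hsc : ∀ δ, ContinuousOn (fun s => exp (-(Λ * s)) * src μ k R L L1 δ s) (Ioi 0) := by
    intro δ
    unfold src
    have : ContinuousOn (fun s : ℝ => exp (-(Λ * s))) (Ioi 0) := by fun_prop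
    exact this.mul ((((hHc.div hkc hkne).mul ((continuousOn_const.mul hLc).sub (hRc.mul hL1c))).add
      (continuousOn_const.mul hL1c)).sub hLc)
  have hsb : ∀ δ ∈ Icc 0 (2/ℓ), ∀ s, 0 < s → |exp (-(Λ * s)) * src μ k R L L1 δ s| ≤ 26 * C := by
    intro δ hδ s hs
    rw [abs_mul, abs_of_pos (exp_pos _)]
    have e1 : exp (-(Λ*s)) * exp (s/4) ≤ 1 := by
      rw [← exp_add, exp_le_one_iff]; nlinarith
    calc exp (-(Λ * s)) * |src μ k R L L1 δ s| ≤ exp (-(Λ * s)) * (26 * C * exp (s/4)) := by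
          gcongr; exact src_bound hL h δ hδ s hs
      _ = 26 * C * (exp (-(Λ*s)) * exp (s/4)) := by ring
      _ ≤ 26 * C * 1 := by gcongr
      _ = _ := by ring
  have h0mem : (0:ℝ) ∈ Icc 0 (2/ℓ) := ⟨le_rfl, by positivity⟩
  have h1mem : (2/ℓ:ℝ) ∈ Icc 0 (2/ℓ) := ⟨by positivity, le_rfl⟩
  obtain ⟨s0, hs0⟩ := mkE _ (hsc 0) _ (hsb 0 h0mem)
  obtain ⟨st, hst⟩ := mkE _ (hsc (2/ℓ)) _ (hsb (2/ℓ) h1mem)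
  set s1 : EE := (ℓ/2) • (st - s0) with hs1
  have hsrc : ∀ δ s, 0 < s → ext0 (s0 + δ • s1) s = exp (-(Λ * s)) * src μ k R L L1 δ s := by
    intro δ s hs
    have e : ext0 (s0 + δ • s1) s = ext0 s0 s + δ * (ℓ/2 * (ext0 st s - ext0 s0 s)) := by
      simp [ext0_eq _ s hs, hs1]
    rw [e, hs0 s hs, hst s hs]
    unfold src
    field_simp
    ring
  -- operators
  have LBexp : ∀ c : ℝ, LB (fun t => exp (c * t)) := by
    intro c
    refine ⟨by fun_prop, fun s hs => ⟨exp (|c| * s), fun t ht => ?_⟩⟩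
    rw [abs_of_pos (exp_pos _), exp_le_exp]
    have := ht.1
    calc c * t ≤ |c| * t := by gcongr; exact le_abs_self c
      _ ≤ |c| * s := by gcongr; exact ht.2
  obtain ⟨B1, hB1, hB1e⟩ := volt (fun s => exp ((1 - Λ) * s) / s) (fun t => exp ((Λ - 1) * t))
    (ContinuousOn.div (by fun_prop) continuousOn_id (fun s hs => ne_of_gt hs)) (LBexp _)
    (fun s _ => (exp_pos _).le) 1 zero_le_one (by
      intro s hs
      have := LB.bound (F := fun t => exp ((Λ - 1) * t)) s (exp ((Λ-1)*s)) hs (fun t ht => by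
        rw [abs_of_pos (exp_pos _), exp_le_exp]
        have := ht.2
        have := ht.1
        nlinarith)
      have := (le_abs_self _).trans this
      rw [abs_of_pos (by positivity)]
      calc exp ((1 - Λ) * s) / s * (∫ t in (0:ℝ)..s, exp ((Λ - 1) * t)) ≤ exp ((1 - Λ) * s) / s * (exp ((Λ-1)*s) * s) := by gcongr
        _ = exp ((1 - Λ) * s) * exp ((Λ-1)*s) := by field_simp
        _ = 1 := by rw [← exp_add]; simp; ring
        _ ≤ 1 := le_rfl)
  have LBk : LB (fun t => k t * exp (Λ * t)) := by
    refine ⟨hkc.mul (by fun_prop), fun s hs => ⟨2 * exp (Λ * s), fun t ht => ?_⟩⟩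
    have := h.kpos t ht.1
    have h2 := h.k2 t ht.1
    rw [abs_of_pos (by positivity)]
    refine mul_le_mul h2 (exp_le_exp.2 ?_) (exp_pos _).le (by norm_num)
    exact mul_le_mul_of_nonneg_left ht.2 (by linarith)
  have kint : ∀ s, 0 < s → ∫ t in (0:ℝ)..s, k t * exp (Λ * t) ≤ k s * exp (Λ * s) / Λ := by
    intro s hs
    have c := cmp0 (b := fun t => k s * (exp (Λ * t) - 1) / Λ) (b' := fun t => k s * exp (Λ * t)) LBk.deriv (by
        intro t ht
        have := ((((hasDerivAt_id t).const_mul Λ).exp.sub_const 1).const_mul (k s)).div_const Λ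
        refine this.congr_deriv ?_
        simp
        field_simp) LBk.lim (by
        have : ContinuousAt (fun t => k s * (exp (Λ * t) - 1) / Λ) 0 := by fun_prop
        have := this.tendsto
        simp only [mul_zero, exp_zero, sub_self, zero_div] at this
        exact this.mono_left nhdsWithin_le_nhds) s hs (fun t ht => by
        have := h.kmono ht.1 ht.2
        exact mul_le_mul_of_nonneg_right this (exp_pos _).le)
    refine c.trans ?_
    have := h.kpos s hs
    show k s * (exp (Λ * s) - 1) / Λ ≤ k s * exp (Λ * s) / Λ
    apply div_le_div_of_nonneg_right _ (by linarith)
    nlinarith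
  obtain ⟨B2, hB2, hB2e⟩ := volt (fun s => - (exp (-(Λ * s)) / k s)) (fun t => k t * exp (Λ * t))
    (ContinuousOn.neg (ContinuousOn.div (by fun_prop) hkc hkne)) LBk
    (fun s hs => by have := h.kpos s hs; positivity) (1/Λ) (by positivity) (by
      intro s hs
      have := h.kpos s hs
      rw [abs_neg, abs_of_pos (by positivity)]
      calc exp (-(Λ * s)) / k s * (∫ t in (0:ℝ)..s, k t * exp (Λ * t)) ≤ exp (-(Λ * s)) / k s * (k s * exp (Λ * s) / Λ) := by
            gcongr; exact kint s hs
        _ = (exp (-(Λ * s)) * exp (Λ * s)) / Λ := by field_simp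
        _ = 1 / Λ := by rw [← exp_add]; simp
        _ ≤ _ := le_rfl)
  set B := B2.comp B1 with hB
  have hBn : ‖B‖ ≤ 1 / (2 * ((n:ℝ) + 1)) := by
    rw [← hΛ]
    calc ‖B‖ ≤ ‖B2‖ * ‖B1‖ := ContinuousLinearMap.opNorm_comp_le _ _
      _ ≤ (1/Λ) * 1 := by gcongr
      _ = _ := by ring
  obtain ⟨U, hUc, hU⟩ := fam B n hBn s0 s1
  have hsub : Icc 0 (2/ℓ) ⊆ Icc (0:ℝ) 1 := Icc_subset_Icc le_rfl (two_ell h)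
  have evc : ∀ (T : EE →L[ℝ] EE) (s : ℝ), 0 < s → ContinuousOn (fun δ => ext0 (T (U δ)) s) (Icc 0 (2/ℓ)) := by
    intro T s hs
    simp only [ext0_eq _ s hs]
    have h1 : Continuous (fun v : EE => v ⟨s, hs⟩) := (BoundedContinuousFunction.evalCLM ℝ _).continuous
    exact (h1.comp T.continuous).comp_continuousOn (hUc.mono hsub)
  refine ⟨fun δ s => s * exp (Λ * s) * ext0 (B1 (U δ)) s, fun δ s => k s * exp (Λ * s) * ext0 (B (U δ)) s,
    fun s hs => continuousOn_const.mul (evc B1 s hs), fun s hs => continuousOn_const.mul (evc B s hs), ?_⟩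
  intro δ hδ s hs
  have hUδ := hU δ (hsub hδ)
  have hUn : ‖U δ‖ ≤ 52 * C := by
    have : ‖s0 + δ • s1‖ ≤ 26 * C := by
      apply normE _ _ (by positivity)
      intro s hs
      rw [hsrc δ s hs]
      exact hsb δ hδ s hs
    linarith [hUδ.2]
  have hG : ∀ t, 0 < t → t * exp (Λ * t) * ext0 (B1 (U δ)) t
      = exp t * ∫ r in (0:ℝ)..t, exp ((Λ - 1) * r) * ext0 (U δ) r := by
    intro t ht
    rw [hB1e _ t ht]
    have : exp (Λ * t) * exp ((1 - Λ) * t) = exp t := by rw [← exp_add]; ring_nf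
    rw [← this]
    field_simp
  have hD : ∀ t, 0 < t → k t * exp (Λ * t) * ext0 (B (U δ)) t
      = - ∫ r in (0:ℝ)..t, (k r * exp (Λ * r)) * ext0 (B1 (U δ)) r := by
    intro t ht
    rw [hB, ContinuousLinearMap.comp_apply, hB2e _ t ht]
    have h1 : exp (Λ * t) * exp (-(Λ * t)) = 1 := by rw [← exp_add]; simp
    have h2 := h.kpos t ht
    calc _ = - ((exp (Λ * t) * exp (-(Λ * t))) * (k t / k t)) * ∫ r in (0:ℝ)..t, (k r * exp (Λ * r)) * ext0 (B1 (U δ)) r := by ring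
      _ = _ := by rw [h1, div_self h2.ne']; ring
  have hk := h.kpos s hs
  have hs' : (0:ℝ) < s := hs
  refine ⟨?_, ?_, ?_, ?_⟩
  · have d1 := (Real.hasDerivAt_exp s).mul ((LBmul (LBexp (Λ - 1)) (U δ)).deriv s hs)
    have d2 : HasDerivAt (fun s => s * exp (Λ * s) * ext0 (B1 (U δ)) s) _ s :=
      d1.congr_of_eventuallyEq (by
        filter_upwards [Ioi_mem_nhds hs] with t ht
        exact hG t ht)
    refine d2.congr_deriv ?_
    beta_reduce
    rw [hG s hs]
    have e1 : exp s * exp ((Λ - 1) * s) = exp (Λ * s) := by rw [← exp_add]; ring_nf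
    have e2 : ext0 (U δ) s = exp (-(Λ * s)) * src μ k R L L1 δ s + ((n:ℝ) + δ) * ext0 (B (U δ)) s := by
      have : ext0 (U δ) s = ext0 (s0 + δ • s1) s + ((n:ℝ) + δ) * ext0 (B (U δ)) s := by
        conv_lhs => rw [hUδ.1]
        simp [ext0_eq _ s hs]
      rw [this, hsrc δ s hs]
    have e3 : exp (Λ * s) * exp (-(Λ * s)) = 1 := by rw [← exp_add]; simp
    rw [← mul_assoc (exp s), e1, e2, mul_add, ← mul_assoc, e3]
    field_simp
    ring
  · have d1 := ((LBmul LBk (B1 (U δ))).deriv s hs).neg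
    have d2 : HasDerivAt (fun s => k s * exp (Λ * s) * ext0 (B (U δ)) s) _ s :=
      d1.congr_of_eventuallyEq (by
        filter_upwards [Ioi_mem_nhds hs] with t ht
        exact hD t ht)
    refine d2.congr_deriv ?_
    field_simp
  · rw [abs_mul, abs_of_pos (by positivity)]
    have b1 : |ext0 (B1 (U δ)) s| ≤ 52 * C := by
      refine (ext0_le _ s hs).trans ((B1.le_opNorm _).trans ?_)
      calc ‖B1‖ * ‖U δ‖ ≤ 1 * (52 * C) := by gcongr
        _ = _ := by ring
    calc s * exp (Λ * s) * |ext0 (B1 (U δ)) s| ≤ s * exp (Λ * s) * (52 * C) := by gcongr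
      _ = _ := by ring
  · rw [abs_mul, abs_of_pos (by positivity)]
    have b1 : |ext0 (B (U δ)) s| ≤ 52 * C := by
      refine (ext0_le _ s hs).trans ((B.le_opNorm _).trans ?_)
      have : ‖B‖ ≤ 1 := hBn.trans (by rw [← hΛ, div_le_one (by linarith)]; linarith)
      calc ‖B‖ * ‖U δ‖ ≤ 1 * (52 * C) := by gcongr
        _ = _ := by ring
    calc k s * exp (Λ * s) * |ext0 (B (U δ)) s| ≤ k s * exp (Λ * s) * (52 * C) := by gcongr
      _ = _ := by ring

lemma cmp0abs {a b a' b' : ℝ → ℝ} (ha : ∀ s, 0 < s → HasDerivAt a (a' s) s)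
    (hb : ∀ s, 0 < s → HasDerivAt b (b' s) s)
    (la : Filter.Tendsto a (nhdsWithin 0 (Ioi 0)) (nhds 0))
    (lb : Filter.Tendsto b (nhdsWithin 0 (Ioi 0)) (nhds 0))
    (s : ℝ) (hs : 0 < s) (hab : ∀ t ∈ Ioc 0 s, |a' t| ≤ b' t) : |a s| ≤ b s := by
  have lb' : Filter.Tendsto (fun t => - b t) (nhdsWithin 0 (Ioi 0)) (nhds 0) := by simpa using lb.neg
  have h1 := cmp0 ha hb la lb s hs (fun t ht => (abs_le.1 (hab t ht)).2)
  have h2 := cmp0 (a := fun t => - b t) (a' := fun t => - b' t) (fun t ht => (hb t ht).neg) ha lb' la s hs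
    (fun t ht => (abs_le.1 (hab t ht)).1)
  exact abs_le.2 ⟨h2, h1⟩

structure Sol (n : ℕ) (L L1 : ℝ → ℝ) (K Λ δ : ℝ) (k R W f : ℝ → ℝ) : Prop where
  dW : ∀ s, 0 < s → HasDerivAt W (f s) s
  df : ∀ s, 0 < s → HasDerivAt f ((-((n:ℝ) + δ) * W s - (1 - R s - s) * f s) / s) s
  bW : ∀ s, 0 < s → |W s - HH k s * L s| ≤ K * k s * exp (Λ * s)
  bf : ∀ s, 0 < s → |f s - (k s / s * L s + HH k s * L1 s)| ≤ K * k s * exp (Λ * s)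

theorem step2 {n : ℕ} {L L1 M : ℝ → ℝ} {C S1 : ℝ} (hL : LData n L L1 M C S1)
    {μ ℓ : ℝ} {k R : ℝ → ℝ} (h : KData μ ℓ k R) :
    ∃ W f : ℝ → ℝ → ℝ,
      (∀ s, 0 < s → ContinuousOn (fun δ => W δ s) (Icc 0 (2/ℓ))) ∧
      (∀ s, 0 < s → ContinuousOn (fun δ => f δ s) (Icc 0 (2/ℓ))) ∧
      ∀ δ ∈ Icc 0 (2/ℓ), Sol n L L1 (52 * C) (2 * ((n:ℝ) + 1)) δ k R (W δ) (f δ) := by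
  obtain ⟨G, D, cG, cD, hGD⟩ := volterra hL h _ rfl
  refine ⟨fun δ s => HH k s * L s + D δ s, fun δ s => k s / s * (L s - G δ s) + HH k s * L1 s,
    fun s hs => continuousOn_const.add (cD s hs),
    fun s hs => (continuousOn_const.mul (continuousOn_const.sub (cG s hs))).add continuousOn_const,
    fun δ hδ => ⟨fun s hs => ?_, fun s hs => ?_, fun s hs => ?_, fun s hs => ?_⟩⟩
  · obtain ⟨d1, d2, b1, b2⟩ := hGD δ hδ s hs
    refine (((h.dH s hs).mul (hL.dL s)).add d2).congr_deriv ?_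
    ring
  · obtain ⟨d1, d2, b1, b2⟩ := hGD δ hδ s hs
    have hk := h.kpos s hs
    refine ((((h.dk s hs).div (hasDerivAt_id s) hs.ne').mul ((hL.dL s).sub d1)).add
      ((h.dH s hs).mul (hL.dL1 s hs))).congr_deriv ?_
    unfold src
    simp
    field_simp
    ring
  · obtain ⟨d1, d2, b1, b2⟩ := hGD δ hδ s hs
    simpa using b2
  · obtain ⟨d1, d2, b1, b2⟩ := hGD δ hδ s hs
    have hk := h.kpos s hs
    have e : k s / s * (L s - G δ s) + HH k s * L1 s - (k s / s * L s + HH k s * L1 s) = -(k s / s * G δ s) := by ring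
    show |k s / s * (L s - G δ s) + HH k s * L1 s - (k s / s * L s + HH k s * L1 s)| ≤ _
    rw [e, abs_neg, abs_mul, abs_of_pos (by positivity)]
    calc k s / s * |G δ s| ≤ k s / s * (52 * C * s * exp (2 * ((n:ℝ) + 1) * s)) := by gcongr
      _ = _ := by field_simp

noncomputable def Jf (L L1 W f : ℝ → ℝ) (s : ℝ) : ℝ := s * exp (-s) * (f s * L s - W s * L1 s)

lemma dJ {n : ℕ} {L L1 M : ℝ → ℝ} {C S1 : ℝ} (hL : LData n L L1 M C S1)
    {K Λ δ : ℝ} {k R W f : ℝ → ℝ} (hS : Sol n L L1 K Λ δ k R W f) (s : ℝ) (hs : 0 < s) :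
    HasDerivAt (Jf L L1 W f) (exp (-s) * (R s * L s * f s - δ * L s * W s)) s := by
  have d0 : HasDerivAt (fun s : ℝ => exp (-s)) (-exp (-s)) s := by
    simpa using (hasDerivAt_id s).neg.exp
  refine (((hasDerivAt_id s).mul d0).mul (((hS.df s hs).mul (hL.dL s)).sub ((hS.dW s hs).mul (hL.dL1 s hs)))).congr_deriv ?_
  simp
  field_simp
  ring

lemma dEM {n : ℕ} {L L1 M : ℝ → ℝ} {C S1 : ℝ} (hL : LData n L L1 M C S1) (s : ℝ) :
    HasDerivAt (fun s => 1 - exp (-s) * M s) (exp (-s) * L s ^ 2) s := by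
  have d0 : HasDerivAt (fun s : ℝ => exp (-s)) (-exp (-s)) s := by
    simpa using (hasDerivAt_id s).neg.exp
  refine ((d0.mul (hL.dM s)).const_sub 1).congr_deriv ?_
  ring

lemma expL2 {n : ℕ} {L L1 M : ℝ → ℝ} {C S1 : ℝ} (hL : LData n L L1 M C S1) (A s : ℝ) (hs : 0 < s)
    (hA : ∀ t ∈ Ioc 0 s, |L t| ≤ A ∧ |L1 t| ≤ A) : |exp (-s) * L s ^ 2 - 1| ≤ 3 * A^2 * s := by
  have d : ∀ t, 0 < t → HasDerivAt (fun s => exp (-s) * L s ^ 2 - 1) (exp (-t) * (2 * L t * L1 t - L t^2)) t := by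
    intro t ht
    have d0 : HasDerivAt (fun s : ℝ => exp (-s)) (-exp (-t)) t := by
      simpa using (hasDerivAt_id t).neg.exp
    refine ((d0.mul ((hL.dL t).pow 2)).sub_const 1).congr_deriv ?_
    simp; ring
  have lim : Filter.Tendsto (fun s => exp (-s) * L s ^ 2 - 1) (nhdsWithin 0 (Ioi 0)) (nhds 0) := by
    have hc : ContinuousAt (fun s => exp (-s) * L s ^ 2 - 1) 0 := by
      have := (hL.dL 0).continuousAt
      fun_prop
    have := hc.tendsto
    simp only [neg_zero, exp_zero, hL.L0] at this
    norm_num at this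
    exact this.mono_left nhdsWithin_le_nhds
  have lim2 : Filter.Tendsto (fun s : ℝ => 3 * A^2 * s) (nhdsWithin 0 (Ioi 0)) (nhds 0) := by
    have hc : ContinuousAt (fun s : ℝ => 3 * A^2 * s) 0 := by fun_prop
    have := hc.tendsto
    simp only [mul_zero] at this
    exact this.mono_left nhdsWithin_le_nhds
  have d2 : ∀ t : ℝ, 0 < t → HasDerivAt (fun s : ℝ => 3 * A^2 * s) (3 * A^2) t := by
    intro t _
    simpa using (hasDerivAt_id t).const_mul (3 * A^2)
  have key : ∀ t ∈ Ioc 0 s, |exp (-t) * (2 * L t * L1 t - L t^2)| ≤ 3 * A^2 := by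
    intro t ht
    obtain ⟨a1, a2⟩ := hA t ht
    have e1 : exp (-t) ≤ 1 := by rw [exp_le_one_iff]; linarith [ht.1]
    have p1 : |L t * L1 t| ≤ A * A := by
      rw [abs_mul]; exact mul_le_mul a1 a2 (abs_nonneg _) ((abs_nonneg _).trans a1)
    have p2 : |L t * L t| ≤ A * A := by
      rw [abs_mul]; exact mul_le_mul a1 a1 (abs_nonneg _) ((abs_nonneg _).trans a1)
    have p3 : |2 * L t * L1 t - L t^2| ≤ 3 * A^2 := by
      rw [abs_le] at *
      constructor <;> nlinarith
    rw [abs_mul, abs_of_pos (exp_pos _)]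
    calc exp (-t) * |2 * L t * L1 t - L t^2| ≤ 1 * (3 * A^2) := by gcongr
      _ = _ := by ring
  exact cmp0abs d d2 lim lim2 s hs key

lemma sqrt_cmp {a a' : ℝ → ℝ} (ha : ∀ s, 0 < s → HasDerivAt a (a' s) s)
    (la : Filter.Tendsto a (nhdsWithin 0 (Ioi 0)) (nhds 0)) (c s : ℝ) (hs : 0 < s)
    (hab : ∀ t ∈ Ioc 0 s, |a' t| ≤ c / sqrt t) : |a s| ≤ 2 * c * sqrt s := by
  refine cmp0abs (b := fun s => 2 * c * sqrt s) (b' := fun t => c / sqrt t) ha (fun t ht => ?_) la ?_ s hs hab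
  · have q : 0 < sqrt t := sqrt_pos.2 ht
    refine ((Real.hasDerivAt_sqrt ht.ne').const_mul (2 * c)).congr_deriv ?_
    field_simp
  · have hc : ContinuousAt (fun s : ℝ => 2 * c * sqrt s) 0 := by fun_prop
    have := hc.tendsto
    simp only [sqrt_zero, mul_zero] at this
    exact this.mono_left nhdsWithin_le_nhds

set_option maxHeartbeats 1000000 in
theorem step3 {n : ℕ} {L L1 M : ℝ → ℝ} {C S1 : ℝ} (hL : LData n L L1 M C S1) (K Λ : ℝ) (hK : 0 ≤ K)
    (hΛ : 0 ≤ Λ) :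
    ∃ c : ℝ, 1 ≤ c ∧ ∀ (μ ℓ : ℝ) (k R : ℝ → ℝ), KData μ ℓ k R → ∀ δ ∈ Icc 0 (2/ℓ), ∀ W f : ℝ → ℝ,
      Sol n L L1 K Λ δ k R W f →
      |Jf L L1 W f S1 - k S1 + δ * ℓ * (1 - exp (-S1) * M S1)| ≤ c / ℓ ∧ |W S1 - ℓ * L S1| ≤ c := by
  obtain ⟨A, hA⟩ : ∃ A, A = C * exp (S1/8) := ⟨_, rfl⟩
  obtain ⟨E, hE⟩ : ∃ E, E = K * exp (Λ * S1) := ⟨_, rfl⟩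
  have hC := hL.C1
  have hS1 := hL.S11
  have hA1 : 1 ≤ A := by
    have : 1 ≤ exp (S1/8) := one_le_exp (by linarith)
    rw [hA]; nlinarith
  have hE0 : 0 ≤ E := by rw [hE]; positivity
  obtain ⟨c0, hc0⟩ : ∃ c0, c0 = (6 + 5 * S1) * S1 * A + 2 * A + 2 * E * S1 := ⟨_, rfl⟩
  obtain ⟨c2, hc2⟩ : ∃ c2, c2 = 6 * A^2 + 2 * (2 + S1) * A^2 + 2 * E * A := ⟨_, rfl⟩
  have c0p : 1 ≤ c0 := by
    have : 0 ≤ (6 + 5 * S1) * S1 * A := by positivity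
    have : 0 ≤ 2 * E * S1 := by positivity
    linarith
  have c2p : 0 ≤ c2 := by rw [hc2]; positivity
  refine ⟨2 * (2 * A * c0 + 48 * c2) * S1 + c0, by
    have : 0 ≤ 2 * (2 * A * c0 + 48 * c2) * S1 := by positivity
    linarith, ?_⟩
  intro μ ℓ k R h δ hδ W f hS
  have bA : ∀ t ∈ Ioc 0 S1, |L t| ≤ A ∧ |L1 t| ≤ A := by
    intro t ht
    have : C * exp (t/8) ≤ A := by rw [hA]; gcongr; exact ht.2
    exact ⟨(hL.bL t ht.1.le).trans this, (hL.bL1 t ht.1.le).trans this⟩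
  have bE : ∀ t ∈ Ioc 0 S1, K * k t * exp (Λ * t) ≤ E * k t := by
    intro t ht
    have := h.kpos t ht.1
    have : exp (Λ * t) ≤ exp (Λ * S1) := by gcongr; exact ht.2
    calc K * k t * exp (Λ * t) ≤ K * k t * exp (Λ * S1) := by gcongr
      _ = _ := by rw [hE]; ring
  have hμ0 := h.μ0
  have hl := h.ℓ0
  have hl64 := h.hℓ
  have bWl : ∀ t ∈ Ioc 0 S1, |W t - ℓ * L t| ≤ c0 / sqrt t := by
    intro t ht
    have q : 0 < sqrt t := sqrt_pos.2 ht.1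
    have q1 : sqrt t ≤ S1 := by
      rw [sqrt_le_left (by linarith)]
      nlinarith [ht.2]
    have a1 := (hS.bW t ht.1).trans (bE t ht)
    have a2 := h.k2 t ht.1
    have a3 := h.HHell t ht.1
    have a4 := (bA t ht).1
    have e : W t - ℓ * L t = (W t - HH k t * L t) + (HH k t - ℓ) * L t := by ring
    have a5 : |(HH k t - ℓ) * L t| ≤ (6 + 5 * t + 2 / sqrt t) * A := by
      rw [abs_mul]; have := ht.1; gcongr
    have a6 : |W t - ℓ * L t| ≤ 2 * E + (6 + 5 * S1 + 2 / sqrt t) * A := by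
      rw [e]
      refine (abs_add_le _ _).trans ?_
      have : E * k t ≤ E * 2 := by gcongr
      have : (6 + 5 * t + 2 / sqrt t) * A ≤ (6 + 5 * S1 + 2 / sqrt t) * A := by gcongr; exact ht.2
      linarith
    refine a6.trans ?_
    rw [le_div_iff₀ q]
    have : (2 * E + (6 + 5 * S1 + 2 / sqrt t) * A) * sqrt t = (2 * E + (6 + 5 * S1) * A) * sqrt t + 2 * A := by field_simp; ring
    rw [this]
    have : (2 * E + (6 + 5 * S1) * A) * sqrt t ≤ (2 * E + (6 + 5 * S1) * A) * S1 := by gcongr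
    rw [hc0]; linarith
  have hS1m : S1 ∈ Ioc 0 S1 := ⟨by linarith, le_rfl⟩
  have last : |W S1 - ℓ * L S1| ≤ c0 := by
    refine (bWl S1 hS1m).trans ?_
    apply div_le_self (by linarith)
    rw [le_sqrt' (by norm_num)]; linarith
  have der : ∀ s, 0 < s → HasDerivAt (fun s => Jf L L1 W f s - k s + δ * ℓ * (1 - exp (-s) * M s))
      (R s * (exp (-s) * L s * f s - k s / s) - δ * exp (-s) * L s * (W s - ℓ * L s)) s := by
    intro s hs
    refine (((dJ hL hS s hs).sub (h.dk s hs)).add ((dEM hL s).const_mul (δ * ℓ))).congr_deriv ?_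
    ring
  have lim : Filter.Tendsto (fun s => Jf L L1 W f s - k s + δ * ℓ * (1 - exp (-s) * M s)) (nhdsWithin 0 (Ioi 0)) (nhds 0) := by
    have l3 : Filter.Tendsto (fun s => δ * ℓ * (1 - exp (-s) * M s)) (nhdsWithin 0 (Ioi 0)) (nhds 0) := by
      have hc := ((dEM hL 0).const_mul (δ * ℓ)).continuousAt
      have := hc.tendsto
      simp only [neg_zero, exp_zero, hL.M0] at this
      norm_num at this
      exact this.mono_left nhdsWithin_le_nhds
    have l2 : Filter.Tendsto k (nhdsWithin 0 (Ioi 0)) (nhds 0) := by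
      apply tend0_of_bound (2/μ^2)
      intro s hs hs1
      rw [abs_of_pos (h.kpos s hs)]
      refine (h.ksq s hs).trans ?_
      gcongr
      nlinarith
    have l1 : Filter.Tendsto (Jf L L1 W f) (nhdsWithin 0 (Ioi 0)) (nhds 0) := by
      apply tend0_of_bound ((2/μ^2 * A + 2 * (1 + 1/μ) * A + 2 * E) * A + (2 * (1 + 1/μ) * A + 2 * E) * A)
      intro s hs hs1
      have hm : s ∈ Ioc 0 S1 := ⟨hs, by linarith⟩
      obtain ⟨a1, a2⟩ := bA s hm
      have a3 := (hS.bW s hs).trans (bE s hm)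
      have a4 := (hS.bf s hs).trans (bE s hm)
      have a5 := h.k2 s hs
      have hk := h.kpos s hs
      have a6 := h.H_le s hs
      have a7 := h.H_nonneg s hs
      have a8 := lam_le hμ0 hs
      have a9 := lam_nonneg hμ0 hs
      have a10 : s / μ ≤ 1 / μ := by gcongr
      have a11 : HH k s ≤ 2 * (1 + 1/μ) := by
        refine a6.trans ?_
        gcongr
        linarith
      have a12 : k s / s ≤ 2/μ^2 := by
        rw [div_le_iff₀ hs]
        refine (h.ksq s hs).trans ?_
        gcongr
        nlinarith
      have a13 : E * k s ≤ 2 * E := by nlinarith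
      have p1 : |HH k s * L s| ≤ 2 * (1 + 1/μ) * A := by
        rw [abs_mul, abs_of_nonneg a7]; gcongr
      have p2 : |HH k s * L1 s| ≤ 2 * (1 + 1/μ) * A := by
        rw [abs_mul, abs_of_nonneg a7]; gcongr
      have p3 : |k s / s * L s| ≤ 2/μ^2 * A := by
        rw [abs_mul, abs_of_pos (by positivity)]; gcongr
      have w1 : |W s| ≤ 2 * (1 + 1/μ) * A + 2 * E := by
        rw [abs_le] at *; constructor <;> linarith
      have f1 : |f s| ≤ 2/μ^2 * A + 2 * (1 + 1/μ) * A + 2 * E := by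
        rw [abs_le] at *; constructor <;> linarith
      have e1 : exp (-s) ≤ 1 := by rw [exp_le_one_iff]; linarith
      unfold Jf
      have g1 : |f s * L s - W s * L1 s| ≤ (2/μ^2 * A + 2 * (1 + 1/μ) * A + 2 * E) * A + (2 * (1 + 1/μ) * A + 2 * E) * A := by
        refine (abs_sub _ _).trans ?_
        rw [abs_mul, abs_mul]
        gcongr
      rw [abs_mul, abs_of_pos (by positivity)]
      calc s * exp (-s) * |f s * L s - W s * L1 s| ≤ s * 1 * ((2/μ^2 * A + 2 * (1 + 1/μ) * A + 2 * E) * A + (2 * (1 + 1/μ) * A + 2 * E) * A) := by gcongr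
        _ = _ := by ring
    simpa using (l1.sub l2).add l3
  have bd : ∀ t ∈ Ioc 0 S1, |R t * (exp (-t) * L t * f t - k t / t) - δ * exp (-t) * L t * (W t - ℓ * L t)| ≤
      ((2 * A * c0 + 48 * c2) / ℓ) / sqrt t := by
    intro t ht
    have ht0 := ht.1
    obtain ⟨a1, a2⟩ := bA t ht
    have q : 0 < sqrt t := sqrt_pos.2 ht.1
    have e1 : exp (-t) ≤ 1 := by rw [exp_le_one_iff]; linarith
    have e0 : 0 < exp (-t) := exp_pos _
    have hk := h.kpos t ht0
    have hk2 := h.k2 t ht0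
    have x1 : |δ * exp (-t) * L t * (W t - ℓ * L t)| ≤ (2/ℓ) * 1 * A * (c0 / sqrt t) := by
      rw [abs_mul, abs_mul, abs_mul, abs_of_nonneg hδ.1, abs_of_pos e0]
      have := hδ.1
      have := hδ.2
      have := bWl t ht
      gcongr
    have a4 := (hS.bf t ht0).trans (bE t ht)
    have a6 := h.H_le t ht0
    have a7 := h.H_nonneg t ht0
    have a9 := lam_nonneg hμ0 ht0
    have a8 := h.lam_le2 t ht0
    have a11 : HH k t ≤ 2 * (1 + ℓ + S1) := by
      refine a6.trans (mul_le_mul hk2 ?_ (by linarith) (by norm_num))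
      linarith [ht.2]
    have a12 : HH k t ≤ 2 * (2 + S1) * ℓ := by nlinarith
    have y1 := expL2 hL A t ht0 (fun r hr => bA r ⟨hr.1, hr.2.trans ht.2⟩)
    have y2 : |(k t / t) * (exp (-t) * L t^2 - 1)| ≤ 6 * A^2 := by
      rw [abs_mul, abs_of_pos (by positivity)]
      calc k t / t * |exp (-t) * L t^2 - 1| ≤ k t / t * (3 * A^2 * t) := by gcongr
        _ = k t * (3 * A^2) := by field_simp
        _ ≤ 2 * (3 * A^2) := by gcongr
        _ = _ := by ring
    have y3 : |exp (-t) * L t * HH k t * L1 t| ≤ 1 * A * (2 * (2 + S1) * ℓ) * A := by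
      rw [abs_mul, abs_mul, abs_mul, abs_of_pos e0, abs_of_nonneg a7]
      gcongr
    have y4 : |exp (-t) * L t * (f t - (k t / t * L t + HH k t * L1 t))| ≤ 1 * A * (E * 2) := by
      rw [abs_mul, abs_mul, abs_of_pos e0]
      have : E * k t ≤ E * 2 := by gcongr
      have := a4.trans this
      gcongr
    have e : exp (-t) * L t * f t - k t / t = (k t / t) * (exp (-t) * L t^2 - 1) + exp (-t) * L t * HH k t * L1 t
        + exp (-t) * L t * (f t - (k t / t * L t + HH k t * L1 t)) := by ring
    have y5 : |exp (-t) * L t * f t - k t / t| ≤ c2 * ℓ := by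
      rw [e]
      refine (abs_add_three _ _ _).trans ?_
      have : 6 * A^2 ≤ 6 * A^2 * ℓ := le_mul_of_one_le_right (by positivity) (by linarith)
      have : E * A * 2 ≤ E * A * 2 * ℓ := le_mul_of_one_le_right (by positivity) (by linarith)
      have hx : c2 * ℓ = 6 * A^2 * ℓ + 1 * A * (2 * (2 + S1) * ℓ) * A + E * A * 2 * ℓ := by rw [hc2]; ring
      rw [hx]
      linarith
    have hR := h.Rpos t ht0
    have r1 : R t ≤ 3 * (sqrt μ / sqrt t) := (h.R2 t ht0).trans (by linarith [h.μs t ht0])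
    have sq := h.sqrtμ
    have x2 : |R t * (exp (-t) * L t * f t - k t / t)| ≤ 3 * (sqrt μ / sqrt t) * (c2 * ℓ) := by
      rw [abs_mul, abs_of_nonneg hR]; gcongr
    have x3 : 3 * (sqrt μ / sqrt t) * (c2 * ℓ) ≤ 48 * c2 / ℓ / sqrt t := by
      have : 3 * (sqrt μ / sqrt t) * (c2 * ℓ) = 3 * c2 * (sqrt μ * ℓ^2) / ℓ / sqrt t := by field_simp
      rw [this]
      apply div_le_div_of_nonneg_right _ q.le
      apply div_le_div_of_nonneg_right _ hl.le
      have := mul_le_mul_of_nonneg_left sq c2p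
      linarith
    refine (abs_sub _ _).trans ?_
    have : (2 * A * c0 + 48 * c2) / ℓ / sqrt t = (2/ℓ) * 1 * A * (c0 / sqrt t) + 48 * c2 / ℓ / sqrt t := by ring
    rw [this]; linarith
  have fin := sqrt_cmp der lim _ S1 hS1m.1 bd
  refine ⟨?_, last.trans ?_⟩
  · refine fin.trans ?_
    have q1 : sqrt S1 ≤ S1 := by
      rw [sqrt_le_left (by linarith)]
      nlinarith
    calc 2 * ((2 * A * c0 + 48 * c2) / ℓ) * sqrt S1 ≤ 2 * ((2 * A * c0 + 48 * c2) / ℓ) * S1 := by gcongr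
      _ = (2 * (2 * A * c0 + 48 * c2) * S1) / ℓ := by ring
      _ ≤ _ := by gcongr; linarith
  · have : 0 ≤ 2 * (2 * A * c0 + 48 * c2) * S1 := by positivity
    linarith

lemma inv_region {g j α d : ℝ → ℝ} {δ S1 : ℝ} (hδ : 0 < δ) (hδ2 : δ ≤ 1/32) (hS1 : 1 ≤ S1)
    (dg : ∀ s, S1 ≤ s → HasDerivAt g (j s / s) s)
    (dj : ∀ s, S1 ≤ s → HasDerivAt j (α s * j s - d s * g s) s)
    (hα : ∀ s, S1 ≤ s → 3/4 ≤ α s) (hd : ∀ s, S1 ≤ s → 0 ≤ d s) (hd2 : ∀ s, S1 ≤ s → d s ≤ 5/4 * δ)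
    (s0 : ℝ) (hs0 : S1 ≤ s0) (h1 : 0 < j s0) (h2 : 0 < j s0 - 2 * δ * g s0) (s : ℝ) (hs : s0 ≤ s) :
    0 < j s ∧ 0 < j s - 2 * δ * g s := by
  by_contra hcon
  have cj : ContinuousOn j (Icc s0 s) := fun t ht => (dj t (hs0.trans ht.1)).continuousAt.continuousWithinAt
  have cg : ContinuousOn g (Icc s0 s) := fun t ht => (dg t (hs0.trans ht.1)).continuousAt.continuousWithinAt
  have cb : ContinuousOn (fun t => j t - 2 * δ * g t) (Icc s0 s) := cj.sub (continuousOn_const.mul cg)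
  have cm : ContinuousOn (fun t => min (j t) (j t - 2 * δ * g t)) (Icc s0 s) := cj.inf cb
  let Z := Icc s0 s ∩ (fun t => min (j t) (j t - 2 * δ * g t)) ⁻¹' (Iic 0)
  have Zc : IsCompact Z := by
    apply IsCompact.of_isClosed_subset isCompact_Icc _ inter_subset_left
    exact cm.preimage_isClosed_of_isClosed isClosed_Icc isClosed_Iic
  have Zne : Z.Nonempty := by
    refine ⟨s, ⟨hs, le_rfl⟩, ?_⟩
    simp only [mem_preimage, mem_Iic]
    by_contra h
    rw [not_le, lt_min_iff] at h
    exact hcon h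
  obtain ⟨t, ht, htm⟩ := Zc.exists_isLeast Zne
  have ht0 : s0 ≤ t := ht.1.1
  have pos : ∀ r ∈ Ico s0 t, 0 < j r ∧ 0 < j r - 2 * δ * g r := by
    intro r hr
    rw [← lt_min_iff]
    by_contra h
    rw [not_lt] at h
    have := htm (show r ∈ Z from ⟨⟨hr.1, hr.2.le.trans ht.1.2⟩, h⟩)
    linarith [hr.2]
  have key : ∀ r ∈ Ico s0 t, 0 ≤ α r * j r - d r * g r ∧ 0 ≤ α r * j r - d r * g r - 2 * δ * (j r / r) := by
    intro r hr
    obtain ⟨p1, p2⟩ := pos r hr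
    have hr1 : S1 ≤ r := hs0.trans hr.1
    have a1 := hα r hr1
    have a2 := hd r hr1
    have a3 := hd2 r hr1
    have hjr : j r / r ≤ j r := div_le_self p1.le (by linarith)
    have hjr0 : 0 ≤ j r / r := div_nonneg p1.le (by linarith)
    have b1 : 2 * δ * (j r / r) ≤ j r / 16 := by nlinarith
    have b2 : 3/4 * j r ≤ α r * j r := by nlinarith
    have b3 : d r * g r ≤ 5/8 * j r := by
      rcases le_or_gt 0 (g r) with hg | hg
      · have : d r * g r ≤ 5/4 * δ * g r := by nlinarith
        nlinarith
      · nlinarith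
    constructor
    · linarith
    · have : 0 ≤ 2 * δ * (j r / r) := by positivity
      linarith
  have sub : Icc s0 t ⊆ Icc s0 s := Icc_subset_Icc le_rfl ht.1.2
  have m1 : MonotoneOn j (Icc s0 t) := by
    apply monotoneOn_of_deriv_nonneg (convex_Icc _ _) (cj.mono sub)
    · intro r hr
      rw [interior_Icc] at hr
      exact (dj r (hs0.trans hr.1.le)).differentiableAt.differentiableWithinAt
    · intro r hr
      rw [interior_Icc] at hr
      rw [(dj r (hs0.trans hr.1.le)).deriv]
      exact (key r ⟨hr.1.le, hr.2⟩).1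
  have m2 : MonotoneOn (fun t => j t - 2 * δ * g t) (Icc s0 t) := by
    have dd : ∀ r ∈ Ioo s0 t, HasDerivAt (fun t => j t - 2 * δ * g t) (α r * j r - d r * g r - 2 * δ * (j r / r)) r :=
      fun r hr => (dj r (hs0.trans hr.1.le)).sub ((dg r (hs0.trans hr.1.le)).const_mul (2 * δ))
    apply monotoneOn_of_deriv_nonneg (convex_Icc _ _) (cb.mono sub)
    · intro r hr
      rw [interior_Icc] at hr
      exact (dd r hr).differentiableAt.differentiableWithinAt
    · intro r hr
      rw [interior_Icc] at hr
      rw [(dd r hr).deriv]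
      exact (key r ⟨hr.1.le, hr.2⟩).2
  have q1 := m1 ⟨le_rfl, ht0⟩ ⟨ht0, le_rfl⟩ ht0
  have q2 := m2 ⟨le_rfl, ht0⟩ ⟨ht0, le_rfl⟩ ht0
  have q3 : min (j t) (j t - 2 * δ * g t) ≤ 0 := ht.2
  have q4 : 0 < min (j t) (j t - 2 * δ * g t) := lt_min (by linarith) (by simp only at q2; linarith)
  linarith

lemma wazewski {F H : ℝ → ℝ → ℝ} {a b S1 : ℝ} (hab : a ≤ b)
    (cF : ∀ s, S1 ≤ s → ContinuousOn (F s) (Icc a b)) (cH : ∀ s, S1 ≤ s → ContinuousOn (H s) (Icc a b))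
    (disj : ∀ δ ∈ Icc a b, ∀ s, S1 ≤ s → ∀ s', S1 ≤ s' → 0 < F s δ → 0 < H s δ → F s' δ < 0 → H s' δ < 0 → False)
    (ha : 0 < F S1 a ∧ 0 < H S1 a) (hb : F S1 b < 0 ∧ H S1 b < 0) :
    ∃ δ ∈ Icc a b, ∀ s, S1 ≤ s → (0 < F s δ → H s δ ≤ 0) ∧ (F s δ < 0 → 0 ≤ H s δ) := by
  by_contra hcon
  push Not at hcon
  let p : ℝ → ℝ := fun x => (projIcc a b hab x : ℝ)
  have hp : Continuous p := continuous_subtype_val.comp continuous_projIcc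
  have hpm : ∀ x, p x ∈ Icc a b := fun x => (projIcc a b hab x).2
  have cF' : ∀ s, S1 ≤ s → Continuous (fun x => F s (p x)) := fun s hs => (cF s hs).comp_continuous hp hpm
  have cH' : ∀ s, S1 ≤ s → Continuous (fun x => H s (p x)) := fun s hs => (cH s hs).comp_continuous hp hpm
  let u : Set ℝ := ⋃ s ∈ Ici S1, {x | 0 < F s (p x)} ∩ {x | 0 < H s (p x)}
  let v : Set ℝ := ⋃ s ∈ Ici S1, {x | F s (p x) < 0} ∩ {x | H s (p x) < 0}
  have uo : IsOpen u := isOpen_biUnion fun s hs =>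
    (isOpen_lt continuous_const (cF' s hs)).inter (isOpen_lt continuous_const (cH' s hs))
  have vo : IsOpen v := isOpen_biUnion fun s hs =>
    (isOpen_lt (cF' s hs) continuous_const).inter (isOpen_lt (cH' s hs) continuous_const)
  have cov : u ∪ v = univ := by
    rw [eq_univ_iff_forall]
    intro x
    obtain ⟨s, hs, h⟩ := hcon (p x) (hpm x)
    by_cases h1 : 0 < F s (p x) ∧ 0 < H s (p x)
    · left
      simp only [u, mem_iUnion]
      exact ⟨s, hs, h1⟩
    · right
      simp only [v, mem_iUnion]
      exact ⟨s, hs, h (fun q => not_lt.1 (fun q' => h1 ⟨q, q'⟩))⟩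
  have pa : p a = a := by simp [p]
  have pb : p b = b := by simp [p]
  have une : u.Nonempty := ⟨a, by
    simp only [u, mem_iUnion]
    exact ⟨S1, self_mem_Ici, by simpa [pa] using ha⟩⟩
  have vne : v.Nonempty := ⟨b, by
    simp only [v, mem_iUnion]
    exact ⟨S1, self_mem_Ici, by simpa [pb] using hb⟩⟩
  obtain ⟨x, hxu, hxv⟩ := nonempty_inter uo vo cov une vne
  simp only [u, mem_iUnion] at hxu
  simp only [v, mem_iUnion] at hxv
  obtain ⟨s, hs, h1⟩ := hxu
  obtain ⟨s', hs', h2⟩ := hxv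
  exact disj (p x) (hpm x) s hs s' hs' h1.1 h1.2 h2.1 h2.2

lemma disj_region {g j α d : ℝ → ℝ} {δ S1 : ℝ} (hδ : 0 < δ) (hδ2 : δ ≤ 1/32) (hS1 : 1 ≤ S1)
    (dg : ∀ s, S1 ≤ s → HasDerivAt g (j s / s) s)
    (dj : ∀ s, S1 ≤ s → HasDerivAt j (α s * j s - d s * g s) s)
    (hα : ∀ s, S1 ≤ s → 3/4 ≤ α s) (hd : ∀ s, S1 ≤ s → 0 ≤ d s) (hd2 : ∀ s, S1 ≤ s → d s ≤ 5/4 * δ)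
    (s : ℝ) (hs : S1 ≤ s) (s' : ℝ) (hs' : S1 ≤ s') (h1 : 0 < j s) (h2 : 0 < j s - 2 * δ * g s)
    (h3 : j s' < 0) (h4 : j s' - 2 * δ * g s' < 0) : False := by
  rcases le_total s s' with h | h
  · have := inv_region hδ hδ2 hS1 dg dj hα hd hd2 s hs h1 h2 s' h
    linarith [this.1]
  · have := inv_region (g := fun s => - g s) (j := fun s => - j s) hδ hδ2 hS1
      (fun s hs => (dg s hs).neg.congr_deriv (by ring)) (fun s hs => (dj s hs).neg.congr_deriv (by ring))
      hα hd hd2 s' hs' (by linarith) (by linarith) s h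
    linarith [this.1]

lemma growth {g j : ℝ → ℝ} {δ S1 : ℝ} (hδ : 0 < δ) (hδ2 : δ ≤ 1/32) (hS1 : 1 ≤ S1)
    (dg : ∀ s, S1 ≤ s → HasDerivAt g (j s / s) s)
    (hj : ∀ s, S1 ≤ s → (0 < j s → j s - 2 * δ * g s ≤ 0) ∧ (j s < 0 → 0 ≤ j s - 2 * δ * g s))
    (s : ℝ) (hs : S1 ≤ s) : |j s| ≤ 2 * δ * |g s| ∧ |g s| ≤ |g S1| * s := by
  have hb : ∀ s, S1 ≤ s → |j s| ≤ 2 * δ * |g s| := by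
    intro s hs
    obtain ⟨h1, h2⟩ := hj s hs
    rcases lt_trichotomy (j s) 0 with h | h | h
    · have := h2 h
      rw [abs_of_neg h]
      have := neg_abs_le (g s)
      nlinarith
    · rw [h, abs_zero]; positivity
    · have := h1 h
      rw [abs_of_pos h]
      have := le_abs_self (g s)
      nlinarith
  refine ⟨hb s hs, ?_⟩
  have dd : ∀ r, S1 ≤ r → HasDerivAt (fun r => g r ^ 2 / r^2) (2 * (g r * j r - g r ^ 2) / r^3) r := by
    intro r hr
    have hr0 : r ≠ 0 := by linarith
    refine (((dg r hr).pow 2).div (hasDerivAt_pow 2 r) (by positivity)).congr_deriv ?_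
    simp
    field_simp
  have an : AntitoneOn (fun r => g r ^ 2 / r^2) (Ici S1) := by
    apply antitoneOn_of_deriv_nonpos (convex_Ici _)
    · exact fun r hr => (dd r hr).continuousAt.continuousWithinAt
    · intro r hr
      rw [interior_Ici] at hr
      exact (dd r (le_of_lt hr)).differentiableAt.differentiableWithinAt
    · intro r hr
      rw [interior_Ici] at hr
      rw [(dd r (le_of_lt hr)).deriv]
      have hr1 : S1 < r := hr
      have a1 := hb r hr1.le
      have a2 : g r * j r ≤ g r ^2 := by
        have : g r * j r ≤ |g r| * |j r| := by rw [← abs_mul]; exact le_abs_self _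
        have h3 : |g r| * |j r| ≤ |g r| * |g r| := by
          have := abs_nonneg (g r)
          apply mul_le_mul_of_nonneg_left _ this
          nlinarith
        rw [abs_mul_abs_self] at h3
        nlinarith
      apply div_nonpos_of_nonpos_of_nonneg
      · linarith
      · have : 0 < r := by linarith
        positivity
  have h1 := an (show S1 ∈ Ici S1 from self_mem_Ici) (show s ∈ Ici S1 from hs) hs
  have hs0 : 0 < s := by linarith
  simp only at h1
  have h2 : g S1 ^ 2 / S1^2 ≤ g S1^2 := div_le_self (sq_nonneg _) (by nlinarith)
  have h3 : g s^2 ≤ g S1^2 * s^2 := by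
    rw [← div_le_iff₀ (by positivity)]; linarith
  apply abs_le_of_sq_le_sq _ (by positivity)
  rw [mul_pow, sq_abs]; exact h3

lemma μℓ {μ ℓ : ℝ} {k R : ℝ → ℝ} (h : KData μ ℓ k R) : μ * ℓ^2 ≤ 1/4 ∧ μ ≤ 1 / (4 * ℓ) / 2 := by
  have h0 := h.μ0
  have hl := h.ℓ0
  have hl64 := h.hℓ
  have q := h.sqrtμ
  have e := sq_sqrt h0.le
  have q0 := sqrt_nonneg μ
  have a1 : μ * ℓ^2 * ℓ^2 ≤ 256 := by
    have : (sqrt μ * ℓ^2)^2 ≤ 16^2 := by gcongr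
    nlinarith
  have a2 : μ * ℓ^2 ≤ 1/4 := by
    have : (4096:ℝ) ≤ ℓ^2 := by nlinarith
    have : 0 ≤ μ * ℓ^2 := by positivity
    nlinarith
  refine ⟨a2, ?_⟩
  rw [div_div, le_div_iff₀ (by positivity)]
  have : 0 ≤ μ * ℓ := by positivity
  nlinarith

lemma gj {n : ℕ} {L L1 M : ℝ → ℝ} {C S1 : ℝ} (hL : LData n L L1 M C S1)
    {μ ℓ : ℝ} {k R : ℝ → ℝ} (h : KData μ ℓ k R) {K Λ δ : ℝ} (hδ : 1/(4*ℓ) ≤ δ) {W f : ℝ → ℝ}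
    (hS : Sol n L L1 K Λ δ k R W f) (s : ℝ) (hs : S1 ≤ s) :
    HasDerivAt (fun s => W s / L s) ((s * (f s * L s - W s * L1 s) / L s^2) / s) s ∧
    HasDerivAt (fun s => s * (f s * L s - W s * L1 s) / L s^2)
      ((1 - 2 * (L1 s / L s) + R s / s) * (s * (f s * L s - W s * L1 s) / L s^2)
        - (δ - R s * (L1 s / L s)) * (W s / L s)) s ∧
    3/4 ≤ 1 - 2 * (L1 s / L s) + R s / s ∧ 0 ≤ δ - R s * (L1 s / L s) ∧
      δ - R s * (L1 s / L s) ≤ 5/4 * δ := by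
  have hs1 : 1 ≤ s := hL.S11.trans hs
  have hs0 : 0 < s := by linarith
  have hne := hL.nz s hs
  have h8 := hL.b8 s hs
  have hR := h.Rpos s hs0
  have h0 := h.μ0
  have hr : |L1 s / L s| ≤ 1/8 := by
    rw [abs_div, div_le_iff₀ (abs_pos.2 hne)]; linarith
  have hrr := abs_le.1 hr
  have hRu : R s ≤ 3 * μ := by
    refine (h.R2 s hs0).trans ?_
    gcongr
    apply div_le_self h0.le
    linarith
  have hRd : R s ≤ 3 / 2 * δ := by linarith [(μℓ h).2]
  refine ⟨?_, ?_, ?_, ?_, ?_⟩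
  · refine ((hS.dW s hs0).div (hL.dL s) hne).congr_deriv ?_
    field_simp
  · refine (((hasDerivAt_id s).mul (((hS.df s hs0).mul (hL.dL s)).sub ((hS.dW s hs0).mul (hL.dL1 s hs0)))).div
      ((hL.dL s).pow 2) (pow_ne_zero 2 hne)).congr_deriv ?_
    simp
    field_simp
    ring
  · have : 0 ≤ R s / s := by positivity
    linarith
  · nlinarith
  · nlinarith

lemma kS1 {μ ℓ : ℝ} {k R : ℝ → ℝ} (h : KData μ ℓ k R) (s : ℝ) (hs : 1 ≤ s) : |k s - 1| ≤ 6 / ℓ := by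
  have h0 := h.μ0
  have hl := h.ℓ0
  have hs0 : 0 < s := by linarith
  have a1 := h.kk s hs0
  have a2 := k0_le_one h0 hs0
  have a3 : 1 - 2 * μ ≤ k0 μ s := by
    unfold k0
    rw [le_div_iff₀ (by positivity)]
    have : 0 ≤ μ * s := by positivity
    nlinarith [mul_nonneg h0.le (sq_nonneg (s)), mul_nonneg h0.le (mul_nonneg h0.le hs0.le), pow_pos h0 3]
  have a4 : μ ≤ 1 / ℓ := (μℓ h).2.trans (by rw [div_div]; gcongr; linarith)
  have a5 : 4 / ℓ * k0 μ s ≤ 4 / ℓ * 1 := by gcongr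
  have e1 : 4 / ℓ = 4 * (1 / ℓ) := by ring
  have e2 : 6 / ℓ = 6 * (1 / ℓ) := by ring
  rw [e1] at a1 a5
  rw [e2]
  have : 0 < 1 / ℓ := by positivity
  rw [abs_le] at *
  constructor <;> linarith

/-- growth of the quotient on the far region -/
lemma far {n : ℕ} {L L1 M : ℝ → ℝ} {C S1 : ℝ} (hL : LData n L L1 M C S1)
    {μ ℓ : ℝ} {k R : ℝ → ℝ} (h : KData μ ℓ k R) {K Λ δ : ℝ} (hδ : 1/(4*ℓ) ≤ δ) (hδ2 : δ ≤ 2/ℓ) {W f : ℝ → ℝ}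
    (hS : Sol n L L1 K Λ δ k R W f) (c : ℝ) (hc : 0 ≤ c) (hcl : c ≤ ℓ) (hg : |W S1 / L S1 - ℓ| ≤ c)
    (hj : ∀ s, S1 ≤ s → (0 < s * (f s * L s - W s * L1 s) / L s^2 →
        s * (f s * L s - W s * L1 s) / L s^2 - 2 * δ * (W s / L s) ≤ 0) ∧
      (s * (f s * L s - W s * L1 s) / L s^2 < 0 → 0 ≤ s * (f s * L s - W s * L1 s) / L s^2 - 2 * δ * (W s / L s)))
    (s : ℝ) (hs : S1 ≤ s) :
    |W s / L s - ℓ| ≤ (c + 8) * s ∧ |(f s * L s - W s * L1 s) / L s^2| ≤ 8 := by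
  have hl := h.ℓ0
  have hl64 := h.hℓ
  have hδ0 : 0 < δ := lt_of_lt_of_le (by positivity) hδ
  have hδ3 : δ ≤ 1/32 := hδ2.trans (by rw [div_le_div_iff₀ hl (by norm_num)]; linarith)
  have hS1 := hL.S11
  have gr := growth hδ0 hδ3 hS1 (fun s hs => (gj hL h hδ hS s hs).1) hj
  have hgl : |W S1 / L S1| ≤ 2 * ℓ := by
    rw [abs_le] at *; constructor <;> linarith
  have dbound : ∀ s, S1 ≤ s → |(s * (f s * L s - W s * L1 s) / L s^2) / s| ≤ 8 := by
    intro s hs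
    have hs0 : 0 < s := by linarith
    obtain ⟨g1, g2⟩ := gr s hs
    rw [abs_div, abs_of_pos hs0, div_le_iff₀ hs0]
    refine g1.trans ?_
    have : |W s / L s| ≤ 2 * ℓ * s := g2.trans (by gcongr)
    calc 2 * δ * |W s / L s| ≤ 2 * (2/ℓ) * (2 * ℓ * s) := by gcongr
      _ = 8 * s := by field_simp; norm_num
  constructor
  · have mv := (convex_Ici S1).norm_image_sub_le_of_norm_hasDerivWithin_le (C := 8)
      (fun x hx => (gj hL h hδ hS x hx).1.hasDerivWithinAt) (fun x hx => dbound x hx)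
      (self_mem_Ici (a := S1)) (show s ∈ Ici S1 from hs)
    rw [Real.norm_eq_abs, Real.norm_eq_abs, abs_of_nonneg (sub_nonneg.2 hs)] at mv
    have : (c + 8) * s ≥ c + 8 * s := by nlinarith
    rw [abs_le] at *
    constructor <;> linarith
  · have hs0 : 0 < s := by linarith
    have := dbound s hs
    have e : (s * (f s * L s - W s * L1 s) / L s^2) / s = (f s * L s - W s * L1 s) / L s^2 := by field_simp
    rwa [e] at this

lemma expcmp {E E' : ℝ → ℝ} {S1 b : ℝ} (hb : 0 ≤ b) (hS1 : 0 ≤ S1) (dE : ∀ s, S1 ≤ s → HasDerivAt E (E' s) s)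
    (bE : ∀ s, S1 ≤ s → |E' s| ≤ b * exp (-(s/2))) (s : ℝ) (hs : S1 ≤ s) : |E s - E S1| ≤ 2 * b := by
  have d0 : ∀ s : ℝ, HasDerivAt (fun s : ℝ => 2 * b * exp (-(s/2))) (- (b * exp (-(s/2)))) s := by
    intro s
    refine ((((hasDerivAt_id s).div_const 2).neg.exp).const_mul (2 * b)).congr_deriv ?_
    simp; ring
  have m1 : MonotoneOn (fun s => E s - 2 * b * exp (-(s/2))) (Ici S1) := by
    have dd := fun s hs => (dE s hs).sub (d0 s)
    apply monotoneOn_of_deriv_nonneg (convex_Ici _)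
    · exact fun r hr => (dd r hr).continuousAt.continuousWithinAt
    · intro r hr
      rw [interior_Ici] at hr
      exact (dd r (le_of_lt hr)).differentiableAt.differentiableWithinAt
    · intro r hr
      rw [interior_Ici] at hr
      have h1 := (dd r (le_of_lt hr)).deriv
      have h2 := (abs_le.1 (bE r (le_of_lt hr))).1
      refine le_of_le_of_eq ?_ h1.symm
      linarith
  have m2 : AntitoneOn (fun s => E s + 2 * b * exp (-(s/2))) (Ici S1) := by
    have dd := fun s hs => (dE s hs).add (d0 s)
    apply antitoneOn_of_deriv_nonpos (convex_Ici _)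
    · exact fun r hr => (dd r hr).continuousAt.continuousWithinAt
    · intro r hr
      rw [interior_Ici] at hr
      exact (dd r (le_of_lt hr)).differentiableAt.differentiableWithinAt
    · intro r hr
      rw [interior_Ici] at hr
      have h1 := (dd r (le_of_lt hr)).deriv
      have h2 := (abs_le.1 (bE r (le_of_lt hr))).2
      refine le_of_eq_of_le h1 ?_
      linarith
  have q1 := m1 (self_mem_Ici (a := S1)) (show s ∈ Ici S1 from hs) hs
  have q2 := m2 (self_mem_Ici (a := S1)) (show s ∈ Ici S1 from hs) hs
  simp only at q1 q2
  have e1 : 2 * b * exp (-(S1/2)) ≤ 2 * b := by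
    apply mul_le_of_le_one_right (by positivity)
    rw [exp_le_one_iff]; linarith
  have e2 : 0 ≤ 2 * b * exp (-(s/2)) := by positivity
  rw [abs_le]
  constructor <;> linarith

set_option maxHeartbeats 1000000 in
theorem step45 {n : ℕ} {L L1 M : ℝ → ℝ} {C S1 : ℝ} (hL : LData n L L1 M C S1) :
    ∃ c ℓ0 : ℝ, 1 ≤ c ∧ ∀ (μ ℓ : ℝ) (k R : ℝ → ℝ), KData μ ℓ k R → ℓ0 ≤ ℓ → 
      ∃ δ ∈ Icc 0 (2/ℓ), ∃ W f : ℝ → ℝ, Sol n L L1 (52 * C) (2 * ((n:ℝ) + 1)) δ k R W f ∧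
        |δ - 1/ℓ| ≤ c / ℓ^2 ∧ |W S1 - ℓ * L S1| ≤ c ∧
        ∀ s, S1 ≤ s → |f s - ℓ * L1 s| ≤ c * s * exp (s/8) := by
  have hC := hL.C1
  have hS1 := hL.S11
  obtain ⟨c, hc1, hc⟩ := step3 hL (52 * C) (2 * ((n:ℝ) + 1)) (by positivity) (by positivity)
  have hLS := hL.nz S1 le_rfl
  have haL : 0 < |L S1| := abs_pos.2 hLS
  obtain ⟨cg, hcg⟩ : ∃ cg, cg = c / |L S1| := ⟨_, rfl⟩
  have hcg0 : 0 ≤ cg := by rw [hcg]; positivity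
  obtain ⟨c4, hc4⟩ : ∃ c4, c4 = 8 * C + (cg + 8) * C := ⟨_, rfl⟩
  obtain ⟨c3, hc3⟩ : ∃ c3, c3 = 3 * C * (c4 + C) + 16 * C^2 * (cg + 8) := ⟨_, rfl⟩
  obtain ⟨c5, hc5⟩ : ∃ c5, c5 = 64 * C^2 + 2 * C := ⟨_, rfl⟩
  have hc40 : 0 ≤ c4 := by rw [hc4]; positivity
  have hc30 : 0 ≤ c3 := by rw [hc3]; positivity
  have hc50 : 0 ≤ c5 := by rw [hc5]; positivity
  refine ⟨c + 6 + 2 * c3 + c5 + c4, max (max (2 * cg) (4 * (c + 6) + 1)) S1, by linarith, ?_⟩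
  intro μ ℓ k R h hℓ
  have hℓ1 : 2 * cg ≤ ℓ := (le_max_left _ _).trans ((le_max_left _ _).trans hℓ)
  have hℓ2 : 4 * (c + 6) + 1 ≤ ℓ := (le_max_right _ _).trans ((le_max_left _ _).trans hℓ)
  have hℓ3 : S1 ≤ ℓ := (le_max_right _ _).trans hℓ
  have hl := h.ℓ0
  have hl64 := h.hℓ
  obtain ⟨W, f, cW, cf, hSol⟩ := step2 hL h
  have hab : 1/(4*ℓ) ≤ 2/ℓ := by
    rw [div_le_div_iff₀ (by positivity) hl]; linarith
  have hsub : Icc (1/(4*ℓ)) (2/ℓ) ⊆ Icc 0 (2/ℓ) := Icc_subset_Icc (by positivity) le_rfl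
  have gS : ∀ δ ∈ Icc 0 (2/ℓ), |W δ S1 / L S1 - ℓ| ≤ cg := by
    intro δ hδ
    have := (hc μ ℓ k R h δ hδ _ _ (hSol δ hδ)).2
    have e : W δ S1 / L S1 - ℓ = (W δ S1 - ℓ * L S1) / L S1 := by field_simp
    rw [e, abs_div, hcg]
    gcongr
  have m0 : 0 ≤ exp (-S1) * M S1 := mul_nonneg (exp_pos _).le (hL.Mp S1)
  have m1 := hL.eM
  have hk1 := kS1 h S1 hS1
  have small : (c + 6) / ℓ < 1/4 := by
    rw [div_lt_iff₀ hl]; linarith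
  have small' : c / ℓ + 6 / ℓ = (c + 6) / ℓ := by ring
  have jJ : ∀ δ, S1 * (f δ S1 * L S1 - W δ S1 * L1 S1) / L S1^2 = exp S1 / L S1^2 * Jf L L1 (W δ) (f δ) S1 := by
    intro δ
    unfold Jf
    have : exp S1 * exp (-S1) = 1 := by rw [← exp_add]; simp
    calc _ = (exp S1 * exp (-S1)) * (S1 * (f δ S1 * L S1 - W δ S1 * L1 S1) / L S1^2) := by rw [this, one_mul]
      _ = _ := by ring
  have hL2 : 0 < L S1^2 := by positivity
  have big : 4 ≤ exp S1 / L S1^2 := by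
    rw [le_div_iff₀ hL2]; exact hL.eL
  obtain ⟨δ, hδ, hwz⟩ := wazewski (S1 := S1) (F := fun s δ => s * (f δ s * L s - W δ s * L1 s) / L s^2)
    (H := fun s δ => s * (f δ s * L s - W δ s * L1 s) / L s^2 - 2 * δ * (W δ s / L s)) hab
    (fun s hs => by
      have h1 := (cW s (by linarith)).mono hsub
      have h2 := (cf s (by linarith)).mono hsub
      exact (continuousOn_const.mul ((h2.mul continuousOn_const).sub (h1.mul continuousOn_const))).div_const _)
    (fun s hs => by
      have h1 := (cW s (by linarith)).mono hsub
      have h2 := (cf s (by linarith)).mono hsub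
      exact ((continuousOn_const.mul ((h2.mul continuousOn_const).sub (h1.mul continuousOn_const))).div_const _).sub
        ((continuousOn_const.mul continuousOn_id).mul (h1.div_const _)))
    (fun δ hδ s hs s' hs' p1 p2 p3 p4 => by
      have hG := gj hL h hδ.1 (hSol δ (hsub hδ))
      have hδ0 : 0 < δ := lt_of_lt_of_le (by positivity) hδ.1
      have hδ3 : δ ≤ 1/32 := hδ.2.trans (by rw [div_le_div_iff₀ hl (by norm_num)]; linarith)
      exact disj_region hδ0 hδ3 hS1 (fun s hs => (hG s hs).1) (fun s hs => (hG s hs).2.1) (fun s hs => (hG s hs).2.2.1)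
        (fun s hs => (hG s hs).2.2.2.1) (fun s hs => (hG s hs).2.2.2.2) s hs s' hs' p1 p2 p3 p4)
    (by
      have hm : 1/(4*ℓ) ∈ Icc 0 (2/ℓ) := hsub ⟨le_rfl, hab⟩
      have a1 := (hc μ ℓ k R h _ hm _ _ (hSol _ hm)).1
      have a2 := gS _ hm
      have e : 1/(4*ℓ) * ℓ = 1/4 := by field_simp
      rw [e] at a1
      have hJ : 1/2 ≤ Jf L L1 (W (1/(4*ℓ))) (f (1/(4*ℓ))) S1 := by
        rw [abs_le] at *; linarith
      have hj2 : 2 ≤ exp S1 / L S1^2 * Jf L L1 (W (1/(4*ℓ))) (f (1/(4*ℓ))) S1 := by nlinarith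
      have hg2 : 2 * (1/(4*ℓ)) * (W (1/(4*ℓ)) S1 / L S1) ≤ 1 := by
        have : W (1/(4*ℓ)) S1 / L S1 ≤ 2 * ℓ := by rw [abs_le] at a2; linarith
        calc 2 * (1/(4*ℓ)) * (W (1/(4*ℓ)) S1 / L S1) ≤ 2 * (1/(4*ℓ)) * (2 * ℓ) := by gcongr
          _ = 1 := by field_simp; norm_num
      simp only [jJ]
      constructor <;> linarith)
    (by
      have hm : 2/ℓ ∈ Icc 0 (2/ℓ) := hsub ⟨hab, le_rfl⟩
      have a1 := (hc μ ℓ k R h _ hm _ _ (hSol _ hm)).1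
      have a2 := gS _ hm
      have e : 2/ℓ * ℓ = 2 := by field_simp
      rw [e] at a1
      have hJ : Jf L L1 (W (2/ℓ)) (f (2/ℓ)) S1 < 0 := by
        rw [abs_le] at *; linarith
      have hj2 : exp S1 / L S1^2 * Jf L L1 (W (2/ℓ)) (f (2/ℓ)) S1 < 0 := by nlinarith
      have hg2 : 0 ≤ 2 * (2/ℓ) * (W (2/ℓ) S1 / L S1) := by
        have : 0 ≤ W (2/ℓ) S1 / L S1 := by rw [abs_le] at a2; linarith
        positivity
      simp only [jJ]
      constructor <;> linarith)
  have hS := hSol δ (hsub hδ)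
  have hfar := far hL h hδ.1 hδ.2 hS cg hcg0 (by linarith) (gS δ (hsub hδ)) hwz
  obtain ⟨st1, st2⟩ := hc μ ℓ k R h δ (hsub hδ) _ _ hS
  have hδ0 : 0 ≤ δ := (hsub hδ).1
  have fb : ∀ s, S1 ≤ s → |f δ s - ℓ * L1 s| ≤ c4 * s * exp (s/8) := by
    intro s hs
    have hs0 : 0 < s := by linarith
    obtain ⟨q1, q2⟩ := hfar s hs
    have hne := hL.nz s hs
    have b1 := hL.bL s hs0.le
    have b2 := hL.bL1 s hs0.le
    have e : f δ s - ℓ * L1 s = (f δ s * L s - W δ s * L1 s) / L s^2 * L s + (W δ s / L s - ℓ) * L1 s := by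
      field_simp; ring
    rw [e]
    refine (abs_add_le _ _).trans ?_
    rw [abs_mul, abs_mul]
    calc _ ≤ 8 * (C * exp (s/8)) + ((cg + 8) * s) * (C * exp (s/8)) := by gcongr
      _ ≤ 8 * (C * exp (s/8)) * s + ((cg + 8) * s) * (C * exp (s/8)) := by
        have : 8 * (C * exp (s/8)) ≤ 8 * (C * exp (s/8)) * s := le_mul_of_one_le_right (by positivity) (by linarith)
        linarith
      _ = _ := by rw [hc4]; ring
  refine ⟨δ, hsub hδ, W δ, f δ, hS, ?_, by linarith, fun s hs => (fb s hs).trans ?_⟩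
  swap
  · have hs0 : 0 < s := by linarith
    gcongr
    linarith
  have dE : ∀ s, 0 < s → HasDerivAt (fun s => Jf L L1 (W δ) (f δ) s + δ * ℓ * (1 - exp (-s) * M s))
      (R s * exp (-s) * L s * f δ s - δ * exp (-s) * L s * (W δ s - ℓ * L s)) s := by
    intro s hs
    refine ((dJ hL hS s hs).add ((dEM hL s).const_mul (δ * ℓ))).congr_deriv ?_
    ring
  have bE : ∀ s, S1 ≤ s → |R s * exp (-s) * L s * f δ s - δ * exp (-s) * L s * (W δ s - ℓ * L s)| ≤ c3 / ℓ * exp (-(s/2)) := by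
    intro s hs
    have hs0 : 0 < s := by linarith
    have hs1 : 1 ≤ s := by linarith
    obtain ⟨q1, q2⟩ := hfar s hs
    have hne := hL.nz s hs
    have b1 := hL.bL s hs0.le
    have b2 := hL.bL1 s hs0.le
    have h0 := h.μ0
    obtain ⟨x, hx⟩ : ∃ x, x = exp (s/8) := ⟨_, rfl⟩
    have hx1 : 1 ≤ x := by rw [hx]; exact one_le_exp (by positivity)
    have hsx : s ≤ 8 * x := by rw [hx]; exact s_le_exp
    have fbs := fb s hs
    rw [← hx] at b1 b2 fbs
    have hyx : exp (-s) * x^3 ≤ exp (-(s/2)) := by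
      rw [hx, ← exp_nat_mul, ← exp_add, exp_le_exp]; push_cast; linarith
    have e0 := exp_pos (-s)
    have hyx2 : exp (-s) * x^2 ≤ exp (-(s/2)) := by
      refine le_trans ?_ hyx
      gcongr
      norm_num
    have fb2 : |f δ s| ≤ ℓ * s * (c4 + C) * x := by
      have a1 : |ℓ * L1 s| ≤ ℓ * s * C * x := by
        rw [abs_mul, abs_of_pos hl]
        calc ℓ * |L1 s| ≤ ℓ * (C * x) := by gcongr
          _ ≤ ℓ * (C * x) * s := le_mul_of_one_le_right (by positivity) hs1
          _ = _ := by ring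
      have a2 : c4 * s * x ≤ ℓ * (c4 * s * x) := le_mul_of_one_le_left (by positivity) (by linarith)
      have e : f δ s = (f δ s - ℓ * L1 s) + ℓ * L1 s := by ring
      rw [e]
      refine (abs_add_le _ _).trans ?_
      linarith
    have Wb : |W δ s - ℓ * L s| ≤ (cg + 8) * s * (C * x) := by
      have e : W δ s - ℓ * L s = (W δ s / L s - ℓ) * L s := by field_simp
      rw [e, abs_mul]
      gcongr
    have hRs : R s ≤ 3 * (μ / s) := by
      refine (h.R2 s hs0).trans ?_
      gcongr
      linarith
    have hR0 := h.Rpos s hs0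
    have hμl : μ * ℓ ≤ 1 / ℓ := by
      rw [le_div_iff₀ hl]
      have := (μℓ h).1
      nlinarith
    have t1 : |R s * exp (-s) * L s * f δ s| ≤ 3 * C * (c4 + C) / ℓ * exp (-(s/2)) := by
      rw [abs_mul, abs_mul, abs_mul, abs_of_nonneg hR0, abs_of_pos e0]
      calc R s * exp (-s) * |L s| * |f δ s| ≤ (3 * (μ / s)) * exp (-s) * (C * x) * (ℓ * s * (c4 + C) * x) := by gcongr
        _ = 3 * C * (c4 + C) * (μ * ℓ) * (exp (-s) * x^2) := by field_simp
        _ ≤ 3 * C * (c4 + C) * (1/ℓ) * exp (-(s/2)) := by gcongr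
        _ = _ := by ring
    have t2 : |δ * exp (-s) * L s * (W δ s - ℓ * L s)| ≤ 16 * C^2 * (cg + 8) / ℓ * exp (-(s/2)) := by
      rw [abs_mul, abs_mul, abs_mul, abs_of_nonneg hδ0, abs_of_pos e0]
      calc δ * exp (-s) * |L s| * |W δ s - ℓ * L s| ≤ (2/ℓ) * exp (-s) * (C * x) * ((cg + 8) * (8 * x) * (C * x)) := by
            have := hδ.2
            refine mul_le_mul (by gcongr) (Wb.trans (by gcongr)) (abs_nonneg _) (by positivity)
        _ = 16 * C^2 * (cg + 8) / ℓ * (exp (-s) * x^3) := by ring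
        _ ≤ _ := by gcongr
    refine (abs_sub _ _).trans ?_
    have : c3 / ℓ * exp (-(s/2)) = 3 * C * (c4 + C) / ℓ * exp (-(s/2)) + 16 * C^2 * (cg + 8) / ℓ * exp (-(s/2)) := by
      rw [hc3]; ring
    linarith
  have hc3l : 0 ≤ c3 / ℓ := by positivity
  have ex := expcmp hc3l (by linarith) (fun s hs => dE s (by linarith)) bE (2 * ℓ) (by linarith)
  have hs0 : 0 < 2 * ℓ := by linarith
  obtain ⟨q1, q2⟩ := hfar (2 * ℓ) (by linarith)
  have hne := hL.nz (2 * ℓ) (by linarith)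
  have b1 := hL.bL _ hs0.le
  have b3 := hL.bM _ hs0.le
  have e0 := exp_pos (-(2 * ℓ))
  have el : exp (-ℓ) ≤ 1 / ℓ := by
    rw [le_div_iff₀ hl]
    have : exp (-ℓ) * exp ℓ = 1 := by rw [← exp_add]; simp
    have h2 := add_one_le_exp ℓ
    have := exp_pos (-ℓ)
    nlinarith
  obtain ⟨x, hx⟩ : ∃ x, x = exp (2 * ℓ/8) := ⟨_, rfl⟩
  have hx1 : 1 ≤ x := by rw [hx]; exact one_le_exp (by positivity)
  have hsx : 2 * ℓ ≤ 8 * x := by rw [hx]; exact s_le_exp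
  rw [← hx] at b1 b3
  have hyx : exp (-(2 * ℓ)) * x^3 ≤ 1 / ℓ := by
    refine le_trans ?_ el
    rw [hx, ← exp_nat_mul, ← exp_add, exp_le_exp]; push_cast; linarith
  have hyx1 : exp (-(2 * ℓ)) * x ≤ 1 / ℓ := by
    refine le_trans ?_ hyx
    gcongr
    nlinarith [mul_nonneg (by linarith : (0:ℝ) ≤ x) (by nlinarith : 0 ≤ x^2 - 1)]
  have J1 : |Jf L L1 (W δ) (f δ) (2 * ℓ)| ≤ 64 * C^2 / ℓ := by
    have e : Jf L L1 (W δ) (f δ) (2 * ℓ) = (2 * ℓ) * exp (-(2 * ℓ)) * (L (2 * ℓ) * L (2 * ℓ)) *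
        ((f δ (2 * ℓ) * L (2 * ℓ) - W δ (2 * ℓ) * L1 (2 * ℓ)) / L (2 * ℓ)^2) := by
      unfold Jf; field_simp
    rw [e, abs_mul, abs_mul, abs_mul (L (2 * ℓ)), abs_of_pos (show 0 < 2 * ℓ * exp (-(2 * ℓ)) by positivity)]
    calc _ ≤ (8 * x) * exp (-(2 * ℓ)) * ((C * x) * (C * x)) * 8 := by gcongr
      _ = 64 * C^2 * (exp (-(2 * ℓ)) * x^3) := by ring
      _ ≤ 64 * C^2 * (1/ℓ) := by gcongr
      _ = _ := by ring
  have hδl : δ * ℓ ≤ 2 := by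
    have := hδ.2
    rwa [le_div_iff₀ hl] at this
  have M1 : |δ * ℓ * (exp (-(2 * ℓ)) * M (2 * ℓ))| ≤ 2 * C / ℓ := by
    rw [abs_mul, abs_mul (exp _), abs_of_nonneg (by positivity), abs_of_pos e0]
    calc _ ≤ 2 * (exp (-(2 * ℓ)) * (C * x)) := by gcongr
      _ = 2 * C * (exp (-(2 * ℓ)) * x) := by ring
      _ ≤ 2 * C * (1/ℓ) := by gcongr
      _ = _ := by ring
  have fin : |δ * ℓ - 1| ≤ (c + 6 + 2 * c3 + c5 + c4) / ℓ := by
    have e1 : (c + 6 + 2 * c3 + c5 + c4) / ℓ = c/ℓ + 6/ℓ + 2 * (c3/ℓ) + 64 * C^2/ℓ + 2 * C/ℓ + c4/ℓ := by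
      rw [hc5]; ring
    have : 0 ≤ c4/ℓ := by positivity
    rw [e1]
    rw [abs_le] at *
    constructor <;> linarith
  have e : δ - 1/ℓ = (δ * ℓ - 1) / ℓ := by field_simp
  rw [e, abs_div, abs_of_pos hl, pow_two, ← div_div]
  gcongr

lemma k0data {μ ℓ : ℝ} (hμ : μ = exp (-ℓ)) (hℓ : 64 ≤ ℓ) :
    KData μ ℓ (k0 μ) (fun s => 2 * (μ / (s + μ))) := by
  have h0 : 0 < μ := by rw [hμ]; positivity
  have hp : ∀ s : ℝ, 0 < s → 0 < μ / (s + μ) := fun s hs => by positivity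
  refine ⟨hμ, hℓ, ?_, ?_, ?_, ?_, ?_⟩
  · intro s hs
    have hne : (s + μ) ^ 2 ≠ 0 := by positivity
    have h1 : HasDerivAt (fun s : ℝ => s ^ 2 / (s + μ) ^ 2) _ s :=
      ((hasDerivAt_id s).pow 2).div (((hasDerivAt_id s).add_const μ).pow 2) hne
    refine HasDerivAt.congr_deriv (f := k0 μ) h1 ?_
    have : s + μ ≠ 0 := by positivity
    unfold k0
    simp
    field_simp
    ring
  · intro s hs
    have hs : 0 < s := hs
    have : s + μ ≠ 0 := by positivity
    exact ContinuousAt.continuousWithinAt (by fun_prop (disch := assumption))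
  · intro s hs; have := hp s hs; linarith
  · intro s hs; have := hp s hs; linarith
  · intro s hs
    have := k0_pos h0 hs
    have : 0 < ℓ := by linarith
    simp; positivity

/-- the weight -/
noncomputable def wt (μ s : ℝ) : ℝ := s / k0 μ s * exp (-s)

lemma wt_nonneg {μ s : ℝ} (hμ : 0 < μ) (hs : 0 < s) : 0 ≤ wt μ s := by
  have := k0_pos hμ hs
  unfold wt; positivity

lemma wt_cont {μ : ℝ} (hμ : 0 < μ) : ContinuousOn (wt μ) (Ioi 0) := by
  intro s hs
  have hs : 0 < s := hs
  have h1 : s + μ ≠ 0 := by positivity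
  have h2 : k0 μ s ≠ 0 := (k0_pos hμ hs).ne'
  unfold wt
  refine ContinuousAt.continuousWithinAt ?_
  refine (continuousAt_id.div ?_ h2).mul (by fun_prop)
  unfold k0
  exact ContinuousAt.div (by fun_prop) (by fun_prop) (by positivity)

lemma dom {μ ℓ : ℝ} (hμ : μ = exp (-ℓ)) (hℓ : 64 ≤ ℓ) :
    ∃ D : ℝ → ℝ, IntegrableOn D (Ioi 0) ∧ ∫ s in Ioi 0, D s ≤ 40 ∧
      ∀ s, 0 < s → s * exp (-(s/2)) + k0 μ s / s * exp (-s) / ℓ^2 ≤ D s := by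
  have h := k0data hμ hℓ
  have h0 := h.μ0
  have hl := h.ℓ0
  let g : ℝ → ℝ := fun t => k0 μ t / t
  have hg : IntegrableOn g (Ioc 0 1) := by
    have := h.LBk.ii 1 one_pos
    rwa [intervalIntegrable_iff_integrableOn_Ioc_of_le zero_le_one] at this
  have hi : IntegrableOn (fun s : ℝ => exp (-(1/4) * s)) (Ioi 0) := integrableOn_exp_mul_Ioi (by norm_num) 0
  have hv : ∫ s in Ioi (0:ℝ), exp (-(1/4) * s) = 4 := by
    rw [integral_exp_mul_Ioi (by norm_num)]; norm_num
  have hind : IntegrableOn (fun s => (Ioc (0:ℝ) 1).indicator g s) (Ioi 0) :=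
    ((integrable_indicator_iff measurableSet_Ioc).2 hg).integrableOn
  have hgv : ∫ s in Ioi (0:ℝ), (Ioc (0:ℝ) 1).indicator g s ≤ ℓ + 2 := by
    rw [setIntegral_indicator measurableSet_Ioc,
      show Ioi (0:ℝ) ∩ Ioc 0 1 = Ioc 0 1 from inter_eq_right.2 (fun x hx => hx.1),
      ← intervalIntegral.integral_of_le zero_le_one]
    have e := h.H_le 1 one_pos
    have e2 := h.lam_le2 1 one_pos
    have e3 := k0_le_one h0 (one_pos)
    have e4 := k0_pos h0 one_pos
    have e5 := lam_nonneg h0 one_pos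
    unfold HH at e
    refine e.trans ?_
    nlinarith
  refine ⟨fun s => 9 * exp (-(1/4) * s) + 1/ℓ^2 * (Ioc (0:ℝ) 1).indicator g s, ?_, ?_, ?_⟩
  · exact (hi.const_mul 9).add (hind.const_mul _)
  · rw [integral_add (hi.const_mul 9) (hind.const_mul _), integral_const_mul, integral_const_mul, hv]
    have : 1/ℓ^2 * ∫ s in Ioi (0:ℝ), (Ioc (0:ℝ) 1).indicator g s ≤ 1/ℓ^2 * (ℓ + 2) := by gcongr
    have : 1/ℓ^2 * (ℓ + 2) ≤ 1 := by
      rw [div_mul_eq_mul_div, div_le_one (by positivity)]; nlinarith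
    linarith
  · intro s hs
    have a1 : s * exp (-(s/2)) ≤ 8 * exp (-(1/4) * s) := by
      calc s * exp (-(s/2)) ≤ 8 * exp (s/8) * exp (-(s/2)) := by gcongr; exact s_le_exp
        _ = 8 * exp (s/8 + -(s/2)) := by rw [mul_assoc, ← exp_add]
        _ ≤ _ := by gcongr; linarith
    have hk := k0_pos h0 hs
    beta_reduce
    by_cases h1 : s ≤ 1
    · rw [indicator_of_mem (show s ∈ Ioc 0 1 from ⟨hs, h1⟩)]
      have : exp (-s) ≤ 1 := exp_le_one_iff.2 (by linarith)
      have : k0 μ s / s * exp (-s) / ℓ^2 ≤ 1/ℓ^2 * g s := by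
        calc k0 μ s / s * exp (-s) / ℓ^2 ≤ k0 μ s / s * 1 / ℓ^2 := by gcongr
          _ = _ := by simp only [g]; ring
      have := exp_pos (-(1/4) * s)
      linarith
    · push Not at h1
      rw [indicator_of_notMem (show s ∉ Ioc 0 1 from fun h => by linarith [h.2])]
      have := k0_le_one h0 hs
      have : k0 μ s / s * exp (-s) / ℓ^2 ≤ exp (-(1/4) * s) := by
        calc k0 μ s / s * exp (-s) / ℓ^2 ≤ 1 / 1 * exp (-(1/4) * s) / 1 := by
              gcongr
              · linarith
              · nlinarith
          _ = _ := by ring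
      linarith

lemma wtint {μ ℓ : ℝ} (hμ : μ = exp (-ℓ)) (hℓ : 64 ≤ ℓ) {g : ℝ → ℝ} (hg : ContinuousOn g (Ioi 0)) {c : ℝ} (hc : 0 ≤ c)
    (hb : ∀ s, 0 < s → |g s| ≤ c * k0 μ s * (exp (s/4) + 1 / (s * ℓ))) :
    IntegrableOn (fun s => g s ^ 2 * wt μ s) (Ioi 0) ∧ ∫ s in Ioi 0, g s ^ 2 * wt μ s ≤ 80 * c^2 := by
  have h := k0data hμ hℓ
  have h0 := h.μ0
  have hl := h.ℓ0
  obtain ⟨D, D1, D2, D3⟩ := dom hμ hℓ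
  have key : ∀ s, 0 < s → g s ^ 2 * wt μ s ≤ 2 * c^2 * D s := by
    intro s hs
    have hk := k0_pos h0 hs
    have hk1 := k0_le_one h0 hs
    have e1 : g s ^ 2 ≤ (c * k0 μ s * (exp (s/4) + 1 / (s * ℓ)))^2 := by
      rw [← sq_abs]; gcongr; exact hb s hs
    have e2 : (exp (s/4) + 1 / (s * ℓ))^2 ≤ 2 * (exp (s/2) + 1 / (s * ℓ)^2) := by
      have : exp (s/2) = exp (s/4) ^ 2 := by rw [← exp_nat_mul]; congr 1; push_cast; ring
      rw [this]
      have : 1 / (s * ℓ)^2 = (1 / (s * ℓ))^2 := by ring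
      rw [this]
      nlinarith [sq_nonneg (exp (s/4) - 1 / (s * ℓ))]
    have e3 : exp (s/2) * exp (-s) = exp (-(s/2)) := by rw [← exp_add]; congr 1; ring
    calc g s ^ 2 * wt μ s ≤ (c * k0 μ s * (exp (s/4) + 1 / (s * ℓ)))^2 * wt μ s :=
          mul_le_mul_of_nonneg_right e1 (wt_nonneg h0 hs)
      _ = c^2 * (s * k0 μ s * exp (-s)) * (exp (s/4) + 1 / (s * ℓ))^2 := by unfold wt; field_simp
      _ ≤ c^2 * (s * k0 μ s * exp (-s)) * (2 * (exp (s/2) + 1 / (s * ℓ)^2)) := by gcongr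
      _ = 2 * c^2 * (s * (exp (s/2) * exp (-s)) * k0 μ s + k0 μ s / s * exp (-s) / ℓ^2) := by field_simp
      _ ≤ 2 * c^2 * (s * (exp (s/2) * exp (-s)) * 1 + k0 μ s / s * exp (-s) / ℓ^2) := by gcongr
      _ = 2 * c^2 * (s * exp (-(s/2)) + k0 μ s / s * exp (-s) / ℓ^2) := by rw [e3, mul_one]
      _ ≤ _ := by gcongr; exact D3 s hs
  have I1 : IntegrableOn (fun s => g s ^ 2 * wt μ s) (Ioi 0) := by
    refine Integrable.mono' (D1.const_mul (2 * c^2)) (((hg.pow 2).mul (wt_cont h0)).aestronglyMeasurable measurableSet_Ioi) ?_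
    filter_upwards [ae_restrict_mem measurableSet_Ioi] with s hs
    rw [norm_of_nonneg (mul_nonneg (sq_nonneg _) (wt_nonneg h0 hs))]
    exact key s hs
  refine ⟨I1, ?_⟩
  calc _ ≤ ∫ s in Ioi 0, 2 * c^2 * D s := setIntegral_mono_on I1 (D1.const_mul _) measurableSet_Ioi (fun s hs => key s hs)
    _ = 2 * c^2 * ∫ s in Ioi 0, D s := integral_const_mul _ _
    _ ≤ 2 * c^2 * 40 := by gcongr
    _ = _ := by ring

noncomputable def fref (L L1 : ℝ → ℝ) (μ s : ℝ) : ℝ := k0 μ s / s * L s + H0 μ s * L1 s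

lemma H0k {μ ℓ : ℝ} {k R : ℝ → ℝ} (h : KData μ ℓ k R) (s : ℝ) (hs : 0 < s) : H0 μ s ≤ 4 * k0 μ s * (1 + ℓ + s) := by
  have a := h.HH0 s hs
  have h4 : 4/ℓ ≤ 1/2 := by rw [div_le_iff₀ h.ℓ0]; linarith [h.hℓ]
  have := h.H0_nonneg s hs
  have b := h.H_le s hs
  have c := h.kup s hs
  have d := h.lam_le2 s hs
  have e := lam_nonneg h.μ0 hs
  have hk := k0_pos h.μ0 hs
  have e1 : HH k s ≤ (2 * k0 μ s) * (1 + (ℓ + s)) := b.trans (by gcongr)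
  have e2 : 4/ℓ * H0 μ s ≤ 1/2 * H0 μ s := by gcongr
  have := (abs_le.1 a).1
  nlinarith

lemma frefbd {n : ℕ} {L L1 M : ℝ → ℝ} {C S1 : ℝ} (hL : LData n L L1 M C S1) {μ ℓ : ℝ} {k R : ℝ → ℝ} (h : KData μ ℓ k R) :
    ∃ c, 0 ≤ c ∧ ∀ s, 0 < s → |fref L L1 μ s| ≤ c * k0 μ s * (exp (s/4) + 1 / (s * ℓ)) := by
  have h0 := h.μ0
  have hl := h.ℓ0
  have hC : 1 ≤ C := hL.C1
  refine ⟨C * ℓ + C * (1 + 4 * (9 + ℓ)), by positivity, fun s hs => ?_⟩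
  have hk := k0_pos h0 hs
  have hH := h.H0_nonneg s hs
  have hHk := H0k h s hs
  obtain ⟨x, hx⟩ : ∃ x, x = exp (s/8) := ⟨_, rfl⟩
  have hx1 : 1 ≤ x := by rw [hx]; exact one_le_exp (by positivity)
  have hsx : s ≤ 8 * x := by rw [hx]; exact s_le_exp
  have b1 := hL.bL s hs.le
  have b2 := hL.bL1 s hs.le
  rw [← hx] at b1 b2
  have hx2 : exp (s/4) = x^2 := by rw [hx, ← exp_nat_mul]; congr 1; push_cast; ring
  have hxs : x / s ≤ 1 / s + x := by
    rw [div_add' _ _ _ hs.ne', div_le_div_iff_of_pos_right hs]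
    have : (1 - s/8) * x ≤ 1 := by
      have := one_sub_le_exp_neg (s/8)
      have e : exp (-(s/8)) * x = 1 := by rw [hx, ← exp_add]; simp
      nlinarith
    nlinarith
  rw [hx2]
  have e1 : |k0 μ s / s * L s| ≤ k0 μ s * C * (1 / s + x^2) := by
    rw [abs_mul, abs_of_pos (by positivity)]
    calc k0 μ s / s * |L s| ≤ k0 μ s / s * (C * x) := by gcongr
      _ = k0 μ s * C * (x / s) := by ring
      _ ≤ k0 μ s * C * (1 / s + x^2) := by
        gcongr
        exact hxs.trans (by nlinarith)
  have e2 : |H0 μ s * L1 s| ≤ k0 μ s * C * (4 * (9 + ℓ)) * x^2 := by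
    rw [abs_mul, abs_of_nonneg hH]
    calc H0 μ s * |L1 s| ≤ (4 * k0 μ s * (1 + ℓ + s)) * (C * x) := by gcongr
      _ ≤ (4 * k0 μ s * ((9 + ℓ) * x)) * (C * x) := by gcongr; nlinarith
      _ = _ := by ring
  have e3 : 1 / s = ℓ * (1 / (s * ℓ)) := by field_simp
  unfold fref
  refine (abs_add_le _ _).trans ((add_le_add e1 e2).trans ?_)
  rw [e3]
  have p1 : 0 ≤ 1 / (s * ℓ) := by positivity
  have p2 : 0 ≤ C * (1 + 4 * (9 + ℓ)) * k0 μ s * (1 / (s * ℓ)) := by positivity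
  have p3 : 0 ≤ C * ℓ * k0 μ s * x^2 := by positivity
  nlinarith

lemma fdiff {n : ℕ} {L L1 M : ℝ → ℝ} {C S1 : ℝ} (hL : LData n L L1 M C S1) (K Λ c : ℝ) (hK : 0 ≤ K) (hΛ : 0 ≤ Λ) (hc : 0 ≤ c) :
    ∃ c', 0 ≤ c' ∧ ∀ (μ ℓ δ : ℝ) (k R W f : ℝ → ℝ), KData μ ℓ k R → Sol n L L1 K Λ δ k R W f →
      (∀ s, S1 ≤ s → |f s - ℓ * L1 s| ≤ c * s * exp (s/8)) →
      ∀ s, 0 < s → |f s - fref L L1 μ s| ≤ c' * k0 μ s * (exp (s/4) + 1 / (s * ℓ)) := by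
  have hC : 1 ≤ C := hL.C1
  have hS : 1 ≤ S1 := hL.S11
  obtain ⟨E, hE⟩ : ∃ E, E = exp (S1/8) := ⟨_, rfl⟩
  have hE0 : 0 < E := by rw [hE]; positivity
  obtain ⟨a1, ha1⟩ : ∃ a1, a1 = 2 * K * exp (Λ * S1) + 4 * C * E + 16 * (2 + S1) * C * E := ⟨_, rfl⟩
  obtain ⟨a2, ha2⟩ : ∃ a2, a2 = 4 * (8 * c + 13 * C) := ⟨_, rfl⟩
  have ha10 : 0 ≤ a1 := by rw [ha1]; positivity
  have ha20 : 0 ≤ a2 := by rw [ha2]; positivity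
  refine ⟨a1 + a2, by positivity, fun μ ℓ δ k R W f h S hf s hs => ?_⟩
  have h0 := h.μ0
  have hl := h.ℓ0
  have hk := k0_pos h0 hs
  have hH := h.H0_nonneg s hs
  obtain ⟨x, hx⟩ : ∃ x, x = exp (s/8) := ⟨_, rfl⟩
  have hx1 : 1 ≤ x := by rw [hx]; exact one_le_exp (by positivity)
  have hsx : s ≤ 8 * x := by rw [hx]; exact s_le_exp
  have b1 := hL.bL s hs.le
  have b2 := hL.bL1 s hs.le
  have hx2 : exp (s/4) = x^2 := by rw [hx, ← exp_nat_mul]; congr 1; push_cast; ring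
  have p1 : 0 < 1 / (s * ℓ) := by positivity
  rw [hx2]
  by_cases hsS : s ≤ S1
  · have hxE : x ≤ E := by rw [hx, hE, exp_le_exp]; linarith
    rw [← hx] at b1 b2
    have b1' : |L s| ≤ C * E := b1.trans (by gcongr)
    have b2' : |L1 s| ≤ C * E := b2.trans (by gcongr)
    have d1 : |f s - (k s / s * L s + HH k s * L1 s)| ≤ k0 μ s * (2 * K * exp (Λ * S1)) := by
      refine (S.bf s hs).trans ?_
      calc K * k s * exp (Λ * s) ≤ K * (2 * k0 μ s) * exp (Λ * S1) := by
            have := h.kup s hs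
            have := (h.kpos s hs).le
            gcongr
        _ = _ := by ring
    have d2 : |(k s - k0 μ s) / s * L s| ≤ k0 μ s * (4 * C * E) * (1 / (s * ℓ)) := by
      rw [abs_mul, abs_div, abs_of_pos hs]
      calc |k s - k0 μ s| / s * |L s| ≤ (4/ℓ * k0 μ s) / s * (C * E) := by
            have := h.kk s hs
            gcongr
        _ = _ := by field_simp
    have d3 : |(HH k s - H0 μ s) * L1 s| ≤ k0 μ s * (16 * (2 + S1) * C * E) := by
      rw [abs_mul]
      have q1 : |HH k s - H0 μ s| ≤ 16 * k0 μ s * (2 + S1) := by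
        calc _ ≤ 4/ℓ * H0 μ s := h.HH0 s hs
          _ ≤ 4/ℓ * (4 * k0 μ s * (1 + ℓ + s)) := by have := H0k h s hs; gcongr
          _ ≤ 4/ℓ * (4 * k0 μ s * (ℓ * (2 + S1))) := by
            gcongr
            have := h.hℓ
            nlinarith
          _ = _ := by field_simp; norm_num
      calc _ ≤ (16 * k0 μ s * (2 + S1)) * (C * E) := by gcongr
        _ = _ := by ring
    have e : f s - fref L L1 μ s = (f s - (k s / s * L s + HH k s * L1 s)) + (k s - k0 μ s) / s * L s + (HH k s - H0 μ s) * L1 s := by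
      unfold fref; ring
    rw [e]
    refine (abs_add_three _ _ _).trans ((add_le_add (add_le_add d1 d2) d3).trans ?_)
    have hx3 : 1 ≤ x^2 := one_le_pow₀ hx1
    calc _ ≤ k0 μ s * (2 * K * exp (Λ * S1)) * (x^2 + 1/(s*ℓ)) + k0 μ s * (4 * C * E) * (x^2 + 1 / (s * ℓ)) + k0 μ s * (16 * (2 + S1) * C * E) * (x^2 + 1 / (s*ℓ)) := by
          refine add_le_add (add_le_add ?_ ?_) ?_
          · exact le_mul_of_one_le_right (by positivity) (by linarith)
          · exact mul_le_mul_of_nonneg_left (by linarith) (by positivity)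
          · exact le_mul_of_one_le_right (by positivity) (by linarith)
      _ = a1 * k0 μ s * (x^2 + 1/(s*ℓ)) := by rw [ha1]; ring
      _ ≤ _ := by gcongr; linarith
  · push Not at hsS
    have hs1 : 1 ≤ s := by linarith
    have d1 := hf s hsS.le
    rw [← hx] at b1 b2 d1
    have hk4 : 1/4 ≤ k0 μ s := by
      have := h.μ1
      unfold k0
      rw [le_div_iff₀ (by positivity)]
      nlinarith
    have d2 : |(ℓ - H0 μ s) * L1 s| ≤ 12 * C * x^2 := by
      rw [abs_mul]
      have q := h.Hell s hs
      rw [abs_sub_comm] at q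
      have q2 : 2 / sqrt s ≤ 2 := by
        rw [div_le_iff₀ (by positivity)]
        have := Real.one_le_sqrt.2 hs1
        linarith
      calc _ ≤ (12 * x) * (C * x) := by gcongr; linarith
        _ = _ := by ring
    have d3 : |k0 μ s / s * L s| ≤ C * x^2 := by
      rw [abs_mul, abs_of_pos (by positivity)]
      have := k0_le_one h0 hs
      calc _ ≤ 1 / 1 * (C * x) := by gcongr
        _ ≤ C * x^2 := by rw [div_one, one_mul, sq]; exact mul_le_mul_of_nonneg_left (by nlinarith) (by linarith)
    have e : f s - fref L L1 μ s = (f s - ℓ * L1 s) + (ℓ - H0 μ s) * L1 s + -(k0 μ s / s * L s) := by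
      unfold fref; ring
    rw [e]
    refine (abs_add_three _ _ _).trans ?_
    rw [abs_neg]
    have d1' : c * s * x ≤ 8 * c * x^2 := by
      calc c * s * x ≤ c * (8 * x) * x := by gcongr
        _ = _ := by ring
    calc _ ≤ (8 * c + 13 * C) * x^2 := by linarith
      _ = a2 * (1/4) * x^2 := by rw [ha2]; ring
      _ ≤ (a1 + a2) * k0 μ s * (x^2 + 1 / (s * ℓ)) := by
        gcongr
        · linarith
        · linarith

lemma Wlim {n : ℕ} {L L1 M : ℝ → ℝ} {C S1 : ℝ} (hL : LData n L L1 M C S1) {K Λ δ μ ℓ : ℝ} {k R W f : ℝ → ℝ} (h : KData μ ℓ k R)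
    (hK : 0 ≤ K) (hΛ : 0 ≤ Λ) (S : Sol n L L1 K Λ δ k R W f) : Filter.Tendsto W (nhdsWithin 0 (Ioi 0)) (nhds 0) := by
  have h0 := h.μ0
  have t1 : Filter.Tendsto (fun s => HH k s * L s) (nhdsWithin 0 (Ioi 0)) (nhds 0) := by
    have := h.H_lim.mul ((hL.dL 0).continuousAt.tendsto.mono_left nhdsWithin_le_nhds)
    simpa using this
  have t2 : Filter.Tendsto (fun s => W s - HH k s * L s) (nhdsWithin 0 (Ioi 0)) (nhds 0) := by
    refine tend0_of_bound (K * (2/μ^2) * exp Λ) (fun s hs hs1 => (S.bW s hs).trans ?_)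
    have := h.ksq s hs
    have := h.kpos s hs
    calc K * k s * exp (Λ * s) ≤ K * (2/μ^2 * s^2) * exp Λ := by
          gcongr
          nlinarith
      _ ≤ K * (2/μ^2 * s) * exp Λ := by gcongr; nlinarith
      _ = _ := by ring
  have := t1.add t2
  simpa using this

lemma lower {n : ℕ} {L L1 M : ℝ → ℝ} {C S1 : ℝ} (hL : LData n L L1 M C S1) (K Λ c : ℝ) (hK : 0 ≤ K) (hΛ : 0 ≤ Λ) :
    ∃ c' ℓ0, 1 ≤ c' ∧ ∀ (μ ℓ δ : ℝ) (k R W f : ℝ → ℝ) (a : ℝ), KData μ ℓ k R → ℓ0 ≤ ℓ → Sol n L L1 K Λ δ k R W f →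
      |W S1 - ℓ * L S1| ≤ c → 0 ≤ a →
      (∀ s, 0 < s → |f s| ≤ a * k0 μ s * (exp (s/4) + 1 / (s * ℓ))) →
      ℓ ≤ c' * ∫ s in Ioi 0, f s ^ 2 * wt μ s := by
  have hS : 1 ≤ S1 := hL.S11
  obtain ⟨m, hm⟩ : ∃ m, m = |L S1| := ⟨_, rfl⟩
  have hm0 : 0 < m := by rw [hm]; exact abs_pos.2 (hL.nz S1 le_rfl)
  refine ⟨8 * exp S1 / m^2 + 1, max S1 (2 * c / m), by have : 0 < 8 * exp S1 / m^2 := by positivity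
                                                       linarith, ?_⟩
  intro μ ℓ δ k R W f a h hℓ S hW ha hf
  have h0 := h.μ0
  have hl := h.ℓ0
  have hℓ1 : S1 ≤ ℓ := (le_max_left _ _).trans hℓ
  have hℓ2 : 2 * c / m ≤ ℓ := (le_max_right _ _).trans hℓ
  rw [div_le_iff₀ hm0] at hℓ2
  have fc : ContinuousOn f (Ioi 0) := fun s hs => (S.df s hs).continuousAt.continuousWithinAt
  obtain ⟨I1, -⟩ := wtint h.hμ h.hℓ fc ha hf
  have S0 : 0 < S1 := by linarith
  let F : ℝ → ℝ := fun s => f s ^ 2 * (wt μ s * exp s)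
  have hF : LB F := by
    refine ⟨(fc.pow 2).mul ((wt_cont h0).mul continuous_exp.continuousOn), fun s hs => ⟨a^2 * (1/μ^2) * s * (s * exp (s/4) + 1/ℓ)^2, fun t ht => ?_⟩⟩
    have hk := k0_pos h0 ht.1
    have h2 : F t = f t ^ 2 * (t / k0 μ t) := by
      simp only [F, wt]; rw [mul_assoc, ← exp_add]; simp
    have hp : 0 ≤ F t := by rw [h2]; have := ht.1; positivity
    have t0 := ht.1
    have e1 : f t ^ 2 ≤ (a * k0 μ t * (exp (t/4) + 1 / (t * ℓ)))^2 := by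
      rw [← sq_abs]; gcongr; exact hf t ht.1
    rw [abs_of_nonneg hp, h2]
    have k2 : k0 μ t ≤ 1/μ^2 * t^2 := by
      unfold k0
      rw [div_mul_eq_mul_div, one_mul]
      gcongr
      linarith
    have e2 : (exp (t/4) + 1 / (t * ℓ)) * t ≤ s * exp (s/4) + 1/ℓ := by
      have : (exp (t/4) + 1 / (t * ℓ)) * t = t * exp (t/4) + 1/ℓ := by field_simp
      rw [this]
      gcongr
      · exact ht.2
      · exact ht.2
    calc f t ^ 2 * (t / k0 μ t) ≤ (a * k0 μ t * (exp (t/4) + 1 / (t * ℓ)))^2 * (t / k0 μ t) := by gcongr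
      _ = a^2 * k0 μ t * ((exp (t/4) + 1 / (t * ℓ)) * t)^2 / t := by field_simp
      _ ≤ a^2 * (1/μ^2 * t^2) * (s * exp (s/4) + 1/ℓ)^2 / t := by gcongr
      _ = a^2 * (1/μ^2) * t * (s * exp (s/4) + 1/ℓ)^2 := by field_simp
      _ ≤ _ := by gcongr; exact ht.2
  have hb : ∀ s, 0 < s → HasDerivAt (fun s => 2/m * (∫ t in (0:ℝ)..s, F t) + m/8 * H0 μ s) (2/m * F s + m/8 * (k0 μ s / s)) s :=
    fun s hs => ((hF.deriv s hs).const_mul _).add ((dH0 h0 s hs).const_mul _)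
  have lb : Filter.Tendsto (fun s => 2/m * (∫ t in (0:ℝ)..s, F t) + m/8 * H0 μ s) (nhdsWithin 0 (Ioi 0)) (nhds 0) := by
    have := (hF.lim.const_mul (2/m)).add (h.H0_lim.const_mul (m/8))
    simpa using this
  have hle : ∀ s, 0 < s → |f s| ≤ 2/m * F s + m/8 * (k0 μ s / s) := by
    intro t ht
    have hk := k0_pos h0 ht
    have h2 : F t = f t ^ 2 * (t / k0 μ t) := by
      simp only [F, wt]; rw [mul_assoc, ← exp_add]; simp
    obtain ⟨y, hy⟩ : ∃ y, y = k0 μ t / t := ⟨_, rfl⟩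
    have hy0 : 0 < y := by rw [hy]; positivity
    have h3 : t / k0 μ t = 1 / y := by rw [hy]; field_simp
    rw [h2, h3, ← hy, ← sq_abs (f t)]
    have : 2/m * (|f t|^2 * (1/y)) + m/8*y - |f t| = 2 / (m*y) * (|f t| - m*y/4)^2 := by field_simp; ring
    have : 0 ≤ 2 / (m*y) * (|f t| - m*y/4)^2 := by positivity
    linarith
  have lW := Wlim hL h hK hΛ S
  have c1 := cmp0 S.dW hb lW lb S1 S0 (fun t ht => (le_abs_self _).trans (hle t ht.1))
  have c2 := cmp0 (a := fun s => -W s) (fun s hs => (S.dW s hs).neg) hb (by simpa using lW.neg) lb S1 S0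
    (fun t ht => (neg_le_abs _).trans (hle t ht.1))
  have c3 : |W S1| ≤ 2/m * (∫ t in (0:ℝ)..S1, F t) + m/8 * H0 μ S1 := abs_le.2 ⟨by linarith, c1⟩
  have c4 : ∫ t in (0:ℝ)..S1, F t ≤ exp S1 * ∫ s in Ioi 0, f s ^ 2 * wt μ s := by
    have ii := hF.ii S1 S0
    rw [intervalIntegrable_iff_integrableOn_Ioc_of_le S0.le] at ii
    rw [intervalIntegral.integral_of_le S0.le, ← integral_const_mul]
    refine (setIntegral_mono_on ii ((I1.mono_set (fun x hx => hx.1)).const_mul (exp S1)) measurableSet_Ioc ?_).trans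
      (setIntegral_mono_set (I1.const_mul (exp S1)) ?_ (Filter.Eventually.of_forall (fun x hx => hx.1)))
    · intro t ht
      have := wt_nonneg h0 ht.1
      have e : exp t ≤ exp S1 := exp_le_exp.2 ht.2
      calc F t = exp t * (f t ^ 2 * wt μ t) := by simp only [F]; ring
        _ ≤ _ := by gcongr
    · filter_upwards [ae_restrict_mem measurableSet_Ioi] with t ht
      have := wt_nonneg h0 ht
      simp only [Pi.zero_apply]
      positivity
  have c5 : H0 μ S1 ≤ 2 * ℓ := by
    have := h.H0_le S1 S0
    have := h.lam_le2 S1 S0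
    linarith
  have c6 : ℓ * m - c ≤ |W S1| := by
    have e : ℓ * L S1 = W S1 - (W S1 - ℓ * L S1) := by ring
    have := abs_sub (W S1) (W S1 - ℓ * L S1)
    rw [← e, abs_mul, abs_of_pos hl, ← hm] at this
    linarith
  obtain ⟨I, hI⟩ : ∃ I, I = ∫ s in Ioi 0, f s ^ 2 * wt μ s := ⟨_, rfl⟩
  have hI0 : 0 ≤ I := by
    rw [hI]
    exact setIntegral_nonneg measurableSet_Ioi (fun t ht => mul_nonneg (sq_nonneg _) (wt_nonneg h0 ht))
  rw [← hI] at c4 ⊢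
  have c7 : 2/m * (∫ t in (0:ℝ)..S1, F t) ≤ 2/m * (exp S1 * I) := by gcongr
  have c8 : m/8 * H0 μ S1 ≤ m/8 * (2*ℓ) := by gcongr
  have c9 : ℓ * m / 4 ≤ 2/m * (exp S1 * I) := by nlinarith
  have c10 : ℓ ≤ 8 * exp S1 / m^2 * I := by
    have : (4/m) * (ℓ * m / 4) ≤ (4/m) * (2/m * (exp S1 * I)) := by gcongr
    have e1 : (4/m) * (ℓ * m / 4) = ℓ := by field_simp
    have e2 : (4/m) * (2/m * (exp S1 * I)) = 8 * exp S1 / m^2 * I := by field_simp; ring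
    linarith
  linarith

/-- the equations for an eigenfunction in the variable s -/
structure Eqs (n : ℕ) (δ : ℝ) (R W f : ℝ → ℝ) : Prop where
  dW : ∀ s, 0 < s → HasDerivAt W (f s) s
  df : ∀ s, 0 < s → HasDerivAt f ((-((n:ℝ)+δ) * W s - (1 - R s - s) * f s) / s) s

theorem pair (n : ℕ) : ∃ C ℓ0 : ℝ, 1 ≤ C ∧ ∀ (μ ℓ : ℝ) (k R k' R' : ℝ → ℝ), KData μ ℓ k R → KData μ ℓ k' R' → ℓ0 ≤ ℓ →
    ∃ (δ δ' : ℝ) (W f W' f' : ℝ → ℝ), |δ - 1/ℓ| ≤ C/ℓ^2 ∧ |δ' - 1/ℓ| ≤ C/ℓ^2 ∧ Eqs n δ R W f ∧ Eqs n δ' R' W' f' ∧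
      IntegrableOn (fun s => f s ^ 2 * wt μ s) (Ioi 0) ∧ IntegrableOn (fun s => f' s ^ 2 * wt μ s) (Ioi 0) ∧
      ℓ ≤ C * ∫ s in Ioi 0, f s ^ 2 * wt μ s ∧ ℓ ≤ C * ∫ s in Ioi 0, f' s ^ 2 * wt μ s ∧
      ∫ s in Ioi 0, (f' s - f s) ^ 2 * wt μ s ≤ C := by
  obtain ⟨L, L1, M, C, S1, hL⟩ := ldata_exists n
  obtain ⟨c, ℓ1, hc, H⟩ := step45 hL
  have hC := hL.C1
  obtain ⟨a, ha, H2⟩ := fdiff hL (52 * C) (2*((n:ℝ)+1)) c (by positivity) (by positivity) (by positivity)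
  obtain ⟨b, ℓ2, hb, H3⟩ := lower hL (52 * C) (2*((n:ℝ)+1)) c (by positivity) (by positivity)
  have one : ∀ (μ ℓ : ℝ) (k R : ℝ → ℝ), KData μ ℓ k R → max ℓ1 ℓ2 ≤ ℓ → ∃ (δ : ℝ) (W f : ℝ → ℝ),
      |δ - 1/ℓ| ≤ c/ℓ^2 ∧ Eqs n δ R W f ∧ IntegrableOn (fun s => f s ^ 2 * wt μ s) (Ioi 0) ∧
      ℓ ≤ b * (∫ s in Ioi 0, f s ^ 2 * wt μ s) ∧ ∀ s, 0 < s → |f s - fref L L1 μ s| ≤ a * k0 μ s * (exp (s/4) + 1 / (s * ℓ)) := by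
    intro μ ℓ k R h hℓ
    obtain ⟨δ, hδ, W, f, S, r1, r2, r3⟩ := H μ ℓ k R h ((le_max_left _ _).trans hℓ)
    have q := H2 μ ℓ δ k R W f h S r3
    obtain ⟨d, hd, hr⟩ := frefbd hL h
    have fb : ∀ s, 0 < s → |f s| ≤ (a + d) * k0 μ s * (exp (s/4) + 1 / (s * ℓ)) := by
      intro s hs
      have e : f s = (f s - fref L L1 μ s) + fref L L1 μ s := by ring
      rw [e]
      refine (abs_add_le _ _).trans ((add_le_add (q s hs) (hr s hs)).trans (le_of_eq (by ring)))
    have fc : ContinuousOn f (Ioi 0) := fun s hs => (S.df s hs).continuousAt.continuousWithinAt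
    exact ⟨δ, W, f, r1, ⟨S.dW, S.df⟩, (wtint h.hμ h.hℓ fc (by positivity) fb).1,
      H3 μ ℓ δ k R W f (a+d) h ((le_max_right _ _).trans hℓ) S r2 (by positivity) fb, q⟩
  refine ⟨c + b + 80 * (2*a)^2, max ℓ1 ℓ2, by nlinarith [sq_nonneg (2*a)], ?_⟩
  intro μ ℓ k R k' R' h h' hℓ
  obtain ⟨δ, W, f, r1, r2, r3, r4, r5⟩ := one μ ℓ k R h hℓ
  obtain ⟨δ', W', f', r1', r2', r3', r4', r5'⟩ := one μ ℓ k' R' h' hℓ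
  have hl := h.ℓ0
  have mon : c / ℓ^2 ≤ (c + b + 80 * (2*a)^2) / ℓ^2 := by
    gcongr
    nlinarith [sq_nonneg (2*a)]
  have pos : ∀ g : ℝ → ℝ, 0 ≤ ∫ s in Ioi 0, g s ^ 2 * wt μ s := fun g =>
    setIntegral_nonneg measurableSet_Ioi (fun t ht => mul_nonneg (sq_nonneg _) (wt_nonneg h.μ0 ht))
  have mon2 : ∀ I : ℝ, 0 ≤ I → b * I ≤ (c + b + 80 * (2*a)^2) * I := fun I hI =>
    mul_le_mul_of_nonneg_right (by nlinarith [sq_nonneg (2*a)]) hI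
  refine ⟨δ, δ', W, f, W', f', r1.trans mon, r1'.trans mon, r2, r2', r3, r3', r4.trans (mon2 _ (pos f)), r4'.trans (mon2 _ (pos f')), ?_⟩
  have fc : ContinuousOn f (Ioi 0) := fun s hs => (r2.df s hs).continuousAt.continuousWithinAt
  have fc' : ContinuousOn f' (Ioi 0) := fun s hs => (r2'.df s hs).continuousAt.continuousWithinAt
  refine (wtint h.hμ h.hℓ (g := fun s => f' s - f s) (c := 2 * a) (fc'.sub fc) (by positivity) ?_).2.trans (by linarith)
  intro s hs
  have e : f' s - f s = (f' s - fref L L1 μ s) - (f s - fref L L1 μ s) := by ring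
  rw [e]
  exact (abs_sub _ _).trans ((add_le_add (r5' s hs) (r5 s hs)).trans (le_of_eq (by ring)))

lemma kdataP {β ν μ ℓ Λ : ℝ} {P : ℝ → ℝ} (hβ : 0 < β) (hν : 0 < ν) (hΛ : Λ = |log ν|) (hμ : μ = β * ν^2/2) (hμℓ : μ = exp (-ℓ))
    (hℓ : 64 ≤ ℓ) (hΛ1 : 1 ≤ Λ) (hℓ4 : ℓ ≤ 4 * Λ) (Pc : ContinuousOn P (Ioi 0))
    (hP : ∀ ζ : ℝ, 0 < ζ → |P ζ| ≤ ν ^ 2 / |log ν| * ζ ^ 2 / (ν ^ 2 + ζ ^ 2) ^ 2) :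
    ∃ k, KData μ ℓ k (fun s => 2 * (μ / (s + μ)) - P (sqrt (2*s/β)) / 2) := by
  have h := k0data hμℓ hℓ
  have h0 := h.μ0
  have hl := h.ℓ0
  obtain ⟨p, hp⟩ : ∃ p : ℝ → ℝ, p = fun s => P (sqrt (2*s/β)) / 2 := ⟨_, rfl⟩
  have pc : ContinuousOn p (Ioi 0) := by
    rw [hp]
    refine ContinuousOn.div_const (Pc.comp (by fun_prop) ?_) 2
    intro s hs
    have hs : 0 < s := hs
    show 0 < sqrt (2*s/β)
    positivity
  have pb : ∀ s, 0 < s → |p s| ≤ 1/(2*Λ) * (μ * s / (s + μ)^2) := by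
    intro s hs
    have := hP (sqrt (2*s/β)) (by positivity)
    rw [sq_sqrt (by positivity), ← hΛ] at this
    rw [hp]
    simp only [abs_div, abs_two]
    have e : ν^2/Λ * (2*s/β) / (ν^2 + 2*s/β)^2 = 2 * (1/(2*Λ) * (μ * s / (s + μ)^2)) := by
      rw [hμ]; field_simp; ring
    rw [e] at this
    linarith
  have pb2 : ∀ s, 0 < s → |p s| ≤ 1/2 * (μ/(s+μ)) := by
    intro s hs
    refine (pb s hs).trans ?_
    have : μ * s / (s + μ)^2 ≤ μ / (s + μ) := by
      rw [div_le_div_iff₀ (by positivity) (by positivity)]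
      nlinarith [mul_pos (mul_pos h0 h0) (by linarith : 0 < s + μ)]
    have : 1/(2*Λ) ≤ 1/2 := by
      rw [div_le_div_iff₀ (by positivity) (by positivity)]; linarith
    gcongr
  have pb3 : ∀ s, 0 < s → |p s / s| ≤ 1/(2*Λ) * (μ / (s + μ)^2) := by
    intro s hs
    rw [abs_div, abs_of_pos hs, div_le_iff₀ hs]
    refine (pb s hs).trans (le_of_eq (by ring))
  have hLB : LB (fun s => p s / s) := by
    refine ⟨fun s hs => (pc s hs).div continuousWithinAt_id (ne_of_gt hs), fun s hs => ⟨1/(2*Λ) * (μ/μ^2), fun t ht => ?_⟩⟩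
    have t0 := ht.1
    refine (pb3 t ht.1).trans ?_
    gcongr
    linarith
  obtain ⟨θ, hθ⟩ : ∃ θ : ℝ → ℝ, θ = fun s => ∫ t in (0:ℝ)..s, p t / t := ⟨_, rfl⟩
  have dθ : ∀ s, 0 < s → HasDerivAt θ (p s / s) s := fun s hs => by rw [hθ]; exact hLB.deriv s hs
  have θb : ∀ s, 0 < s → |θ s| ≤ 1/(2*Λ) := by
    intro s hs
    have db : ∀ s, 0 < s → HasDerivAt (fun s => 1/(2*Λ) * (s/(s+μ))) (1/(2*Λ) * (μ/(s+μ)^2)) s := by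
      intro s hs
      have hne : s + μ ≠ 0 := by positivity
      refine HasDerivAt.const_mul _ (HasDerivAt.congr_deriv ((hasDerivAt_id s).div ((hasDerivAt_id s).add_const μ) hne) ?_)
      simp
    have lb : Filter.Tendsto (fun s => 1/(2*Λ) * (s/(s+μ))) (nhdsWithin 0 (Ioi 0)) (nhds 0) := by
      refine tend0_of_bound (1/(2*Λ) * (1/μ)) (fun s hs _ => ?_)
      rw [abs_of_nonneg (by positivity)]
      calc 1/(2*Λ) * (s/(s+μ)) ≤ 1/(2*Λ) * (s/μ) := by gcongr; linarith
        _ = _ := by ring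
    have := cmp0abs dθ db (by rw [hθ]; exact hLB.lim) lb s hs (fun t ht => pb3 t ht.1)
    refine this.trans (mul_le_of_le_one_right (by positivity) ?_)
    rw [div_le_one (by positivity)]; linarith
  refine ⟨fun s => k0 μ s * exp (-θ s), hμℓ, hℓ, ?_, ?_, ?_, ?_, ?_⟩
  · intro s hs
    refine HasDerivAt.congr_deriv ((h.dk s hs).mul ((dθ s hs).neg.exp)) ?_
    rw [hp]
    simp only [Pi.neg_apply]
    field_simp
    ring
  · have := h.cR.sub pc
    rw [hp] at this
    exact this
  · intro s hs
    have := pb2 s hs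
    rw [hp] at this
    have q : 0 < μ/(s+μ) := by positivity
    have := (abs_le.1 this).2
    linarith
  · intro s hs
    have := pb2 s hs
    rw [hp] at this
    have q : 0 < μ/(s+μ) := by positivity
    have := (abs_le.1 this).1
    linarith
  · intro s hs
    have hk := k0_pos h0 hs
    have t1 := θb s hs
    have e : k0 μ s * exp (-θ s) - k0 μ s = (exp (-θ s) - 1) * k0 μ s := by ring
    rw [e, abs_mul, abs_of_pos hk]
    have t2 : 1/(2*Λ) ≤ 1/2 := by
      rw [div_le_div_iff₀ (by positivity) (by positivity)]; linarith
    have t3 := Real.abs_exp_sub_one_le (x := -θ s) (by rw [abs_neg]; linarith)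
    rw [abs_neg] at t3
    have t4 : 2 * (1/(2*Λ)) ≤ 4/ℓ := by
      have : 2 * (1/(2*Λ)) = 1/Λ := by field_simp
      rw [this, div_le_div_iff₀ (by positivity) (by positivity)]; linarith
    gcongr
    linarith

lemma convODE {n : ℕ} {β ν μ δ : ℝ} {P W f : ℝ → ℝ} (hβ : 0 < β) (hν : 0 < ν) (hμ : μ = β * ν^2/2)
    (Ps : ContDiffOn ℝ (⊤ : ℕ∞) P (Ioi 0)) (E : Eqs n δ (fun s => 2 * (μ / (s + μ)) - P (sqrt (2*s/β)) / 2) W f) :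
    ContDiffOn ℝ (⊤ : ℕ∞) (fun ζ => f (β * ζ^2/2)) (Ioi 0) ∧
    ∀ ζ ∈ Ioi (0:ℝ), AzetaBar ν β P (fun ζ => f (β * ζ^2/2)) ζ = 2 * β * (1 - n - δ) * f (β * ζ^2/2) := by
  obtain ⟨φ, hφ⟩ : ∃ φ : ℝ → ℝ, φ = fun ζ => f (β * ζ^2/2) := ⟨_, rfl⟩
  obtain ⟨Ψ, hΨ⟩ : ∃ Ψ : ℝ → ℝ, Ψ = fun ζ => W (β * ζ^2/2) := ⟨_, rfl⟩
  obtain ⟨G, hG⟩ : ∃ G : ℝ → ℝ, G = fun ζ => (-2 * (n + δ) * Ψ ζ + (2 + β * ζ^2 - 4 * ζ^2/(ζ^2+ν^2) - P ζ) * φ ζ) / ζ := ⟨_, rfl⟩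
  have ds : ∀ ζ : ℝ, HasDerivAt (fun ζ : ℝ => β * ζ^2/2) (β * ζ) ζ := by
    intro ζ
    refine HasDerivAt.congr_deriv ((((hasDerivAt_id ζ).pow 2).const_mul β).div_const 2) ?_
    simp; ring
  have dΨ : ∀ ζ, 0 < ζ → HasDerivAt Ψ (β * ζ * φ ζ) ζ := by
    intro ζ hζ
    rw [hΨ, hφ]
    exact ((E.dW (β * ζ^2/2) (by positivity)).comp ζ (ds ζ)).congr_deriv (by ring)
  have dφ : ∀ ζ, 0 < ζ → HasDerivAt φ (G ζ) ζ := by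
    intro ζ hζ
    have := (E.df (β * ζ^2/2) (by positivity)).comp ζ (ds ζ)
    rw [hG, hΨ, hφ]
    refine this.congr_deriv ?_
    have e : sqrt (2 * (β * ζ^2/2) / β) = ζ := by
      rw [show 2 * (β * ζ^2/2) / β = ζ^2 by field_simp]; exact sqrt_sq hζ.le
    simp only [e, hμ]
    have : ζ^2 + ν^2 ≠ 0 := by positivity
    have : β * ζ^2/2 + β * ν^2/2 ≠ 0 := by positivity
    field_simp
    ring
  have sm : ∀ m : ℕ, ContDiffOn ℝ m Ψ (Ioi 0) ∧ ContDiffOn ℝ m φ (Ioi 0) := by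
    intro m
    induction m with
    | zero =>
      constructor
      · simp only [Nat.cast_zero]
        exact contDiffOn_zero.2 (fun s hs => (dΨ s hs).continuousAt.continuousWithinAt)
      · simp only [Nat.cast_zero]
        exact contDiffOn_zero.2 (fun s hs => (dφ s hs).continuousAt.continuousWithinAt)
    | succ m ih =>
      have Pm : ContDiffOn ℝ m P (Ioi 0) := Ps.of_le (by exact_mod_cast le_top)
      constructor
      · rw [Nat.cast_succ, contDiffOn_succ_iff_deriv_of_isOpen isOpen_Ioi]
        refine ⟨fun s hs => (dΨ s hs).differentiableAt.differentiableWithinAt, by simp, ?_⟩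
        refine ContDiffOn.congr (f := fun ζ => β * ζ * φ ζ) ?_ (fun ζ hζ => (dΨ ζ hζ).deriv)
        exact ContDiffOn.mul (by fun_prop) ih.2
      · rw [Nat.cast_succ, contDiffOn_succ_iff_deriv_of_isOpen isOpen_Ioi]
        refine ⟨fun s hs => (dφ s hs).differentiableAt.differentiableWithinAt, by simp, ?_⟩
        refine ContDiffOn.congr (f := G) ?_ (fun ζ hζ => (dφ ζ hζ).deriv)
        rw [hG]
        refine ContDiffOn.div ?_ contDiffOn_id (fun ζ hζ => ne_of_gt hζ)
        refine ContDiffOn.add (ContDiffOn.mul contDiffOn_const ih.1) (ContDiffOn.mul ?_ ih.2)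
        refine ContDiffOn.sub (ContDiffOn.sub (by fun_prop) (ContDiffOn.div (by fun_prop) (by fun_prop) ?_)) Pm
        intro ζ hζ
        positivity
  rw [← hφ]
  refine ⟨contDiffOn_infty.2 (fun m => (sm m).2), ?_⟩
  intro ζ hζ
  have hζ : 0 < ζ := hζ
  have hφζ : f (β * ζ^2/2) = φ ζ := by rw [hφ]
  rw [hφζ]
  have d1 : deriv φ ζ = G ζ := (dφ ζ hζ).deriv
  have dP : HasDerivAt P (deriv P ζ) ζ :=
    ((Ps.contDiffAt (Ioi_mem_nhds hζ)).differentiableAt (by simp)).hasDerivAt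
  have hne : ζ^2 + ν^2 ≠ 0 := by positivity
  have dQ : HasDerivAt (fun ζ : ℝ => 4 * ζ^2/(ζ^2+ν^2)) (8 * ζ * ν^2 / (ζ^2+ν^2)^2) ζ := by
    refine HasDerivAt.congr_deriv ((((hasDerivAt_id ζ).pow 2).const_mul 4).div (((hasDerivAt_id ζ).pow 2).add_const (ν^2)) hne) ?_
    simp; field_simp; ring
  have dN : HasDerivAt (fun ζ => -2 * (n + δ) * Ψ ζ + (2 + β * ζ^2 - 4 * ζ^2/(ζ^2+ν^2) - P ζ) * φ ζ)
      (-2 * (n + δ) * (β * ζ * φ ζ) + ((2 * β * ζ - 8 * ζ * ν^2 / (ζ^2+ν^2)^2 - deriv P ζ) * φ ζ + (2 + β * ζ^2 - 4 * ζ^2/(ζ^2+ν^2) - P ζ) * G ζ)) ζ := by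
    have d0 : HasDerivAt (fun ζ : ℝ => 2 + β * ζ^2) (2 * β * ζ) ζ := by
      refine HasDerivAt.congr_deriv ((((hasDerivAt_id ζ).pow 2).const_mul β).const_add 2) ?_
      simp; ring
    exact ((dΨ ζ hζ).const_mul (-2 * ((n:ℝ) + δ))).add (((d0.sub dQ).sub dP).mul (dφ ζ hζ))
  have dG : HasDerivAt G (((-2 * (n + δ) * (β * ζ * φ ζ) + ((2 * β * ζ - 8 * ζ * ν^2 / (ζ^2+ν^2)^2 - deriv P ζ) * φ ζ + (2 + β * ζ^2 - 4 * ζ^2/(ζ^2+ν^2) - P ζ) * G ζ)) * ζ - (ζ * G ζ) * 1) / ζ^2) ζ := by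
    have := dN.div (hasDerivAt_id ζ) hζ.ne'
    have e : -2 * (n + δ) * Ψ ζ + (2 + β * ζ^2 - 4 * ζ^2/(ζ^2+ν^2) - P ζ) * φ ζ = ζ * G ζ := by
      simp only [hG]; rw [mul_div_cancel₀ _ hζ.ne']
    rw [e] at this
    simp only [id] at this
    refine HasDerivAt.congr_of_eventuallyEq this (Filter.Eventually.of_forall (fun x => ?_))
    rw [hG]; rfl
  have d2 : deriv (deriv φ) ζ = deriv G ζ := by
    refine Filter.EventuallyEq.deriv_eq ?_
    filter_upwards [Ioi_mem_nhds hζ] with x hx using (dφ x hx).deriv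
  have d3 : deriv (Qnu ν) ζ = 8 * ζ * ν^2 / (ζ^2+ν^2)^2 := dQ.deriv
  have d4 : deriv (fun s => P s * φ s) ζ = deriv P ζ * φ ζ + P ζ * G ζ := (dP.mul (dφ ζ hζ)).deriv
  have hGζ : G ζ = (-2 * (n + δ) * Ψ ζ + (2 + β * ζ^2 - 4 * ζ^2/(ζ^2+ν^2) - P ζ) * φ ζ) / ζ := by rw [hG]
  unfold AzetaBar Azeta
  rw [d2, d1, d3, d4, dG.deriv]
  simp only [Qnu]
  generalize deriv P ζ = P'
  rw [hGζ]
  generalize Ψ ζ = a, φ ζ = b, P ζ = p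
  field_simp
  ring

lemma omega_eq {ν β μ ζ : ℝ} (hβ : 0 < β) (hν : 0 < ν) (hμ : μ = β * ν^2/2) (hζ : 0 < ζ) :
    omegaNu ν β ζ / ζ = β * ζ * (1/(4*β^2) * wt μ (β * ζ^2/2)) := by
  have h1 : ν^2 + ζ^2 ≠ 0 := by positivity
  have h2 : β * ζ^2/2 + β * ν^2/2 ≠ 0 := by positivity
  unfold omegaNu Unu wt k0
  rw [hμ, show -β * ζ^2/2 = -(β * ζ^2/2) by ring]
  field_simp
  ring

lemma cov {ν β μ : ℝ} (hβ : 0 < β) (hν : 0 < ν) (hμ : μ = β * ν^2/2) (g : ℝ → ℝ) :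
    (IntegrableOn (fun s => g s ^ 2 * wt μ s) (Ioi 0) →
      IntegrableOn (fun ζ => g (β * ζ^2/2) ^ 2 * (omegaNu ν β ζ / ζ)) (Ioi 0)) ∧
    nrm ν β (fun ζ => g (β * ζ^2/2)) = sqrt (1/(4*β^2) * ∫ s in Ioi 0, g s ^ 2 * wt μ s) := by
  have ds : ∀ ζ : ℝ, HasDerivAt (fun ζ : ℝ => β * ζ^2/2) (β * ζ) ζ := by
    intro ζ
    refine HasDerivAt.congr_deriv ((((hasDerivAt_id ζ).pow 2).const_mul β).div_const 2) ?_
    simp; ring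
  have im : (fun ζ : ℝ => β * ζ^2/2) '' Ioi 0 = Ioi 0 := by
    ext s
    constructor
    · rintro ⟨ζ, hζ, rfl⟩
      have hζ : 0 < ζ := hζ
      show 0 < β * ζ^2/2
      positivity
    · intro hs
      have hs : 0 < s := hs
      refine ⟨sqrt (2*s/β), ?_, ?_⟩
      · show 0 < sqrt (2*s/β)
        positivity
      · simp only
        rw [sq_sqrt (by positivity)]; field_simp
  have inj : InjOn (fun ζ : ℝ => β * ζ^2/2) (Ioi 0) := by
    intro a ha b hb hab
    have ha : 0 < a := ha
    have hb : 0 < b := hb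
    simp only at hab
    have : a^2 = b^2 := by
      have : β * (a^2 - b^2) = 0 := by linarith
      rcases mul_eq_zero.1 this with h | h <;> linarith
    exact (pow_left_inj₀ ha.le hb.le (by norm_num)).1 this
  let h : ℝ → ℝ := fun s => 1/(4*β^2) * (g s ^ 2 * wt μ s)
  have e : ∀ ζ ∈ Ioi (0:ℝ), |β * ζ| • h (β * ζ^2/2) = g (β * ζ^2/2) ^ 2 * (omegaNu ν β ζ / ζ) := by
    intro ζ hζ
    have hζ : 0 < ζ := hζ
    rw [omega_eq hβ hν hμ hζ, abs_of_pos (by positivity), smul_eq_mul]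
    simp only [h]; ring
  constructor
  · intro hi
    have hi2 : IntegrableOn h ((fun ζ : ℝ => β * ζ^2/2) '' Ioi 0) := by rw [im]; exact hi.const_mul _
    rw [integrableOn_image_iff_integrableOn_abs_deriv_smul measurableSet_Ioi (fun x _ => (ds x).hasDerivWithinAt) inj] at hi2
    exact hi2.congr_fun e measurableSet_Ioi
  · unfold nrm
    congr 1
    rw [← setIntegral_congr_fun measurableSet_Ioi e,
      ← integral_image_eq_integral_abs_deriv_smul measurableSet_Ioi (fun x _ => (ds x).hasDerivWithinAt) inj h, im]
    exact integral_const_mul _ _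

theorem pairN (N : ℕ) : ∃ C ℓ0 : ℝ, 1 ≤ C ∧ 0 ≤ ℓ0 ∧ ∀ n : ℕ, n ≤ N → ∀ (μ ℓ : ℝ) (k R k' R' : ℝ → ℝ), KData μ ℓ k R → KData μ ℓ k' R' → ℓ0 ≤ ℓ →
    ∃ (δ δ' : ℝ) (W f W' f' : ℝ → ℝ), |δ - 1/ℓ| ≤ C/ℓ^2 ∧ |δ' - 1/ℓ| ≤ C/ℓ^2 ∧ Eqs n δ R W f ∧ Eqs n δ' R' W' f' ∧
      IntegrableOn (fun s => f s ^ 2 * wt μ s) (Ioi 0) ∧ IntegrableOn (fun s => f' s ^ 2 * wt μ s) (Ioi 0) ∧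
      ℓ ≤ C * ∫ s in Ioi 0, f s ^ 2 * wt μ s ∧ ℓ ≤ C * ∫ s in Ioi 0, f' s ^ 2 * wt μ s ∧
      ∫ s in Ioi 0, (f' s - f s) ^ 2 * wt μ s ≤ C := by
  choose C ℓ0 hC H using pair
  have hCm : ∀ n ≤ N, C n ≤ ∑ i ∈ Finset.range (N+1), C i := fun n hn =>
    Finset.single_le_sum (f := C) (fun i _ => by linarith [hC i]) (Finset.mem_range.2 (by omega))
  refine ⟨∑ i ∈ Finset.range (N+1), C i, ∑ i ∈ Finset.range (N+1), |ℓ0 i|, (hC 0).trans (hCm 0 (Nat.zero_le _)),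
    Finset.sum_nonneg (fun _ _ => abs_nonneg _), ?_⟩
  intro n hn μ ℓ k R k' R' h h' hℓ
  have q : ℓ0 n ≤ ℓ := (le_abs_self _).trans ((Finset.single_le_sum (f := fun i => |ℓ0 i|) (fun i _ => abs_nonneg _)
    (Finset.mem_range.2 (by omega : n < N+1))).trans hℓ)
  obtain ⟨δ, δ', W, f, W', f', r1, r1', r2, r2', r3, r3', r4, r4', r5⟩ := H n μ ℓ k R k' R' h h' q
  have hl := h.ℓ0
  have hc := hCm n hn
  have pos : ∀ g : ℝ → ℝ, 0 ≤ ∫ s in Ioi 0, g s ^ 2 * wt μ s := fun g =>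
    setIntegral_nonneg measurableSet_Ioi (fun t ht => mul_nonneg (sq_nonneg _) (wt_nonneg h.μ0 ht))
  have m1 : C n / ℓ^2 ≤ (∑ i ∈ Finset.range (N+1), C i) / ℓ^2 := by gcongr
  exact ⟨δ, δ', W, f, W', f', r1.trans m1, r1'.trans m1, r2, r2', r3, r3',
    r4.trans (mul_le_mul_of_nonneg_right hc (pos f)), r4'.trans (mul_le_mul_of_nonneg_right hc (pos f')), r5.trans hc⟩

lemma nz {β μ ℓ C : ℝ} (hβ : 0 < β) (hl : 0 < ℓ) {f : ℝ → ℝ} (h : ℓ ≤ C * ∫ s in Ioi 0, f s ^ 2 * wt μ s) :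
    ∃ ζ ∈ Ioi (0:ℝ), f (β * ζ^2/2) ≠ 0 := by
  by_contra hcon
  push Not at hcon
  have : ∫ s in Ioi (0:ℝ), f s ^ 2 * wt μ s = ∫ s in Ioi (0:ℝ), (0:ℝ) := by
    refine setIntegral_congr_fun measurableSet_Ioi (fun s hs => ?_)
    have hs : 0 < s := hs
    have := hcon (sqrt (2*s/β)) (show 0 < sqrt (2*s/β) by positivity)
    rw [sq_sqrt (by positivity), show β * (2*s/β) / 2 = s by field_simp] at this
    simp [this]
  rw [this] at h
  simp at h
  linarith

lemma ratio {C B Λ b I J t : ℝ} (hC : 1 ≤ C) (hΛ0 : 0 < Λ) (hB0 : 0 ≤ B) (hb : 0 < b) (r4 : Λ ≤ C * I) (r5 : J ≤ C) (ht : 0 ≤ t) :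
    t * sqrt J ≤ (C + B + 4 * b * C + 1) / sqrt Λ * (t * sqrt I) := by
  have hC0 : 0 < C := by linarith
  have h1 : sqrt Λ ≤ sqrt C * sqrt I := by
    rw [← sqrt_mul hC0.le]; exact sqrt_le_sqrt r4
  have h2 : sqrt J ≤ sqrt C := sqrt_le_sqrt r5
  have hsΛ : 0 < sqrt Λ := sqrt_pos.2 hΛ0
  have h3 : sqrt C ≤ (C + B + 4 * b * C + 1) / sqrt Λ * sqrt I := by
    rw [div_mul_eq_mul_div, le_div_iff₀ hsΛ]
    calc sqrt C * sqrt Λ ≤ sqrt C * (sqrt C * sqrt I) := by gcongr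
      _ = C * sqrt I := by rw [← mul_assoc, mul_self_sqrt hC0.le]
      _ ≤ _ := mul_le_mul_of_nonneg_right (by nlinarith [mul_pos hb hC0]) (sqrt_nonneg _)
  calc t * sqrt J ≤ t * ((C + B + 4 * b * C + 1) / sqrt Λ * sqrt I) := mul_le_mul_of_nonneg_left (h2.trans h3) ht
    _ = _ := by ring

theorem statement15 (N : ℕ) (βs βS : ℝ) (hβs : 0 < βs) (hβ : βs < βS) :
    ∃ C' : ℝ, 0 < C' ∧ ∃ νstar : ℝ, νstar ∈ Set.Ioo (0:ℝ) 1 ∧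
      ∀ β : ℝ, β ∈ Set.Icc βs βS → ∀ ν : ℝ, 0 < ν → ν ≤ νstar →
        ∀ P : ℝ → ℝ, ContDiffOn ℝ (⊤ : ℕ∞) P (Set.Ioi 0) →
          (∀ ζ : ℝ, 0 < ζ →
            |P ζ| + |ζ * deriv P ζ| ≤ ν ^ 2 / |Real.log ν| * ζ ^ 2 / (ν ^ 2 + ζ ^ 2) ^ 2) →
          ∀ n : ℕ, n ≤ N →
            ∃ lam lamBar : ℝ, ∃ φ φBar : ℝ → ℝ,
              -- λ_{n,ν} = 2β(1 − n + 1/(2 ln ν) + O(1/|ln ν|²))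
              (∃ ρ : ℝ, |ρ| ≤ C' / (Real.log ν) ^ 2 ∧
                lam = 2 * β * (1 - (n : ℝ) + 1 / (2 * Real.log ν) + ρ)) ∧
              -- eigenpair of 𝒜^ζ
              ContDiffOn ℝ (⊤ : ℕ∞) φ (Set.Ioi 0) ∧
              (∃ ζ ∈ Set.Ioi (0:ℝ), φ ζ ≠ 0) ∧
              MeasureTheory.IntegrableOn
                (fun ζ => (φ ζ) ^ 2 * (omegaNu ν β ζ / ζ)) (Set.Ioi 0) ∧
              (∀ ζ ∈ Set.Ioi (0:ℝ), Azeta ν β φ ζ = lam * φ ζ) ∧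
              -- eigenpair of the perturbed operator 𝒜̄^ζ
              ContDiffOn ℝ (⊤ : ℕ∞) φBar (Set.Ioi 0) ∧
              (∃ ζ ∈ Set.Ioi (0:ℝ), φBar ζ ≠ 0) ∧
              MeasureTheory.IntegrableOn
                (fun ζ => (φBar ζ) ^ 2 * (omegaNu ν β ζ / ζ)) (Set.Ioi 0) ∧
              (∀ ζ ∈ Set.Ioi (0:ℝ), AzetaBar ν β P φBar ζ = lamBar * φBar ζ) ∧
              -- stability estimates
              |lamBar - lam| ≤ C' / (Real.log ν) ^ 2 ∧
              nrm ν β (fun ζ => φBar ζ - φ ζ)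
                ≤ C' / Real.sqrt |Real.log ν| * nrm ν β φ := by
  obtain ⟨C, ℓ0, hC, hℓ0, H⟩ := pairN N
  obtain ⟨B, hB⟩ : ∃ B, B = |log (βs/2)| + |log (βS/2)| := ⟨_, rfl⟩
  have hB0 : 0 ≤ B := by rw [hB]; positivity
  have hβS : 0 < βS := by linarith
  refine ⟨C + B + 4 * βS * C + 1, by positivity, exp (-(B + 65 + ℓ0)), ⟨by positivity, ?_⟩, ?_⟩
  · rw [exp_lt_one_iff]; linarith
  intro β hβ ν hν hνs P Ps hP n hn
  have β0 : 0 < β := by linarith [hβ.1]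
  obtain ⟨Λ, hΛ⟩ : ∃ Λ, Λ = |log ν| := ⟨_, rfl⟩
  have hlog : log ν ≤ -(B + 65 + ℓ0) := by
    have := log_le_log hν hνs
    rwa [log_exp] at this
  have hΛ2 : log ν = -Λ := by rw [hΛ, abs_of_neg (by linarith)]; ring
  have hΛ3 : B + 65 + ℓ0 ≤ Λ := by linarith
  have hΛ0 : 0 < Λ := by linarith
  obtain ⟨μ, hμ⟩ : ∃ μ, μ = β * ν^2/2 := ⟨_, rfl⟩
  have hμ0 : 0 < μ := by rw [hμ]; positivity
  obtain ⟨ℓ, hℓ⟩ : ∃ ℓ, ℓ = -log μ := ⟨_, rfl⟩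
  have hμℓ : μ = exp (-ℓ) := by rw [hℓ, neg_neg, exp_log hμ0]
  have hℓ2 : ℓ = 2 * Λ - log (β/2) := by
    rw [hℓ, hμ, show β * ν^2/2 = ν^2 * (β/2) by ring, log_mul (by positivity) (by positivity), log_pow, hΛ2]
    push_cast; ring
  have hlb : |log (β/2)| ≤ B := by
    have l1 : log (βs/2) ≤ log (β/2) := log_le_log (by positivity) (by linarith [hβ.1])
    have l2 : log (β/2) ≤ log (βS/2) := log_le_log (by positivity) (by linarith [hβ.2])
    rw [hB, abs_le]
    have a1 := neg_abs_le (log (βs/2))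
    have a2 := le_abs_self (log (βS/2))
    have a3 := abs_nonneg (log (βs/2))
    have a4 := abs_nonneg (log (βS/2))
    constructor <;> linarith
  obtain ⟨lb1, lb2⟩ := abs_le.1 hlb
  have hℓΛ : Λ ≤ ℓ := by linarith
  have hl : 0 < ℓ := by linarith
  have hℓ4 : ℓ ≤ 4 * Λ := by linarith
  obtain ⟨k, hk⟩ := kdataP (P := fun _ => 0) β0 hν hΛ hμ hμℓ (by linarith) (by linarith) hℓ4 continuousOn_const
    (fun ζ hζ => by simp only [abs_zero]; positivity)
  obtain ⟨k', hk'⟩ := kdataP (P := P) β0 hν hΛ hμ hμℓ (by linarith) (by linarith) hℓ4 Ps.continuousOn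
    (fun ζ hζ => (le_add_of_nonneg_right (abs_nonneg _)).trans (hP ζ hζ))
  obtain ⟨δ, δ', W, f, W', f', r1, r1', r2, r2', r3, r3', r4, r4', r5⟩ := H n hn μ ℓ k _ k' _ hk hk' (by linarith)
  obtain ⟨s1, s2⟩ := convODE β0 hν hμ contDiffOn_const r2
  obtain ⟨s1', s2'⟩ := convODE β0 hν hμ Ps r2'
  have hΛsq : C / ℓ^2 ≤ C / Λ^2 := by gcongr
  have hlsq : log ν ^ 2 = Λ^2 := by rw [hΛ2]; ring
  rw [hlsq]
  refine ⟨2 * β * (1 - n - δ), 2 * β * (1 - n - δ'), fun ζ => f (β * ζ^2/2), fun ζ => f' (β * ζ^2/2),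
    ⟨-δ - 1/(2 * log ν), ?_, by ring⟩, s1, nz β0 hl r4, (cov β0 hν hμ f).1 r3, ?_, s1', nz β0 hl r4', (cov β0 hν hμ f').1 r3', s2', ?_, ?_⟩
  · have e : -δ - 1/(2 * log ν) = -(δ - 1/ℓ) + (1/(2*Λ) - 1/ℓ) := by
      rw [hΛ2]; field_simp; ring
    have e2 : 1/(2*Λ) - 1/ℓ = -log (β/2) / (2 * Λ * ℓ) := by
      rw [hℓ2] at hl ⊢
      field_simp; ring
    have e3 : |1/(2*Λ) - 1/ℓ| ≤ B / Λ^2 := by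
      rw [e2, abs_div, abs_neg, abs_of_pos (by positivity : 0 < 2 * Λ * ℓ)]
      have : Λ^2 ≤ 2 * Λ * ℓ := by nlinarith
      gcongr
    rw [e]
    refine (abs_add_le _ _).trans ?_
    rw [abs_neg]
    calc _ ≤ C / Λ^2 + B / Λ^2 := by linarith
      _ = (C + B) / Λ^2 := by ring
      _ ≤ _ := div_le_div_of_nonneg_right (by nlinarith [mul_pos hβS (show 0 < C by linarith)]) (by positivity)
  · intro ζ hζ
    have := s2 ζ hζ
    unfold AzetaBar at this
    simpa using this
  · have e : 2 * β * (1 - n - δ') - 2 * β * (1 - n - δ) = 2 * β * ((δ - 1/ℓ) - (δ' - 1/ℓ)) := by ring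
    rw [e, abs_mul, abs_of_pos (by positivity)]
    have := abs_sub (δ - 1/ℓ) (δ' - 1/ℓ)
    calc _ ≤ 2 * βS * (2 * (C / Λ^2)) := by
          refine mul_le_mul (by linarith [hβ.2]) (by linarith) (abs_nonneg _) (by positivity)
      _ = 4 * βS * C / Λ^2 := by ring
      _ ≤ _ := div_le_div_of_nonneg_right (by linarith) (by positivity)
  · rw [(cov β0 hν hμ (fun s => f' s - f s)).2, (cov β0 hν hμ f).2, ← hΛ, sqrt_mul (by positivity), sqrt_mul (by positivity)]
    exact ratio hC hΛ0 hB0 hβS (by linarith) r5 (sqrt_nonneg _)
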